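/- Fix θ₀ = (σ₀,δ₀,α₀) with σ₀ > 0, δ₀ > 0 and α₀ ∈ (0,2), and for r > 0 let V_n^{(r)} = {θ = (σ,δ,α) : ‖u_n(θ₀)^{-1}(θ − θ₀)‖ ≤ r}. Let J_n(θ) be the Hessian matrix in θ of ln L_n(θ). Then for every r > 0, the random variable sup_{θ ∈ V_n^{(r)}} ‖u_n(θ₀)ᵀ (J_n(θ) − J_n(θ₀)) u_n(θ₀)‖ converges to 0 in ℙ_n-probability as n → ∞. -/

import Mathlib

open MeasureTheory Filter Set Topology Matrix

noncomputable section

namespace LevyLAN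

/-- Standard Gaussian density `φ`. -/
def gauss (y : ℝ) : ℝ := (Real.sqrt (2 * Real.pi))⁻¹ * Real.exp (-(y ^ 2) / 2)

/-- Symmetric `α`-stable density `φ_α`, defined by Fourier inversion. -/
def stableDensity (α z : ℝ) : ℝ :=
  (2 * Real.pi)⁻¹ * ∫ u : ℝ, Real.cos (z * u) * Real.exp (-(|u| ^ α))

/-- `∂_α φ_α`. -/
def stableDensityDalpha (α z : ℝ) : ℝ :=
  -(2 * Real.pi)⁻¹ * ∫ u : ℝ, Real.cos (z * u) * |u| ^ α * Real.log |u| * Real.exp (-(|u| ^ α))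

/-- The operator `(D f) y = (y * f y)' = f y + y * f' y`. -/
def Dop (f : ℝ → ℝ) (y : ℝ) : ℝ := f y + y * deriv f y

/-- `f_α(y, w)`. -/
def fFun (α y w : ℝ) : ℝ := ∫ z : ℝ, gauss (y - w * z) * stableDensity α z

/-- `g_α(y, w)`. -/
def gFun (α y w : ℝ) : ℝ := ∫ z : ℝ, Dop gauss (y - w * z) * stableDensity α z

/-- `h_α(y, w)`. -/
def hFun (α y w : ℝ) : ℝ := ∫ z : ℝ, gauss (y - w * z) * Dop (stableDensity α) z

/-- `k_α(y, w)`. -/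
def kFun (α y w : ℝ) : ℝ := ∫ z : ℝ, gauss (y - w * z) * stableDensityDalpha α z

/-- `c_α`. -/
def cAlpha (α : ℝ) : ℝ :=
  if α = 1 then 1 / Real.pi
  else -(α * (α - 1)) / (2 * Real.Gamma (2 - α) * Real.cos (Real.pi * α / 2))

/-- `w_n(θ) = n^{1/2 - 1/α} δ / σ`. -/
def wn (n : ℕ) (σ δ α : ℝ) : ℝ := (n : ℝ) ^ ((1 : ℝ) / 2 - 1 / α) * δ / σ

/-- `l_α(y, w)` (it depends on `n`). -/
def lFun (n : ℕ) (α y w : ℝ) : ℝ :=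
  ((Real.log n - Real.log (Real.log n)) / (2 * α) - Real.log n / α ^ 2) * hFun α y w
    + kFun α y w

def kappa0 (σ δ α : ℝ) : ℝ := 2 * cAlpha α / (α * (2 - α) ^ (α / 2)) * (δ / σ) ^ α

def kappa1 (σ δ α : ℝ) : ℝ :=
  Real.log (δ / σ) + deriv cAlpha α / cAlpha α - Real.log (2 - α) / 2 - 1 / α

/-- The density `p_{1/n}(y, θ)`, with parameter `θ = (σ, δ, α) : Fin 3 → ℝ`. -/
def pdens (n : ℕ) (θ : Fin 3 → ℝ) (y : ℝ) : ℝ :=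
  Real.sqrt n / θ 0 * fFun (θ 2) (Real.sqrt n * y / θ 0) (wn n (θ 0) (θ 1) (θ 2))

/-- The log-likelihood `ln L_n(θ)`. -/
def logLik (n : ℕ) (θ : Fin 3 → ℝ) (x : Fin n → ℝ) : ℝ :=
  ∑ i, Real.log (pdens n θ (x i))

/-- Partial derivative in the `j`-th parameter coordinate. -/
def pderiv (j : Fin 3) (F : (Fin 3 → ℝ) → ℝ) (θ : Fin 3 → ℝ) : ℝ :=
  deriv (fun t => F (Function.update θ j t)) (θ j)

/-- The score `G_n(θ) = ∇_θ ln L_n(θ)`. -/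
def scoreVec (n : ℕ) (θ : Fin 3 → ℝ) (x : Fin n → ℝ) : Fin 3 → ℝ :=
  fun j => pderiv j (fun θ' => logLik n θ' x) θ

/-- The Hessian matrix `J_n(θ)` of the log-likelihood. -/
def hessMat (n : ℕ) (θ : Fin 3 → ℝ) (x : Fin n → ℝ) : Matrix (Fin 3) (Fin 3) ℝ :=
  Matrix.of fun i j => pderiv i (fun θ' => pderiv j (fun θ'' => logLik n θ'' x) θ') θ

def rate (n : ℕ) (α : ℝ) : ℝ := Real.log n ^ (α / 4) / (n : ℝ) ^ (α / 4)

/-- The rate matrix `u_n(θ)`. -/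
def un (n : ℕ) (θ : Fin 3 → ℝ) : Matrix (Fin 3) (Fin 3) ℝ :=
  !![1 / Real.sqrt n, 0, 0;
     0, rate n (θ 2), -(rate n (θ 2) * (θ 1 / (2 * θ 2)) * (Real.log n - Real.log (Real.log n)));
     0, 0, rate n (θ 2)]

/-- The information matrix `I(θ)`. -/
def Imat (θ : Fin 3 → ℝ) : Matrix (Fin 3) (Fin 3) ℝ :=
  !![2 / θ 0 ^ 2, 0, 0;
     0, θ 2 ^ 2 / θ 1 ^ 2 * kappa0 (θ 0) (θ 1) (θ 2),
        θ 2 / θ 1 * kappa0 (θ 0) (θ 1) (θ 2) * kappa1 (θ 0) (θ 1) (θ 2);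
     0, θ 2 / θ 1 * kappa0 (θ 0) (θ 1) (θ 2) * kappa1 (θ 0) (θ 1) (θ 2),
        kappa0 (θ 0) (θ 1) (θ 2) * (kappa1 (θ 0) (θ 1) (θ 2) ^ 2 + 1 / θ 2 ^ 2)]

/-- `ℙ_n`, the `n`-fold product of the law with Lebesgue density `p_{1/n}(·, θ)`. -/
def Pn (n : ℕ) (θ : Fin 3 → ℝ) : Measure (Fin n → ℝ) :=
  Measure.pi fun _ => MeasureTheory.volume.withDensity fun y => ENNReal.ofReal (pdens n θ y)

/-- The standard Gaussian measure on `ℝ³`. -/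
def stdGauss3 : Measure (Fin 3 → ℝ) :=
  Measure.pi fun _ => ProbabilityTheory.gaussianReal 0 1

/-- Euclidean (Frobenius) norm of a real 3×3 matrix. -/
def frobNorm (M : Matrix (Fin 3) (Fin 3) ℝ) : ℝ := Real.sqrt (∑ i, ∑ j, M i j ^ 2)

/-- Euclidean norm of a vector of `ℝ³`. -/
def vecNorm (v : Fin 3 → ℝ) : ℝ := Real.sqrt (∑ j, v j ^ 2)

/-- The admissible families of functions `ψ_α^{(p)}`. -/
structure IsPsiFamily (ψ : ℝ → ℕ → ℝ → ℝ) : Prop where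
  contDiff : ∀ α ∈ Set.Ioo (0 : ℝ) 2, ∀ p : ℕ, ContDiff ℝ 2 (ψ α p)
  pos : ∀ α ∈ Set.Ioo (0 : ℝ) 2, ∀ p : ℕ, ∀ y : ℝ, 0 < ψ α p y
  even : ∀ α ∈ Set.Ioo (0 : ℝ) 2, ∀ p : ℕ, ∀ y : ℝ, ψ α p (-y) = ψ α p y
  eq_one : ∀ α ∈ Set.Ioo (0 : ℝ) 2, ∀ p : ℕ, ∀ y : ℝ, |y| ≤ 1 → ψ α p y = 1
  eq_tail : ∀ α ∈ Set.Ioo (0 : ℝ) 2, ∀ p : ℕ, ∀ y : ℝ, 3 ≤ |y| →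
    ψ α p y = Real.log |y| ^ p / |y| ^ (α + 1)
  unifBound : ∀ K : Set ℝ, K ⊆ Set.Ioo (0 : ℝ) 2 → IsCompact K → ∀ p : ℕ,
    ∃ c > (0 : ℝ), ∃ C : ℝ, ∀ α ∈ K, ∀ y : ℝ, 1 ≤ |y| → |y| ≤ 3 →
      c ≤ ψ α p y ∧ ψ α p y ≤ C

/-- `𝓘_α^{(k,l)}`. -/
def Ical (ψ : ℝ → ℕ → ℝ → ℝ) (α : ℝ) (k l : ℕ) (y : ℝ) : ℝ :=
  ∫ z in {z : ℝ | 1 < |z|}, Dop^[k] gauss (y - z) * ψ α l z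

/-- `f_α^{(k,l,m)}`. -/
def fklm (α : ℝ) (k l m : ℕ) (y w : ℝ) : ℝ :=
  ∫ z : ℝ, Dop^[k] gauss (y - w * z)
    * Dop^[l] (fun z' => iteratedDeriv m (fun a => stableDensity a z') α) z

def Gamman (n : ℕ) (α : ℝ) : ℝ := Real.sqrt ((1 - α / 2) * Real.log n)

def Mn (n : ℕ) (α : ℝ) : ℝ := Real.sqrt ((2 - α) * Real.log n)

def Kconst (σ δ α : ℝ) : ℝ := deriv cAlpha α + cAlpha α * Real.log (δ / σ)



/-! ### The working context: fixed true parameter and small slack exponent -/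

/-- Fixed true parameter, slack exponent `τ` and truncation exponent `K`. -/
structure Ctx where
  s0 : ℝ
  d0 : ℝ
  a0 : ℝ
  τ : ℝ
  K : ℝ
  hs : 0 < s0
  hd : 0 < d0
  ha : 0 < a0
  ha2 : a0 < 2
  hτ : 0 < τ
  hτ1 : 4 * τ ≤ a0
  hK : K = 12 / a0
  hτ2 : a0 / 2 - 1 + (3 * K + 6) * τ < 0
  hτ3 : -a0 / 4 + (9 * K + 20) * τ < 0

/-- Tail exponent. -/
def Ctx.β (P : Ctx) : ℝ := P.a0 - 2 * P.τ

/-- Fixed neighbourhood of the true parameter. -/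
def Ctx.U (P : Ctx) (σ δ α : ℝ) : Prop :=
  P.s0 / 2 < σ ∧ σ < 2 * P.s0 ∧ P.d0 / 2 < δ ∧ δ < 2 * P.d0 ∧ P.a0 - P.τ < α ∧ α < P.a0 + P.τ

def Ctx.Lam (P : Ctx) (n : ℕ) : ℝ := (n : ℝ) ^ (P.a0 / 2 - 1 + P.τ)

lemma Ctx.K_pos (P : Ctx) : 0 < P.K := by
  rw [P.hK]; have := P.ha; positivity

lemma Ctx.τ_lt (P : Ctx) : P.a0 / 2 - 1 + 6 * P.τ < 0 := by
  have := P.hτ2; have := mul_pos P.K_pos P.hτ; nlinarith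

lemma Ctx.τ_lt1 (P : Ctx) : P.τ < 1 / 2 := by
  have := P.hτ1; have := P.ha2; linarith

lemma Ctx.β_pos (P : Ctx) : 0 < P.β := by
  have := P.hτ1; have := P.ha; unfold Ctx.β; linarith

lemma Ctx.β_lt (P : Ctx) : P.β < 2 := by
  have := P.hτ; have := P.ha2; unfold Ctx.β; linarith

lemma Ctx.Lam_pos (P : Ctx) {n : ℕ} (hn : 1 ≤ n) : 0 < P.Lam n := by
  have : (0 : ℝ) < n := by exact_mod_cast hn
  unfold Ctx.Lam; positivity

lemma Ctx.Lam_le (P : Ctx) {n : ℕ} (hn : 1 ≤ n) : P.Lam n ≤ 1 := by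
  have h1 : (1 : ℝ) ≤ n := by exact_mod_cast hn
  have h := P.τ_lt; have := P.hτ
  exact Real.rpow_le_one_of_one_le_of_nonpos h1 (by linarith)

lemma Ctx.U.pos {P : Ctx} {σ δ α : ℝ} (h : P.U σ δ α) : 0 < σ ∧ 0 < δ ∧ 0 < α ∧ α < 2 := by
  obtain ⟨h1, h2, h3, h4, h5, h6⟩ := h
  have := P.hs; have := P.hd; have := P.hτ1; have := P.ha; have := P.τ_lt; have := P.hτ
  refine ⟨by linarith, by linarith, by linarith, by linarith⟩

/-! ### Fourier integrands -/

def ell (n : ℕ) (δ u : ℝ) : ℝ := Real.log n / 2 + Real.log δ + Real.log u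

def LL (n : ℕ) (δ α u : ℝ) : ℝ := Real.exp (α * ell n δ u) / n

/-- The basic monomials. -/
def MM (a b c : ℕ) (t : ℝ) (n : ℕ) (σ δ α u : ℝ) : ℝ :=
  u ^ (2 * a) * LL n δ α u ^ b * ell n δ u ^ c *
    Real.exp (-(σ ^ 2 * u ^ 2) / 2 - t ^ 2 * LL n δ α u)

/-- The basic cosine integrals. -/
def JJ (a b c : ℕ) (t : ℝ) (n : ℕ) (x σ δ α : ℝ) : ℝ :=
  Real.pi⁻¹ * ∫ u in Ioi (0 : ℝ), Real.cos (u * x) * MM a b c t n σ δ α u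

lemma LL_nonneg (n : ℕ) (δ α u : ℝ) : 0 ≤ LL n δ α u := by unfold LL; positivity

lemma LL_eq {n : ℕ} (hn : 1 ≤ n) {δ u : ℝ} (α : ℝ) (hδ : 0 < δ) (hu : 0 < u) :
    LL n δ α u = (n : ℝ) ^ (α / 2 - 1) * δ ^ α * u ^ α := by
  have hn' : (0 : ℝ) < n := by exact_mod_cast hn
  unfold LL ell
  rw [Real.rpow_sub hn', Real.rpow_one, Real.rpow_def_of_pos hn', Real.rpow_def_of_pos hδ,
    Real.rpow_def_of_pos hu, div_mul_eq_mul_div, div_mul_eq_mul_div, ← Real.exp_add,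
    ← Real.exp_add]
  congr 2; ring

lemma poly_exp_le (m : ℕ) {κ : ℝ} (hκ : 0 < κ) :
    ∃ C > 0, ∀ u : ℝ, 0 ≤ u → (1 + u) ^ m * Real.exp (-(κ * u ^ 2)) ≤ C * Real.exp (-u) := by
  refine ⟨m.factorial * Real.exp (1 + 1 / κ), by positivity, fun u hu => ?_⟩
  have h1 : (1 + u) ^ m ≤ m.factorial * Real.exp (1 + u) := by
    have := Real.pow_div_factorial_le_exp (1 + u) (by linarith) m
    rwa [div_le_iff₀ (by positivity), mul_comm] at this
  have h2 : 1 + u + -(κ * u ^ 2) ≤ 1 + 1 / κ + -u := by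
    have : 1 / κ - 2 * u + κ * u ^ 2 = (κ * u - 1) ^ 2 / κ := by field_simp; ring
    have : 0 ≤ (κ * u - 1) ^ 2 / κ := by positivity
    linarith
  calc (1 + u) ^ m * Real.exp (-(κ * u ^ 2))
      ≤ m.factorial * Real.exp (1 + u) * Real.exp (-(κ * u ^ 2)) := by gcongr
    _ = m.factorial * Real.exp (1 + u + -(κ * u ^ 2)) := by rw [mul_assoc, ← Real.exp_add]
    _ ≤ m.factorial * Real.exp (1 + 1 / κ + -u) := by gcongr
    _ = _ := by rw [Real.exp_add (1 + 1 / κ)]; ring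

lemma rpow_le_one_add_sq {u e : ℝ} (hu : 0 < u) (he : 0 ≤ e) (he2 : e ≤ 2) :
    u ^ e ≤ (1 + u) ^ 2 := by
  calc u ^ e ≤ (1 + u) ^ e := Real.rpow_le_rpow hu.le (by linarith) he
    _ ≤ (1 + u) ^ (2 : ℝ) := Real.rpow_le_rpow_of_exponent_le (by linarith) he2
    _ = _ := by norm_cast

lemma LL_le (P : Ctx) : ∃ C ≥ 1, ∀ n : ℕ, 1 ≤ n → ∀ σ δ α, P.U σ δ α → ∀ u, 0 < u →
    LL n δ α u ≤ C * P.Lam n * (u ^ (P.a0 - P.τ) * (1 + u) ^ 2) := by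
  refine ⟨(max 1 (2 * P.d0)) ^ 2, by
    have : 1 ≤ max 1 (2 * P.d0) := le_max_left _ _
    nlinarith, fun n hn σ δ α hU u hu => ?_⟩
  obtain ⟨h1, h2, h3, h4⟩ := hU.pos
  obtain ⟨g1, g2, g3, g4, g5, g6⟩ := hU
  have hn' : (1 : ℝ) ≤ n := by exact_mod_cast hn
  have hτ := P.hτ
  have hτ1 := P.τ_lt1
  rw [LL_eq hn α h2 hu]
  have e1 : (n : ℝ) ^ (α / 2 - 1) ≤ P.Lam n :=
    Real.rpow_le_rpow_of_exponent_le hn' (by linarith)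
  have e2 : δ ^ α ≤ (max 1 (2 * P.d0)) ^ 2 := by
    calc δ ^ α ≤ (max 1 (2 * P.d0)) ^ α :=
          Real.rpow_le_rpow h2.le (g4.le.trans (le_max_right _ _)) h3.le
      _ ≤ (max 1 (2 * P.d0)) ^ (2 : ℝ) :=
          Real.rpow_le_rpow_of_exponent_le (le_max_left _ _) h4.le
      _ = _ := by norm_cast
  have e3 : u ^ α ≤ u ^ (P.a0 - P.τ) * (1 + u) ^ 2 := by
    have : u ^ α = u ^ (P.a0 - P.τ) * u ^ (α - (P.a0 - P.τ)) := by
      rw [← Real.rpow_add hu]; congr 1; ring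
    rw [this]
    gcongr
    exact rpow_le_one_add_sq hu (by linarith) (by linarith)
  have := P.Lam_pos hn
  calc (n : ℝ) ^ (α / 2 - 1) * δ ^ α * u ^ α
      ≤ P.Lam n * (max 1 (2 * P.d0)) ^ 2 * (u ^ (P.a0 - P.τ) * (1 + u) ^ 2) := by gcongr
    _ = _ := by ring

lemma ell_le (P : Ctx) (c : ℕ) : ∃ C ≥ 1, ∀ n : ℕ, 1 ≤ n → ∀ σ δ α, P.U σ δ α → ∀ u, 0 < u →
    |ell n δ u| ^ c ≤ C * (n : ℝ) ^ P.τ * (u ^ (-P.τ) * (1 + u) ^ (2 * c + 2)) := by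
  obtain ⟨ε, hε⟩ : ∃ ε, ε = P.τ / (c + 1) := ⟨_, rfl⟩
  have hτ := P.hτ
  have hτ1 := P.τ_lt1
  have hc : (0 : ℝ) < c + 1 := by positivity
  have hε0 : 0 < ε := by rw [hε]; positivity
  have hεc : ε * (c + 1) = P.τ := by rw [hε]; field_simp
  have hεle : ε * c ≤ P.τ := by linarith [mul_comm ε (c : ℝ)]
  have hε1 : ε ≤ 1 / 2 := by
    have : 0 ≤ ε * c := by positivity
    linarith
  obtain ⟨D, hD⟩ : ∃ D, D = max |Real.log (P.d0 / 2)| |Real.log (2 * P.d0)| := ⟨_, rfl⟩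
  have hD0 : 0 ≤ D := by rw [hD]; exact le_max_of_le_left (abs_nonneg _)
  refine ⟨(1 + 1 / ε + D + 2 / ε) ^ c, one_le_pow₀ (by
    have : 0 < 1 / ε := by positivity
    have : 0 < 2 / ε := by positivity
    linarith), fun n hn σ δ α hU u hu => ?_⟩
  obtain ⟨h1, h2, h3, h4⟩ := hU.pos
  obtain ⟨g1, g2, g3, g4, g5, g6⟩ := hU
  have hn' : (1 : ℝ) ≤ n := by exact_mod_cast hn
  have hd := P.hd
  have k1 : |Real.log δ| ≤ D := by
    rw [hD, abs_le]
    constructor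
    · have := Real.log_le_log (by linarith) g3.le
      have := neg_abs_le (Real.log (P.d0 / 2))
      have := le_max_left |Real.log (P.d0 / 2)| |Real.log (2 * P.d0)|
      linarith
    · have := Real.log_le_log (by linarith) g4.le
      have := le_abs_self (Real.log (2 * P.d0))
      have := le_max_right |Real.log (P.d0 / 2)| |Real.log (2 * P.d0)|
      linarith
  have k2 : 0 ≤ Real.log n := Real.log_nonneg hn'
  have k3 : Real.log n ≤ n ^ ε / ε := Real.log_le_rpow_div (by linarith) hε0
  have hnε : 1 ≤ (n : ℝ) ^ ε := Real.one_le_rpow hn' hε0.le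
  have huε : 0 < u ^ (-ε) := by positivity
  have k5 : 1 ≤ u ^ (-ε) * (1 + u) ^ 2 := by
    have := rpow_le_one_add_sq hu hε0.le (by linarith)
    rw [Real.rpow_neg hu.le, inv_mul_eq_div, le_div_iff₀ (by positivity)]; linarith
  have k4 : |Real.log u| ≤ 2 / ε * (u ^ (-ε) * (1 + u) ^ 2) := by
    have a1 : Real.log u ≤ u ^ ε / ε := Real.log_le_rpow_div hu.le hε0
    have a2 : -Real.log u ≤ u ^ (-ε) / ε := by
      have := Real.log_le_rpow_div (x := u⁻¹) (by positivity) hε0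
      rwa [Real.log_inv, Real.inv_rpow hu.le, ← Real.rpow_neg hu.le] at this
    have a3 : u ^ ε ≤ u ^ (-ε) * (1 + u) ^ 2 := by
      have : u ^ ε = u ^ (-ε) * u ^ (2 * ε) := by rw [← Real.rpow_add hu]; congr 1; ring
      rw [this]; gcongr; exact rpow_le_one_add_sq hu (by linarith) (by linarith)
    have a4 : u ^ (-ε) ≤ u ^ (-ε) * (1 + u) ^ 2 :=
      le_mul_of_one_le_right huε.le (by nlinarith)
    have a5 : u ^ ε / ε ≤ 2 / ε * (u ^ (-ε) * (1 + u) ^ 2) := by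
      rw [div_mul_eq_mul_div]; gcongr; linarith
    have a6 : u ^ (-ε) / ε ≤ 2 / ε * (u ^ (-ε) * (1 + u) ^ 2) := by
      rw [div_mul_eq_mul_div]; gcongr; linarith
    rw [abs_le]; constructor <;> linarith
  have k6 : |ell n δ u| ≤ (1 + 1 / ε + D + 2 / ε) * (n ^ ε * (u ^ (-ε) * (1 + u) ^ 2)) := by
    obtain ⟨w, hw⟩ : ∃ w, w = u ^ (-ε) * (1 + u) ^ 2 := ⟨_, rfl⟩
    rw [← hw] at k4 k5 ⊢
    obtain ⟨N, hN⟩ : ∃ N, N = (n : ℝ) ^ ε := ⟨_, rfl⟩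
    rw [← hN] at k3 hnε ⊢
    have b1 : |ell n δ u| ≤ Real.log n / 2 + |Real.log δ| + |Real.log u| := by
      unfold ell
      refine (abs_add_le _ _).trans (add_le_add ((abs_add_le _ _).trans
        (add_le_add ?_ le_rfl)) le_rfl)
      rw [abs_of_nonneg (by linarith)]
    have c1 : N / ε ≤ 1 / ε * (N * w) := by
      rw [div_mul_eq_mul_div, one_mul]; gcongr
      exact le_mul_of_one_le_right (by linarith) k5
    have c2 : 1 ≤ N * w := by nlinarith
    have c3 : D ≤ D * (N * w) := le_mul_of_one_le_right hD0 c2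
    have c4 : 2 / ε * w ≤ 2 / ε * (N * w) := by
      gcongr; exact le_mul_of_one_le_left (by linarith) hnε
    nlinarith
  calc |ell n δ u| ^ c ≤ ((1 + 1 / ε + D + 2 / ε) * (n ^ ε * (u ^ (-ε) * (1 + u) ^ 2))) ^ c := by
        gcongr
    _ = (1 + 1 / ε + D + 2 / ε) ^ c * (n : ℝ) ^ (ε * c) * (u ^ (-(ε * c)) * (1 + u) ^ (2 * c)) := by
        rw [mul_pow, mul_pow, mul_pow, ← pow_mul, ← Real.rpow_mul_natCast (by linarith),
          ← Real.rpow_mul_natCast hu.le, neg_mul]; ring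
    _ ≤ (1 + 1 / ε + D + 2 / ε) ^ c * (n : ℝ) ^ P.τ *
          ((u ^ (-P.τ) * (1 + u) ^ 2) * (1 + u) ^ (2 * c)) := by
        have z1 : (n : ℝ) ^ (ε * c) ≤ (n : ℝ) ^ P.τ := Real.rpow_le_rpow_of_exponent_le hn' hεle
        have z2 : u ^ (-(ε * c)) ≤ u ^ (-P.τ) * (1 + u) ^ 2 := by
          have : u ^ (-(ε * c)) = u ^ (-P.τ) * u ^ (P.τ - ε * c) := by
            rw [← Real.rpow_add hu]; congr 1; ring
          rw [this]; gcongr; exact rpow_le_one_add_sq hu (by linarith) (by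
            have : 0 ≤ ε * c := by positivity
            linarith)
        gcongr
    _ = _ := by rw [pow_add (1 + u) (2 * c) 2]; ring

/-- Pointwise bound, `b ≥ 1`. -/
lemma MM_le (P : Ctx) (a b c : ℕ) : ∃ C > 0, ∀ n : ℕ, 1 ≤ n → ∀ t σ δ α : ℝ, P.U σ δ α →
    ∀ u, 0 < u → |MM a (b + 1) c t n σ δ α u| ≤
      C * ((n : ℝ) ^ P.τ * P.Lam n ^ (b + 1)) * (u ^ P.β * Real.exp (-u)) := by
  obtain ⟨C1, hC1, H1⟩ := LL_le P
  obtain ⟨C2, hC2, H2⟩ := ell_le P c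
  have hs := P.hs
  obtain ⟨C3, hC3, H3⟩ := poly_exp_le (2 * a + (4 * b + 2) + (2 * c + 2))
    (κ := P.s0 ^ 2 / 8) (by positivity)
  refine ⟨C1 ^ (b + 1) * C2 * C3, by positivity, fun n hn t σ δ α hU u hu => ?_⟩
  have hτ := P.hτ
  have hτ1 := P.τ_lt1
  have hn' : (1 : ℝ) ≤ n := by exact_mod_cast hn
  have h1 := H1 n hn σ δ α hU u hu
  have h2 := H2 n hn σ δ α hU u hu
  have h3 := H3 u hu.le
  have hLam := P.Lam_pos hn
  have hβ : u ^ P.β = u ^ (P.a0 - P.τ) * u ^ (-P.τ) := by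
    rw [← Real.rpow_add hu]; unfold Ctx.β; congr 1; ring
  have hL : LL n δ α u ^ (b + 1) ≤
      C1 ^ (b + 1) * P.Lam n ^ (b + 1) * (u ^ (P.a0 - P.τ) * (1 + u) ^ (4 * b + 2)) := by
    calc LL n δ α u ^ (b + 1) ≤ (C1 * P.Lam n * (u ^ (P.a0 - P.τ) * (1 + u) ^ 2)) ^ (b + 1) :=
          pow_le_pow_left₀ (LL_nonneg _ _ _ _) h1 _
      _ = C1 ^ (b + 1) * P.Lam n ^ (b + 1) *
          (u ^ (P.a0 - P.τ) * (u ^ (P.a0 - P.τ)) ^ b * (1 + u) ^ (2 * b + 2)) := by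
          generalize 1 + u = v
          ring
      _ ≤ C1 ^ (b + 1) * P.Lam n ^ (b + 1) *
          (u ^ (P.a0 - P.τ) * ((1 + u) ^ 2) ^ b * (1 + u) ^ (2 * b + 2)) := by
          have : u ^ (P.a0 - P.τ) ≤ (1 + u) ^ 2 :=
            rpow_le_one_add_sq hu (by have := P.hτ1; linarith) (by have := P.ha2; linarith)
          gcongr
      _ = _ := by
          generalize 1 + u = v
          ring
  have hE : Real.exp (-(σ ^ 2 * u ^ 2) / 2 - t ^ 2 * LL n δ α u) ≤
      Real.exp (-(P.s0 ^ 2 / 8 * u ^ 2)) := by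
    apply Real.exp_le_exp.2
    have : 0 ≤ t ^ 2 * LL n δ α u := mul_nonneg (sq_nonneg _) (LL_nonneg _ _ _ _)
    have : P.s0 ^ 2 / 4 ≤ σ ^ 2 := by nlinarith [hU.1]
    have : P.s0 ^ 2 / 4 * u ^ 2 ≤ σ ^ 2 * u ^ 2 := by gcongr
    linarith
  have hu2 : u ^ (2 * a) ≤ (1 + u) ^ (2 * a) := by gcongr; linarith
  unfold MM
  rw [abs_mul, abs_mul, abs_mul, abs_of_nonneg (by positivity : 0 ≤ u ^ (2 * a)),
    abs_of_nonneg (pow_nonneg (LL_nonneg _ _ _ _) _), abs_of_pos (Real.exp_pos _), abs_pow]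
  have hLn := LL_nonneg n δ α u
  calc _ ≤ (1 + u) ^ (2 * a) * (C1 ^ (b + 1) * P.Lam n ^ (b + 1) *
          (u ^ (P.a0 - P.τ) * (1 + u) ^ (4 * b + 2))) *
          (C2 * (n : ℝ) ^ P.τ * (u ^ (-P.τ) * (1 + u) ^ (2 * c + 2))) *
          Real.exp (-(P.s0 ^ 2 / 8 * u ^ 2)) := by gcongr
    _ = C1 ^ (b + 1) * C2 * ((n : ℝ) ^ P.τ * P.Lam n ^ (b + 1)) * u ^ P.β *
        ((1 + u) ^ (2 * a + (4 * b + 2) + (2 * c + 2)) * Real.exp (-(P.s0 ^ 2 / 8 * u ^ 2))) := by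
        rw [hβ]
        generalize 1 + u = v
        ring
    _ ≤ C1 ^ (b + 1) * C2 * ((n : ℝ) ^ P.τ * P.Lam n ^ (b + 1)) * u ^ P.β *
        (C3 * Real.exp (-u)) := by gcongr
    _ = _ := by ring

/-- Pointwise bound, `b = c = 0`. -/
lemma MM_le0 (P : Ctx) (a : ℕ) : ∃ C > 0, ∀ n : ℕ, ∀ t σ δ α : ℝ, P.U σ δ α →
    ∀ u, 0 < u → |MM a 0 0 t n σ δ α u| ≤ C * Real.exp (-u) := by
  have hs := P.hs
  obtain ⟨C3, hC3, H3⟩ := poly_exp_le (2 * a) (κ := P.s0 ^ 2 / 8) (by positivity)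
  refine ⟨C3, hC3, fun n t σ δ α hU u hu => ?_⟩
  have hE : Real.exp (-(σ ^ 2 * u ^ 2) / 2 - t ^ 2 * LL n δ α u) ≤
      Real.exp (-(P.s0 ^ 2 / 8 * u ^ 2)) := by
    apply Real.exp_le_exp.2
    have : 0 ≤ t ^ 2 * LL n δ α u := mul_nonneg (sq_nonneg _) (LL_nonneg _ _ _ _)
    have : P.s0 ^ 2 / 4 ≤ σ ^ 2 := by nlinarith [hU.1]
    have : P.s0 ^ 2 / 4 * u ^ 2 ≤ σ ^ 2 * u ^ 2 := by gcongr
    linarith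
  have hu2 : u ^ (2 * a) ≤ (1 + u) ^ (2 * a) := by gcongr; linarith
  unfold MM
  rw [pow_zero, pow_zero, mul_one, mul_one, abs_of_nonneg (by positivity)]
  calc _ ≤ (1 + u) ^ (2 * a) * Real.exp (-(P.s0 ^ 2 / 8 * u ^ 2)) := by gcongr
    _ ≤ _ := H3 u hu.le



/-! ### Decay of cosine integrals of symbols -/

lemma integrableOn_rpow_exp {β : ℝ} (hβ : 0 < β) :
    IntegrableOn (fun u : ℝ => u ^ β * Real.exp (-u)) (Ioi 0) := by
  have := Real.GammaIntegral_convergent (s := β + 1) (by linarith)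
  refine this.congr_fun (fun u _ => ?_) measurableSet_Ioi
  simp only [add_sub_cancel_right]; ring

lemma cos_tail_large {β : ℝ} (hβ : 0 < β) (hβ2 : β < 2) (G0 G1 G2 G3 : ℝ → ℝ) {A : ℝ}
    (hA : 0 ≤ A)
    (d0 : ∀ u, 0 < u → HasDerivAt G0 (G1 u / u) u)
    (d1 : ∀ u, 0 < u → HasDerivAt G1 (G2 u / u) u)
    (d2 : ∀ u, 0 < u → HasDerivAt G2 (G3 u / u) u)
    (c3 : ContinuousOn G3 (Ioi 0))
    (b0 : ∀ u, 0 < u → |G0 u| ≤ A * (u ^ β * Real.exp (-u)))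
    (b1 : ∀ u, 0 < u → |G1 u| ≤ A * (u ^ β * Real.exp (-u)))
    (b2 : ∀ u, 0 < u → |G2 u| ≤ A * (u ^ β * Real.exp (-u)))
    (b3 : ∀ u, 0 < u → |G3 u| ≤ A * (u ^ β * Real.exp (-u)))
    {X : ℝ} (hX : 1 ≤ X) :
    |∫ u in Ioi (0 : ℝ), Real.cos (u * X) * G0 u| ≤
      (5 + 6 / (2 - β)) * A * X ^ (-(1 + β)) := by
  have hX0 : 0 < X := by linarith
  have c0 : ContinuousOn G0 (Ioi 0) := fun u hu => (d0 u hu).continuousAt.continuousWithinAt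
  have c1 : ContinuousOn G1 (Ioi 0) := fun u hu => (d1 u hu).continuousAt.continuousWithinAt
  have c2 : ContinuousOn G2 (Ioi 0) := fun u hu => (d2 u hu).continuousAt.continuousWithinAt
  have hIntg : IntegrableOn (fun u => Real.cos (u * X) * G0 u) (Ioi 0) := by
    refine Integrable.mono' ((integrableOn_rpow_exp hβ).const_mul A)
      ((ContinuousOn.mul (by fun_prop) c0).aestronglyMeasurable measurableSet_Ioi) ?_
    filter_upwards [ae_restrict_mem measurableSet_Ioi] with u hu
    rw [norm_mul, Real.norm_eq_abs, Real.norm_eq_abs]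
    calc _ ≤ 1 * |G0 u| := by gcongr; exact Real.abs_cos_le_one _
      _ ≤ _ := by rw [one_mul]; exact b0 u hu
  obtain ⟨h, hh⟩ : ∃ h, h = X⁻¹ := ⟨_, rfl⟩
  have hh0 : 0 < h := by rw [hh]; positivity
  have hpow : X ^ (-(1 + β)) = h ^ (1 + β) := by
    rw [hh, Real.inv_rpow hX0.le, Real.rpow_neg hX0.le]
  have hle : ∀ u, 0 < u → A * (u ^ β * Real.exp (-u)) ≤ A * u ^ β := fun u hu => by
    have : Real.exp (-u) ≤ 1 := Real.exp_le_one_iff.2 (by linarith)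
    have : 0 < u ^ β := by positivity
    gcongr; nlinarith
  -- first piece
  have p1 : |∫ u in Ioc 0 h, Real.cos (u * X) * G0 u| ≤ A * h ^ (1 + β) := by
    have := norm_setIntegral_le_of_norm_le_const (μ := volume) (s := Ioc 0 h)
      (f := fun u => Real.cos (u * X) * G0 u) (C := A * h ^ β) (by simp) (fun u hu => by
        rw [norm_mul, Real.norm_eq_abs, Real.norm_eq_abs]
        calc _ ≤ 1 * |G0 u| := by gcongr; exact Real.abs_cos_le_one _
          _ ≤ A * u ^ β := by rw [one_mul]; exact (b0 u hu.1).trans (hle u hu.1)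
          _ ≤ _ := by gcongr; exact hu.1.le; exact hu.2)
    rw [Real.norm_eq_abs] at this
    refine this.trans (le_of_eq ?_)
    rw [Real.rpow_add hh0, Real.rpow_one]
    simp [hh0.le]; ring
  -- second piece
  set Φ : ℝ → ℝ := fun u => Real.sin (u * X) / X * G0 u + Real.cos (u * X) / X ^ 2 * (G1 u / u)
    - Real.sin (u * X) / X ^ 3 * ((G2 u - G1 u) / u ^ 2) with hΦ
  set g3 : ℝ → ℝ := fun u => (G3 u - 3 * G2 u + 2 * G1 u) / u ^ 3 with hg3
  have hder : ∀ u, 0 < u → HasDerivAt Φ (Real.cos (u * X) * G0 u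
      - Real.sin (u * X) / X ^ 3 * g3 u) u := by
    intro u hu
    have hs : HasDerivAt (fun u : ℝ => Real.sin (u * X)) (Real.cos (u * X) * X) u := by
      simpa using (hasDerivAt_mul_const X (x := u)).sin
    have hc : HasDerivAt (fun u : ℝ => Real.cos (u * X)) (-Real.sin (u * X) * X) u := by
      simpa using (hasDerivAt_mul_const X (x := u)).cos
    have e1 := (hs.div_const X).mul (d0 u hu)
    have e2 := (hc.div_const (X ^ 2)).mul ((d1 u hu).div (hasDerivAt_id u) hu.ne')
    have e3 := (hs.div_const (X ^ 3)).mul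
      (((d2 u hu).sub (d1 u hu)).div (hasDerivAt_pow 2 u) (by positivity))
    refine ((e1.add e2).sub e3).congr_deriv ?_
    simp only [hg3, id, Pi.sub_apply, Pi.div_apply]
    field_simp
    ring
  have hg3b : ∀ u, 0 < u → |g3 u| ≤ 6 * A * u ^ (β - 3) := by
    intro u hu
    have : u ^ (β - 3) = u ^ β / u ^ 3 := by
      rw [Real.rpow_sub hu]; norm_cast
    rw [this, hg3]; simp only
    rw [abs_div, abs_of_pos (by positivity : 0 < u ^ 3), ← mul_div_assoc]
    gcongr
    have z1 := (b1 u hu).trans (hle u hu)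
    have z2 := (b2 u hu).trans (hle u hu)
    have z3 := (b3 u hu).trans (hle u hu)
    rw [abs_le] at *
    constructor <;> linarith [z1.1, z1.2, z2.1, z2.2, z3.1, z3.2]
  have hi3 : IntegrableOn (fun u => 6 * A * u ^ (β - 3)) (Ioi h) :=
    (integrableOn_Ioi_rpow_of_lt (by linarith) hh0).const_mul _
  have hg3m : AEStronglyMeasurable g3 (volume.restrict (Ioi h)) := by
    refine ContinuousOn.aestronglyMeasurable (fun u hu => ?_) measurableSet_Ioi
    have hu0 : 0 < u := hh0.trans hu
    have hu' : Ioi (0 : ℝ) ∈ 𝓝 u := Ioi_mem_nhds hu0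
    have e1 := c1.continuousAt hu'
    have e2 := c2.continuousAt hu'
    have e3 := c3.continuousAt hu'
    exact (ContinuousAt.div (by fun_prop) (by fun_prop) (by positivity)).continuousWithinAt
  have hig : IntegrableOn g3 (Ioi h) := by
    refine Integrable.mono' hi3 hg3m ?_
    filter_upwards [ae_restrict_mem measurableSet_Ioi] with u hu
    exact hg3b u (hh0.trans hu)
  have hisg : IntegrableOn (fun u => Real.sin (u * X) / X ^ 3 * g3 u) (Ioi h) := by
    refine Integrable.mono' hi3 (AEStronglyMeasurable.mul
      (Continuous.aestronglyMeasurable (by fun_prop)) hg3m) ?_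
    filter_upwards [ae_restrict_mem measurableSet_Ioi] with u hu
    rw [norm_mul, Real.norm_eq_abs, Real.norm_eq_abs, abs_div, abs_of_pos (by positivity : 0 < X ^ 3)]
    have : |Real.sin (u * X)| / X ^ 3 ≤ 1 := by
      rw [div_le_one (by positivity)]
      exact (Real.abs_sin_le_one _).trans (one_le_pow₀ hX)
    calc _ ≤ 1 * |g3 u| := by gcongr
      _ ≤ _ := by rw [one_mul]; exact hg3b u (hh0.trans hu)
  have hic : IntegrableOn (fun u => Real.cos (u * X) * G0 u) (Ioi h) :=
    hIntg.mono_set (Ioi_subset_Ioi hh0.le)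
  have hΦb : ∀ u, 0 < u → |Φ u| ≤ A * u ^ β * Real.exp (-u) *
      (1 / X + 1 / (X ^ 2 * u) + 2 / (X ^ 3 * u ^ 2)) := by
    intro u hu
    have hs := Real.abs_sin_le_one (u * X)
    have hc := Real.abs_cos_le_one (u * X)
    have t1 : |Real.sin (u * X) / X * G0 u| ≤ 1 / X * (A * (u ^ β * Real.exp (-u))) := by
      rw [abs_mul, abs_div, abs_of_pos hX0]; gcongr; exact b0 u hu
    have t2 : |Real.cos (u * X) / X ^ 2 * (G1 u / u)| ≤
        1 / X ^ 2 * ((A * (u ^ β * Real.exp (-u))) / u) := by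
      rw [abs_mul, abs_div, abs_div, abs_of_pos hu, abs_of_pos (by positivity : 0 < X ^ 2)]
      gcongr; exact b1 u hu
    have t3 : |Real.sin (u * X) / X ^ 3 * ((G2 u - G1 u) / u ^ 2)| ≤
        1 / X ^ 3 * ((2 * (A * (u ^ β * Real.exp (-u)))) / u ^ 2) := by
      rw [abs_mul, abs_div, abs_div, abs_of_pos (by positivity : 0 < u ^ 2),
        abs_of_pos (by positivity : 0 < X ^ 3)]
      gcongr
      refine (abs_sub _ _).trans ?_
      linarith [b1 u hu, b2 u hu]
    calc |Φ u| ≤ _ := (abs_sub _ _).trans (add_le_add ((abs_add_le _ _).trans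
          (add_le_add t1 t2)) t3)
      _ = _ := by field_simp
  have htend : Tendsto Φ atTop (𝓝 0) := by
    have hlim : Tendsto (fun u : ℝ => 4 * A * (u ^ β * Real.exp (-1 * u))) atTop (𝓝 (4 * A * 0)) :=
      (tendsto_rpow_mul_exp_neg_mul_atTop_nhds_zero β 1 one_pos).const_mul _
    rw [mul_zero] at hlim
    refine squeeze_zero_norm' ?_ hlim
    filter_upwards [eventually_ge_atTop 1] with u hu
    have hu0 : 0 < u := by linarith
    refine (hΦb u hu0).trans ?_
    have y1 : 1 / X ≤ 1 := by rw [div_le_one hX0]; exact hX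
    have y2 : 1 / (X ^ 2 * u) ≤ 1 := by
      rw [div_le_one (by positivity)]; exact one_le_mul_of_one_le_of_one_le (one_le_pow₀ hX) hu
    have y3 : 2 / (X ^ 3 * u ^ 2) ≤ 2 := by
      rw [div_le_iff₀ (by positivity)]
      have := one_le_mul_of_one_le_of_one_le (one_le_pow₀ (n := 3) hX) (one_le_pow₀ (n := 2) hu)
      linarith
    rw [neg_one_mul]
    calc _ ≤ A * u ^ β * Real.exp (-u) * 4 := by gcongr; linarith
      _ = _ := by ring
  have hFTC := integral_Ioi_of_hasDerivAt_of_tendsto' (a := h)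
    (fun u hu => hder u (hh0.trans_le hu)) (hic.sub hisg) htend
  have hsplit : ∫ u in Ioi h, Real.cos (u * X) * G0 u =
      -Φ h + ∫ u in Ioi h, Real.sin (u * X) / X ^ 3 * g3 u := by
    have := integral_sub hic hisg
    rw [this] at hFTC; linarith
  have p2 : |Φ h| ≤ 4 * A * h ^ (1 + β) := by
    refine (hΦb h hh0).trans ?_
    have : 1 / X + 1 / (X ^ 2 * h) + 2 / (X ^ 3 * h ^ 2) = 4 * h := by
      rw [hh]; field_simp; norm_num
    rw [this, Real.rpow_add hh0, Real.rpow_one]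
    have : A * h ^ β * Real.exp (-h) ≤ A * h ^ β := by
      have := hle h hh0; linarith [this]
    nlinarith
  have p3 : |∫ u in Ioi h, Real.sin (u * X) / X ^ 3 * g3 u| ≤ 6 / (2 - β) * A * h ^ (1 + β) := by
    have hb : ∀ᵐ u ∂(volume.restrict (Ioi h)), ‖Real.sin (u * X) / X ^ 3 * g3 u‖ ≤
        (1 / X ^ 3) * (6 * A * u ^ (β - 3)) := by
      filter_upwards [ae_restrict_mem measurableSet_Ioi] with u hu
      rw [norm_mul, Real.norm_eq_abs, Real.norm_eq_abs, abs_div,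
        abs_of_pos (by positivity : 0 < X ^ 3)]
      gcongr
      · exact Real.abs_sin_le_one _
      · exact hg3b u (hh0.trans hu)
    have := norm_integral_le_of_norm_le (hi3.const_mul (1 / X ^ 3)) hb
    rw [Real.norm_eq_abs] at this
    refine this.trans (le_of_eq ?_)
    rw [integral_const_mul, integral_const_mul, integral_Ioi_rpow_of_lt (by linarith) hh0]
    have e1 : β - 3 + 1 = β - 2 := by ring
    have e2 : h ^ (1 + β) = h ^ 3 * h ^ (β - 2) := by
      rw [← Real.rpow_natCast, ← Real.rpow_add hh0]; congr 1; push_cast; ring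
    have e3 : 1 / X ^ 3 = h ^ 3 := by rw [hh]; field_simp
    have e4 : β - 2 ≠ 0 := by linarith
    have e5 : 2 - β ≠ 0 := by linarith
    rw [e1, e2, e3]
    have e6 : -h ^ (β - 2) / (β - 2) = h ^ (β - 2) / (2 - β) := by
      rw [div_eq_div_iff e4 e5]; ring
    rw [e6]; ring
  have hsp : ∫ u in Ioi (0 : ℝ), Real.cos (u * X) * G0 u =
      (∫ u in Ioc 0 h, Real.cos (u * X) * G0 u) + ∫ u in Ioi h, Real.cos (u * X) * G0 u := by
    rw [← setIntegral_union (Ioc_disjoint_Ioi le_rfl) measurableSet_Ioi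
      (hIntg.mono_set Ioc_subset_Ioi_self) hic, Ioc_union_Ioi_eq_Ioi hh0.le]
  rw [hsp, hsplit, hpow]
  calc _ ≤ A * h ^ (1 + β) + (4 * A * h ^ (1 + β) + 6 / (2 - β) * A * h ^ (1 + β)) := by
        refine (abs_add_le _ _).trans (add_le_add p1 ((abs_add_le _ _).trans (add_le_add ?_ p3)))
        rw [abs_neg]; exact p2
    _ = _ := by ring

lemma cos_tail {β : ℝ} (hβ : 0 < β) (hβ2 : β < 2) : ∃ C > 0, ∀ (G0 G1 G2 G3 : ℝ → ℝ) (A : ℝ),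
    0 ≤ A →
    (∀ u, 0 < u → HasDerivAt G0 (G1 u / u) u) →
    (∀ u, 0 < u → HasDerivAt G1 (G2 u / u) u) →
    (∀ u, 0 < u → HasDerivAt G2 (G3 u / u) u) →
    ContinuousOn G3 (Ioi 0) →
    (∀ u, 0 < u → |G0 u| ≤ A * (u ^ β * Real.exp (-u))) →
    (∀ u, 0 < u → |G1 u| ≤ A * (u ^ β * Real.exp (-u))) →
    (∀ u, 0 < u → |G2 u| ≤ A * (u ^ β * Real.exp (-u))) →
    (∀ u, 0 < u → |G3 u| ≤ A * (u ^ β * Real.exp (-u))) →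
    ∀ x : ℝ, |∫ u in Ioi (0 : ℝ), Real.cos (u * x) * G0 u| ≤
      C * A * (1 + |x|) ^ (-(1 + β)) := by
  obtain ⟨I, hI⟩ : ∃ I, I = ∫ u in Ioi (0 : ℝ), u ^ β * Real.exp (-u) := ⟨_, rfl⟩
  have hI0 : 0 ≤ I := by
    rw [hI]; exact setIntegral_nonneg measurableSet_Ioi (fun u hu => by
      have : (0 : ℝ) < u := hu
      positivity)
  have h2β : 0 < 2 - β := by linarith
  refine ⟨8 * (I + (5 + 6 / (2 - β))), by positivity, ?_⟩
  intro G0 G1 G2 G3 A hA d0 d1 d2 c3 b0 b1 b2 b3 x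
  have hcos : ∀ u, Real.cos (u * x) = Real.cos (u * |x|) := by
    intro u
    rcases abs_choice x with h | h <;> rw [h]
    rw [mul_neg, Real.cos_neg]
  simp_rw [hcos]
  have h8 : (2 : ℝ) ^ (1 + β) ≤ 8 := by
    calc (2 : ℝ) ^ (1 + β) ≤ 2 ^ (3 : ℝ) :=
          Real.rpow_le_rpow_of_exponent_le (by norm_num) (by linarith)
      _ = 8 := by norm_num
  have hx0 := abs_nonneg x
  have hp : 0 < (1 + |x|) ^ (-(1 + β)) := by positivity
  rcases le_total 1 |x| with h | h
  · refine (cos_tail_large hβ hβ2 G0 G1 G2 G3 hA d0 d1 d2 c3 b0 b1 b2 b3 h).trans ?_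
    have : |x| ^ (-(1 + β)) ≤ 8 * (1 + |x|) ^ (-(1 + β)) := by
      have h1 : |x| ^ (-(1 + β)) ≤ ((1 + |x|) / 2) ^ (-(1 + β)) :=
        Real.rpow_le_rpow_of_nonpos (by positivity) (by linarith) (by linarith)
      rw [Real.div_rpow (by positivity) (by norm_num), Real.rpow_neg (by norm_num : (0 : ℝ) ≤ 2),
        div_inv_eq_mul] at h1
      nlinarith
    calc _ ≤ (5 + 6 / (2 - β)) * A * (8 * (1 + |x|) ^ (-(1 + β))) := by gcongr
      _ ≤ _ := by
        have : 0 ≤ I * A * (1 + |x|) ^ (-(1 + β)) := by positivity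
        linarith
  · have : |∫ u in Ioi (0 : ℝ), Real.cos (u * |x|) * G0 u| ≤ A * I := by
      have := norm_integral_le_of_norm_le ((integrableOn_rpow_exp hβ).const_mul A)
        (f := fun u => Real.cos (u * |x|) * G0 u) (by
          filter_upwards [ae_restrict_mem measurableSet_Ioi] with u hu
          rw [norm_mul, Real.norm_eq_abs, Real.norm_eq_abs]
          calc _ ≤ 1 * |G0 u| := by gcongr; exact Real.abs_cos_le_one _
            _ ≤ _ := by rw [one_mul]; exact b0 u hu)
      rw [integral_const_mul] at this
      rw [hI]; exact this
    refine this.trans ?_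
    have h1 : 1 ≤ 8 * (1 + |x|) ^ (-(1 + β)) := by
      have h1 : (2 : ℝ) ^ (-(1 + β)) ≤ (1 + |x|) ^ (-(1 + β)) :=
        Real.rpow_le_rpow_of_nonpos (by positivity) (by linarith) (by linarith)
      rw [Real.rpow_neg (by norm_num)] at h1
      have : (8 : ℝ)⁻¹ ≤ ((2 : ℝ) ^ (1 + β))⁻¹ := by gcongr
      linarith
    calc A * I ≤ A * I * (8 * (1 + |x|) ^ (-(1 + β))) := le_mul_of_one_le_right (by positivity) h1
      _ ≤ _ := by
        have : 0 ≤ (5 + 6 / (2 - β)) * A * (1 + |x|) ^ (-(1 + β)) := by positivity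
        linarith



/-! ### Derivatives of the integrands -/

lemma hasDerivAt_mono {p L l E : ℝ → ℝ} {p' g l' E' s : ℝ} (b c : ℕ)
    (hp : HasDerivAt p p' s) (hL : HasDerivAt L (L s * g) s) (hl : HasDerivAt l l' s)
    (hE : HasDerivAt E E' s) :
    HasDerivAt (fun s => p s * L s ^ b * l s ^ c * Real.exp (E s))
      (p' * L s ^ b * l s ^ c * Real.exp (E s) + (b * g) * (p s * L s ^ b * l s ^ c * Real.exp (E s))
        + l' * (c * (p s * L s ^ b * l s ^ (c - 1) * Real.exp (E s)))
        + E' * (p s * L s ^ b * l s ^ c * Real.exp (E s))) s := by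
  have hLb : HasDerivAt (fun s => L s ^ b) (b * g * L s ^ b) s := by
    refine (hL.pow b).congr_deriv ?_
    cases b with
    | zero => simp
    | succ b => simp only [Nat.add_sub_cancel]; push_cast; ring
  refine (((hp.mul hLb).mul (hl.pow c)).mul hE.exp).congr_deriv ?_
  simp only [Pi.mul_apply, Pi.pow_apply]
  ring

lemma ell_deriv_u (n : ℕ) (δ : ℝ) {u : ℝ} (hu : 0 < u) :
    HasDerivAt (fun u => ell n δ u) (1 / u) u := by
  unfold ell
  simpa using (Real.hasDerivAt_log hu.ne').const_add (Real.log n / 2 + Real.log δ)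

lemma ell_deriv_d (n : ℕ) {δ : ℝ} (u : ℝ) (hδ : 0 < δ) :
    HasDerivAt (fun δ => ell n δ u) (1 / δ) δ := by
  unfold ell
  simpa using ((Real.hasDerivAt_log hδ.ne').const_add (Real.log n / 2)).add_const (Real.log u)

lemma LL_deriv_u (n : ℕ) (δ α : ℝ) {u : ℝ} (hu : 0 < u) :
    HasDerivAt (fun u => LL n δ α u) (LL n δ α u * (α / u)) u := by
  unfold LL
  refine ((((ell_deriv_u n δ hu).const_mul α).exp).div_const (n : ℝ)).congr_deriv ?_
  ring

lemma LL_deriv_d (n : ℕ) {δ : ℝ} (α u : ℝ) (hδ : 0 < δ) :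
    HasDerivAt (fun δ => LL n δ α u) (LL n δ α u * (α / δ)) δ := by
  unfold LL
  refine ((((ell_deriv_d n u hδ).const_mul α).exp).div_const (n : ℝ)).congr_deriv ?_
  ring

lemma LL_deriv_a (n : ℕ) (δ α u : ℝ) :
    HasDerivAt (fun α => LL n δ α u) (LL n δ α u * ell n δ u) α := by
  unfold LL
  refine ((((hasDerivAt_id α).mul_const (ell n δ u)).exp).div_const (n : ℝ)).congr_deriv ?_
  simp only [id]; ring

/-- `u ∂_u` of a monomial. -/
def MMu (a b c : ℕ) (t : ℝ) (n : ℕ) (σ δ α u : ℝ) : ℝ :=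
  (2 * a + α * b) * MM a b c t n σ δ α u + c * MM a b (c - 1) t n σ δ α u
    + (-σ ^ 2) * MM (a + 1) b c t n σ δ α u + (-(α * t ^ 2)) * MM a (b + 1) c t n σ δ α u

lemma MM_deriv_u (a b c : ℕ) (t : ℝ) (n : ℕ) (σ δ α : ℝ) {u : ℝ} (hu : 0 < u) :
    HasDerivAt (fun u => MM a b c t n σ δ α u) (MMu a b c t n σ δ α u / u) u := by
  have hE : HasDerivAt (fun u => -(σ ^ 2 * u ^ 2) / 2 - t ^ 2 * LL n δ α u)
      (-(σ ^ 2 * (2 * u)) / 2 - t ^ 2 * (LL n δ α u * (α / u))) u := by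
    have := (((hasDerivAt_pow 2 u).const_mul (σ ^ 2)).neg.div_const 2).sub
      ((LL_deriv_u n δ α hu).const_mul (t ^ 2))
    refine this.congr_deriv ?_
    norm_num
  have hp : HasDerivAt (fun u : ℝ => u ^ (2 * a)) (2 * a * u ^ (2 * a) / u) u := by
    refine (hasDerivAt_pow (2 * a) u).congr_deriv ?_
    cases a with
    | zero => simp
    | succ a =>
      have : 2 * (a + 1) - 1 = 2 * a + 1 := by omega
      rw [this]; push_cast; field_simp
      ring
  refine (hasDerivAt_mono b c hp (LL_deriv_u n δ α hu) (ell_deriv_u n δ hu) hE).congr_deriv ?_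
  unfold MMu MM
  field_simp
  ring

lemma MM_deriv_s (a b c : ℕ) (t : ℝ) (n : ℕ) (σ δ α u : ℝ) :
    HasDerivAt (fun σ => MM a b c t n σ δ α u) (-σ * MM (a + 1) b c t n σ δ α u) σ := by
  have hE : HasDerivAt (fun σ => -(σ ^ 2 * u ^ 2) / 2 - t ^ 2 * LL n δ α u)
      (-(2 * σ * u ^ 2) / 2) σ := by
    have := ((((hasDerivAt_pow 2 σ).mul_const (u ^ 2)).neg.div_const 2).sub_const
      (t ^ 2 * LL n δ α u))
    refine this.congr_deriv ?_
    norm_num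
  refine (hasDerivAt_mono b c (hasDerivAt_const σ (u ^ (2 * a))) (g := 0)
    (by simpa using hasDerivAt_const σ (LL n δ α u)) (hasDerivAt_const σ (ell n δ u))
    hE).congr_deriv ?_
  unfold MM
  ring

lemma MM_deriv_d (a b c : ℕ) (t : ℝ) (n : ℕ) (σ : ℝ) {δ : ℝ} (α u : ℝ) (hδ : 0 < δ) :
    HasDerivAt (fun δ => MM a b c t n σ δ α u)
      (b * α * δ⁻¹ * MM a b c t n σ δ α u + c * δ⁻¹ * MM a b (c - 1) t n σ δ α u
        - t ^ 2 * α * δ⁻¹ * MM a (b + 1) c t n σ δ α u) δ := by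
  have hE : HasDerivAt (fun δ => -(σ ^ 2 * u ^ 2) / 2 - t ^ 2 * LL n δ α u)
      (-(t ^ 2 * (LL n δ α u * (α / δ)))) δ := by
    have := (hasDerivAt_const δ (-(σ ^ 2 * u ^ 2) / 2)).sub
      ((LL_deriv_d n α u hδ).const_mul (t ^ 2))
    refine this.congr_deriv ?_
    ring
  refine (hasDerivAt_mono b c (hasDerivAt_const δ (u ^ (2 * a))) (LL_deriv_d n α u hδ)
    (ell_deriv_d n u hδ) hE).congr_deriv ?_
  unfold MM
  field_simp
  ring

lemma MM_deriv_a (a b c : ℕ) (t : ℝ) (n : ℕ) (σ δ α u : ℝ) :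
    HasDerivAt (fun α => MM a b c t n σ δ α u)
      (b * MM a b (c + 1) t n σ δ α u - t ^ 2 * MM a (b + 1) (c + 1) t n σ δ α u) α := by
  have hE : HasDerivAt (fun α => -(σ ^ 2 * u ^ 2) / 2 - t ^ 2 * LL n δ α u)
      (-(t ^ 2 * (LL n δ α u * ell n δ u))) α := by
    have := (hasDerivAt_const α (-(σ ^ 2 * u ^ 2) / 2)).sub
      ((LL_deriv_a n δ α u).const_mul (t ^ 2))
    refine this.congr_deriv ?_
    ring
  refine (hasDerivAt_mono b c (hasDerivAt_const α (u ^ (2 * a))) (LL_deriv_a n δ α u)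
    (hasDerivAt_const α (ell n δ u)) hE).congr_deriv ?_
  unfold MM
  ring

lemma MM_deriv_t (a b c : ℕ) (t : ℝ) (n : ℕ) (σ δ α u : ℝ) :
    HasDerivAt (fun t => MM a b c t n σ δ α u) (-(2 * t) * MM a (b + 1) c t n σ δ α u) t := by
  have hE : HasDerivAt (fun t => -(σ ^ 2 * u ^ 2) / 2 - t ^ 2 * LL n δ α u)
      (-(2 * t * LL n δ α u)) t := by
    have := (hasDerivAt_const t (-(σ ^ 2 * u ^ 2) / 2)).sub
      ((hasDerivAt_pow 2 t).mul_const (LL n δ α u))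
    refine this.congr_deriv ?_
    norm_num
  refine (hasDerivAt_mono b c (hasDerivAt_const t (u ^ (2 * a))) (g := 0)
    (by simpa using hasDerivAt_const t (LL n δ α u)) (hasDerivAt_const t (ell n δ u))
    hE).congr_deriv ?_
  unfold MM
  ring

lemma MM_continuousOn (a b c : ℕ) (t : ℝ) (n : ℕ) (σ δ α : ℝ) :
    ContinuousOn (fun u => MM a b c t n σ δ α u) (Ioi 0) := fun _ hu =>
  (MM_deriv_u a b c t n σ δ α hu).continuousAt.continuousWithinAt

/-! ### Symbol classes -/

/-- `G` and its first `k` derivatives under `u ∂_u` are bounded by `A u^β e^{-u}`. -/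
def Sym (β : ℝ) : ℕ → ℝ → (ℝ → ℝ) → Prop
  | 0, A, G => ContinuousOn G (Ioi 0) ∧ ∀ u, 0 < u → |G u| ≤ A * (u ^ β * Real.exp (-u))
  | k + 1, A, G => (∀ u, 0 < u → |G u| ≤ A * (u ^ β * Real.exp (-u))) ∧
      ∃ G' : ℝ → ℝ, Sym β k A G' ∧ ∀ u, 0 < u → HasDerivAt G (G' u / u) u

lemma Sym.mono {β : ℝ} {k : ℕ} {A B : ℝ} {G : ℝ → ℝ} (h : Sym β k A G) (hAB : A ≤ B) :
    Sym β k B G := by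
  induction k generalizing G with
  | zero => exact ⟨h.1, fun u hu => (h.2 u hu).trans (by gcongr)⟩
  | succ k ih =>
    obtain ⟨h1, G', h2, h3⟩ := h
    exact ⟨fun u hu => (h1 u hu).trans (by gcongr), G', ih h2, h3⟩

lemma Sym.add {β : ℝ} {k : ℕ} {A B : ℝ} {F G : ℝ → ℝ} (h : Sym β k A F) (h' : Sym β k B G) :
    Sym β k (A + B) (fun u => F u + G u) := by
  induction k generalizing F G with
  | zero => exact ⟨h.1.add h'.1, fun u hu => (abs_add_le _ _).trans
      (by linarith [h.2 u hu, h'.2 u hu])⟩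
  | succ k ih =>
    obtain ⟨h1, F', h2, h3⟩ := h
    obtain ⟨g1, G', g2, g3⟩ := h'
    exact ⟨fun u hu => (abs_add_le _ _).trans (by linarith [h1 u hu, g1 u hu]), _, ih h2 g2,
      fun u hu => ((h3 u hu).add (g3 u hu)).congr_deriv (by ring)⟩

lemma Sym.smul {β : ℝ} {k : ℕ} {A B r : ℝ} {F : ℝ → ℝ} (h : Sym β k A F) (hr : |r| ≤ B)
    (hA : 0 ≤ A) : Sym β k (B * A) (fun u => r * F u) := by
  have key : ∀ (G : ℝ → ℝ), (∀ u, 0 < u → |G u| ≤ A * (u ^ β * Real.exp (-u))) →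
      ∀ u, 0 < u → |r * G u| ≤ B * A * (u ^ β * Real.exp (-u)) := by
    intro G hG u hu
    rw [abs_mul, mul_assoc]
    exact mul_le_mul hr (hG u hu) (abs_nonneg _) ((abs_nonneg _).trans hr)
  induction k generalizing F with
  | zero => exact ⟨continuousOn_const.mul h.1, key F h.2⟩
  | succ k ih =>
    obtain ⟨h1, F', h2, h3⟩ := h
    exact ⟨key F h1, _, ih h2, fun u hu => ((h3 u hu).const_mul r).congr_deriv (by ring)⟩

lemma MM_sym (P : Ctx) (k a b c : ℕ) : ∃ C > 0, ∀ n : ℕ, 1 ≤ n → ∀ t σ δ α : ℝ, |t| ≤ 1 →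
    P.U σ δ α → Sym P.β k (C * ((n : ℝ) ^ P.τ * P.Lam n ^ (b + 1)))
      (fun u => MM a (b + 1) c t n σ δ α u) := by
  induction k generalizing a b c with
  | zero =>
    obtain ⟨C, hC, H⟩ := MM_le P a b c
    exact ⟨C, hC, fun n hn t σ δ α _ hU => ⟨MM_continuousOn _ _ _ _ _ _ _ _, H n hn t σ δ α hU⟩⟩
  | succ k ih =>
    obtain ⟨C0, hC0, H0⟩ := MM_le P a b c
    obtain ⟨C1, hC1, H1⟩ := ih a b c
    obtain ⟨C2, hC2, H2⟩ := ih a b (c - 1)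
    obtain ⟨C3, hC3, H3⟩ := ih (a + 1) b c
    obtain ⟨C4, hC4, H4⟩ := ih a (b + 1) c
    have hs := P.hs
    refine ⟨C0 + ((2 * a + 2 * (b + 1)) * C1 + c * C2 + (4 * P.s0 ^ 2) * C3 + 2 * C4),
      by positivity, fun n hn t σ δ α ht hU => ?_⟩
    have hLam := P.Lam_pos hn
    have hLam1 := P.Lam_le hn
    have hn' : (1 : ℝ) ≤ n := by exact_mod_cast hn
    obtain ⟨g1, g2, g3, g4⟩ := hU.pos
    obtain ⟨W, hW⟩ : ∃ W, W = (n : ℝ) ^ P.τ * P.Lam n ^ (b + 1) := ⟨_, rfl⟩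
    have hW0 : 0 < W := by rw [hW]; positivity
    have hW' : (n : ℝ) ^ P.τ * P.Lam n ^ (b + 1 + 1) ≤ W := by
      rw [hW]; gcongr ?_ * ?_
      exact pow_le_pow_of_le_one hLam.le hLam1 (Nat.le_succ _)
    rw [← hW]
    refine ⟨fun u hu => (H0 n hn t σ δ α hU u hu).trans ?_, MMu a (b + 1) c t n σ δ α, ?_,
      fun u hu => MM_deriv_u _ _ _ _ _ _ _ _ hu⟩
    · rw [← hW]
      have : C0 ≤ C0 + ((2 * a + 2 * (b + 1)) * C1 + c * C2 + (4 * P.s0 ^ 2) * C3 + 2 * C4) := by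
        have : 0 ≤ ((2 * a + 2 * (b + 1)) * C1 + c * C2 + (4 * P.s0 ^ 2) * C3 + 2 * C4) := by
          positivity
        linarith
      gcongr
    · have s1 := (hW ▸ H1 n hn t σ δ α ht hU).smul (r := 2 * a + α * ((b + 1 : ℕ) : ℝ))
        (B := 2 * a + 2 * (b + 1)) (by
          rw [abs_of_nonneg (by positivity)]; push_cast
          have : α * (b + 1) ≤ 2 * (b + 1) := by gcongr
          linarith) (by positivity)
      have s2 := (hW ▸ H2 n hn t σ δ α ht hU).smul (r := (c : ℝ)) (B := c)
        (by rw [abs_of_nonneg (by positivity)]) (by positivity)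
      have s3 := (hW ▸ H3 n hn t σ δ α ht hU).smul (r := -σ ^ 2) (B := 4 * P.s0 ^ 2) (by
          rw [abs_neg, abs_of_nonneg (by positivity)]; nlinarith [hU.2.1]) (by positivity)
      have s4 := ((H4 n hn t σ δ α ht hU).mono
        (mul_le_mul_of_nonneg_left hW' hC4.le)).smul (r := -(α * t ^ 2)) (B := 2) (by
          rw [abs_neg, abs_of_nonneg (by positivity)]
          have : t ^ 2 ≤ 1 := by rwa [sq_le_one_iff_abs_le_one]
          nlinarith) (by positivity)
      refine (((s1.add s2).add s3).add s4).mono ?_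
      have : 0 ≤ C0 * W := by positivity
      nlinarith

/-- Bound (C): decay of the cosine integrals with at least one factor `LL`. -/
lemma JJ_le (P : Ctx) (a b c : ℕ) : ∃ C > 0, ∀ n : ℕ, 1 ≤ n → ∀ t σ δ α : ℝ, |t| ≤ 1 →
    P.U σ δ α → ∀ x, |JJ a (b + 1) c t n x σ δ α| ≤
      C * ((n : ℝ) ^ P.τ * P.Lam n ^ (b + 1)) * (1 + |x|) ^ (-(1 + P.β)) := by
  obtain ⟨C1, hC1, H1⟩ := MM_sym P 3 a b c
  obtain ⟨C2, hC2, H2⟩ := cos_tail P.β_pos P.β_lt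
  refine ⟨Real.pi⁻¹ * (C2 * C1), by positivity, fun n hn t σ δ α ht hU x => ?_⟩
  have hLam := P.Lam_pos hn
  obtain ⟨b0, G1, ⟨b1, G2, ⟨b2, G3, ⟨c3, b3⟩, d2⟩, d1⟩, d0⟩ := H1 n hn t σ δ α ht hU
  have := H2 _ G1 G2 G3 _ (by positivity) d0 d1 d2 c3 b0 b1 b2 b3 x
  unfold JJ
  rw [abs_mul, abs_of_pos (by positivity)]
  calc _ ≤ Real.pi⁻¹ * (C2 * (C1 * ((n : ℝ) ^ P.τ * P.Lam n ^ (b + 1))) *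
        (1 + |x|) ^ (-(1 + P.β))) := by gcongr
    _ = _ := by ring



/-! ### Differentiation of the cosine integrals in the parameters -/

lemma hasDerivAt_cosint (x : ℝ) {F F' : ℝ → ℝ → ℝ} {g : ℝ → ℝ} {s : ℝ} {S : Set ℝ}
    (hS : S ∈ 𝓝 s)
    (hF : ∀ r ∈ S, ∀ u, 0 < u → HasDerivAt (fun r => F r u) (F' r u) r)
    (hFc : ∀ r, ContinuousOn (F r) (Ioi 0)) (hF'c : ContinuousOn (F' s) (Ioi 0))
    (hFi : IntegrableOn (F s) (Ioi 0))
    (hg : IntegrableOn g (Ioi 0)) (hb : ∀ r ∈ S, ∀ u, 0 < u → |F' r u| ≤ g u) :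
    HasDerivAt (fun r => Real.pi⁻¹ * ∫ u in Ioi (0 : ℝ), Real.cos (u * x) * F r u)
      (Real.pi⁻¹ * ∫ u in Ioi (0 : ℝ), Real.cos (u * x) * F' s u) s := by
  have hcos : Continuous fun u : ℝ => Real.cos (u * x) := by fun_prop
  have hm : ∀ G : ℝ → ℝ, ContinuousOn G (Ioi 0) →
      AEStronglyMeasurable (fun u => Real.cos (u * x) * G u) (volume.restrict (Ioi 0)) :=
    fun G hG => (hcos.continuousOn.mul hG).aestronglyMeasurable measurableSet_Ioi
  have hle : ∀ (u v : ℝ), ‖Real.cos (u * x) * v‖ ≤ |v| := fun u v => by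
    rw [Real.norm_eq_abs, abs_mul]
    exact mul_le_of_le_one_left (abs_nonneg _) (Real.abs_cos_le_one _)
  refine ((hasDerivAt_integral_of_dominated_loc_of_deriv_le (bound := g)
    (F := fun r u => Real.cos (u * x) * F r u) (F' := fun r u => Real.cos (u * x) * F' r u)
    hS (Eventually.of_forall fun r => hm _ (hFc r)) ?_ (hm _ hF'c) ?_ hg ?_).2).const_mul _
  · refine Integrable.mono' hFi.norm (hm _ (hFc s)) (Eventually.of_forall fun u => ?_)
    simpa using hle u (F s u)
  · refine (ae_restrict_iff' measurableSet_Ioi).2 (Eventually.of_forall fun u hu r hr => ?_)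
    exact (hle u _).trans (hb r hr u hu)
  · refine (ae_restrict_iff' measurableSet_Ioi).2 (Eventually.of_forall fun u hu r hr => ?_)
    exact (hF r hr u hu).const_mul _

lemma integrableOn_exp_neg : IntegrableOn (fun u : ℝ => Real.exp (-u)) (Ioi 0) :=
  integrableOn_exp_neg_Ioi 0

lemma MM_dom (P : Ctx) (a b c : ℕ) (hbc : b = 0 → c = 0) {n : ℕ} (hn : 1 ≤ n) :
    ∃ g : ℝ → ℝ, IntegrableOn g (Ioi 0) ∧ (∀ u, 0 ≤ g u) ∧ ∀ t σ δ α, P.U σ δ α → ∀ u, 0 < u →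
      |MM a b c t n σ δ α u| ≤ g u := by
  rcases b with _ | b
  · obtain rfl := hbc rfl
    obtain ⟨C, hC, H⟩ := MM_le0 P a
    exact ⟨fun u => C * Real.exp (-u), integrableOn_exp_neg.const_mul C, fun u => by positivity,
      fun t σ δ α hU u hu => H n t σ δ α hU u hu⟩
  · obtain ⟨C, hC, H⟩ := MM_le P a b c
    refine ⟨fun u => |C * ((n : ℝ) ^ P.τ * P.Lam n ^ (b + 1)) * (u ^ P.β * Real.exp (-u))|,
      ((integrableOn_rpow_exp P.β_pos).const_mul _).abs, fun u => abs_nonneg _,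
      fun t σ δ α hU u hu => (H n hn t σ δ α hU u hu).trans (le_abs_self _)⟩

lemma MM_dom' (P : Ctx) (a b c : ℕ) {n : ℕ} (hn : 1 ≤ n) :
    ∃ g : ℝ → ℝ, IntegrableOn g (Ioi 0) ∧ (∀ u, 0 ≤ g u) ∧ ∀ t σ δ α, P.U σ δ α → ∀ u, 0 < u →
      |b * MM a b c t n σ δ α u| ≤ g u := by
  rcases b with _ | b
  · exact ⟨fun _ => 0, integrableOn_zero, fun _ => le_rfl, fun t σ δ α _ u _ => by simp⟩
  · obtain ⟨g, h1, h2, h3⟩ := MM_dom P a (b + 1) c (by simp) hn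
    refine ⟨fun u => ((b + 1 : ℕ) : ℝ) * g u, h1.const_mul _, fun u => by have := h2 u; positivity,
      fun t σ δ α hU u hu => ?_⟩
    rw [abs_mul, Nat.abs_cast]
    exact mul_le_mul_of_nonneg_left (h3 t σ δ α hU u hu) (by positivity)

lemma integrableOn_of_dom {F g : ℝ → ℝ} (hg : IntegrableOn g (Ioi 0)) (hF : ContinuousOn F (Ioi 0))
    (h : ∀ u, 0 < u → |F u| ≤ g u) : IntegrableOn F (Ioi 0) :=
  Integrable.mono' hg (hF.aestronglyMeasurable measurableSet_Ioi)
    ((ae_restrict_iff' measurableSet_Ioi).2 (Eventually.of_forall fun u hu => h u hu))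

lemma MM_int (P : Ctx) (a b c : ℕ) (hbc : b = 0 → c = 0) {n : ℕ} (hn : 1 ≤ n) (t : ℝ) {σ δ α : ℝ}
    (hU : P.U σ δ α) : IntegrableOn (fun u => MM a b c t n σ δ α u) (Ioi 0) := by
  obtain ⟨g, h1, h2, h3⟩ := MM_dom P a b c hbc hn
  exact integrableOn_of_dom h1 (MM_continuousOn _ _ _ _ _ _ _ _) fun u hu => h3 t σ δ α hU u hu

lemma cos_int (x : ℝ) {F : ℝ → ℝ} (hF : IntegrableOn F (Ioi 0)) :
    IntegrableOn (fun u => Real.cos (u * x) * F u) (Ioi 0) := by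
  have hcos : Continuous fun u : ℝ => Real.cos (u * x) := by fun_prop
  refine Integrable.bdd_mul (c := 1) hF hcos.aestronglyMeasurable
    (Eventually.of_forall fun u => Real.abs_cos_le_one _)

/-- linearity of the cosine integral -/
lemma cosint_add (x : ℝ) {F G : ℝ → ℝ} (hF : IntegrableOn F (Ioi 0)) (hG : IntegrableOn G (Ioi 0)) :
    Real.pi⁻¹ * ∫ u in Ioi (0 : ℝ), Real.cos (u * x) * (F u + G u) =
      (Real.pi⁻¹ * ∫ u in Ioi (0 : ℝ), Real.cos (u * x) * F u) +
      (Real.pi⁻¹ * ∫ u in Ioi (0 : ℝ), Real.cos (u * x) * G u) := by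
  simp only [mul_add]
  rw [integral_add (cos_int x hF) (cos_int x hG)]; ring

lemma cosint_smul (x r : ℝ) (F : ℝ → ℝ) :
    Real.pi⁻¹ * ∫ u in Ioi (0 : ℝ), Real.cos (u * x) * (r * F u) =
      r * (Real.pi⁻¹ * ∫ u in Ioi (0 : ℝ), Real.cos (u * x) * F u) := by
  simp only [mul_left_comm _ r]
  rw [integral_const_mul]; ring

lemma U_nhds_s {P : Ctx} {σ δ α : ℝ} (hU : P.U σ δ α) : {s | P.U s δ α} ∈ 𝓝 σ := by
  obtain ⟨h1, h2, h3, h4, h5, h6⟩ := hU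
  filter_upwards [Ioo_mem_nhds h1 h2] with s hs
  exact ⟨hs.1, hs.2, h3, h4, h5, h6⟩

lemma U_nhds_d {P : Ctx} {σ δ α : ℝ} (hU : P.U σ δ α) : {d | P.U σ d α} ∈ 𝓝 δ := by
  obtain ⟨h1, h2, h3, h4, h5, h6⟩ := hU
  filter_upwards [Ioo_mem_nhds h3 h4] with s hs
  exact ⟨h1, h2, hs.1, hs.2, h5, h6⟩

lemma U_nhds_a {P : Ctx} {σ δ α : ℝ} (hU : P.U σ δ α) : {d | P.U σ δ d} ∈ 𝓝 α := by
  obtain ⟨h1, h2, h3, h4, h5, h6⟩ := hU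
  filter_upwards [Ioo_mem_nhds h5 h6] with s hs
  exact ⟨h1, h2, h3, h4, hs.1, hs.2⟩

lemma JJ_deriv_s (P : Ctx) (a b c : ℕ) (hbc : b = 0 → c = 0) {n : ℕ} (hn : 1 ≤ n) (t x : ℝ)
    {σ δ α : ℝ} (hU : P.U σ δ α) :
    HasDerivAt (fun σ => JJ a b c t n x σ δ α) (-σ * JJ (a + 1) b c t n x σ δ α) σ := by
  obtain ⟨g, h1, h2, h3⟩ := MM_dom P (a + 1) b c hbc hn
  refine (hasDerivAt_cosint x (F := fun σ u => MM a b c t n σ δ α u)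
    (F' := fun σ u => -σ * MM (a + 1) b c t n σ δ α u) (g := fun u => 2 * P.s0 * g u)
    (U_nhds_s hU) (fun r _ u _ => MM_deriv_s a b c t n r δ α u)
    (fun r => MM_continuousOn _ _ _ _ _ _ _ _) ((MM_continuousOn _ _ _ _ _ _ _ _).const_mul _)
    (MM_int P a b c hbc hn t hU) (h1.const_mul _) ?_).congr_deriv ?_
  · intro r hr u hu
    have hp := hr.pos
    rw [abs_mul, abs_neg, abs_of_pos hp.1]
    exact mul_le_mul hr.2.1.le (h3 _ _ _ _ hr u hu) (abs_nonneg _) (by have := P.hs; linarith)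
  · rw [cosint_smul]; rfl

lemma JJ_deriv_t (P : Ctx) (a b c : ℕ) (hbc : b = 0 → c = 0) {n : ℕ} (hn : 1 ≤ n) (t x : ℝ)
    {σ δ α : ℝ} (hU : P.U σ δ α) :
    HasDerivAt (fun t => JJ a b c t n x σ δ α) (-(2 * t) * JJ a (b + 1) c t n x σ δ α) t := by
  obtain ⟨g, h1, h2, h3⟩ := MM_dom P a (b + 1) c (by simp) hn
  refine (hasDerivAt_cosint x (F := fun t u => MM a b c t n σ δ α u)
    (F' := fun t u => -(2 * t) * MM a (b + 1) c t n σ δ α u) (g := fun u => 2 * (|t| + 1) * g u)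
    (Metric.ball_mem_nhds t one_pos) (fun r _ u _ => MM_deriv_t a b c r n σ δ α u)
    (fun r => MM_continuousOn _ _ _ _ _ _ _ _) ((MM_continuousOn _ _ _ _ _ _ _ _).const_mul _)
    (MM_int P a b c hbc hn t hU) (h1.const_mul _) ?_).congr_deriv ?_
  · intro r hr u hu
    rw [Metric.mem_ball, Real.dist_eq] at hr
    rw [abs_mul, abs_neg, abs_mul, abs_two]
    have : |r| ≤ |t| + 1 := by
      have := abs_sub_abs_le_abs_sub r t; linarith
    exact mul_le_mul (by linarith) (h3 _ _ _ _ hU u hu) (abs_nonneg _) (by positivity)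
  · rw [cosint_smul]; rfl

lemma JJ_deriv_d (P : Ctx) (a b c : ℕ) (hbc : b = 0 → c = 0) {n : ℕ} (hn : 1 ≤ n) (t x : ℝ)
    {σ δ α : ℝ} (hU : P.U σ δ α) :
    HasDerivAt (fun δ => JJ a b c t n x σ δ α) (b * α * δ⁻¹ * JJ a b c t n x σ δ α +
      c * δ⁻¹ * JJ a b (c - 1) t n x σ δ α - t ^ 2 * α * δ⁻¹ * JJ a (b + 1) c t n x σ δ α) δ := by
  obtain ⟨g, h1, h2, h3⟩ := MM_dom P a b c hbc hn
  obtain ⟨g', h1', h2', h3'⟩ := MM_dom P a b (c - 1) (by intro h; simp [hbc h]) hn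
  obtain ⟨g'', h1'', h2'', h3''⟩ := MM_dom P a (b + 1) c (by simp) hn
  have hα := hU.pos.2.2
  have hd := P.hd
  refine (hasDerivAt_cosint x (F := fun δ u => MM a b c t n σ δ α u)
    (F' := fun δ u => b * α * δ⁻¹ * MM a b c t n σ δ α u + c * δ⁻¹ * MM a b (c - 1) t n σ δ α u
        + (- (t ^ 2 * α * δ⁻¹)) * MM a (b + 1) c t n σ δ α u)
    (g := fun u => b * α * (2 / P.d0) * g u + c * (2 / P.d0) * g' u + t ^ 2 * α * (2 / P.d0) * g'' u)
    (U_nhds_d hU) (fun r hr u _ => (MM_deriv_d a b c t n σ α u hr.pos.2.1).congr_deriv (by ring))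
    (fun r => MM_continuousOn _ _ _ _ _ _ _ _)
    ((((MM_continuousOn _ _ _ _ _ _ _ _).const_mul _).add
      ((MM_continuousOn _ _ _ _ _ _ _ _).const_mul _)).add
      ((MM_continuousOn _ _ _ _ _ _ _ _).const_mul _))
    (MM_int P a b c hbc hn t hU)
    (by exact ((h1.const_mul _).add (h1'.const_mul _)).add (h1''.const_mul _)) ?_).congr_deriv ?_
  · intro r hr u hu
    have hp := hr.pos
    have hr1 : r⁻¹ ≤ 2 / P.d0 := by
      rw [inv_le_comm₀ hp.2.1 (by positivity), inv_div]; exact hr.2.2.1.le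
    have hr0 : 0 < r⁻¹ := inv_pos.2 hp.2.1
    have hα1 := hα.1
    refine (abs_add_le _ _).trans (add_le_add ((abs_add_le _ _).trans (add_le_add ?_ ?_)) ?_)
    · rw [abs_mul, abs_of_nonneg (by positivity)]
      exact mul_le_mul (by gcongr) (h3 _ _ _ _ hr u hu) (abs_nonneg _) (by positivity)
    · rw [abs_mul, abs_of_nonneg (by positivity)]
      exact mul_le_mul (by gcongr) (h3' _ _ _ _ hr u hu) (abs_nonneg _) (by positivity)
    · rw [abs_mul, abs_neg, abs_of_nonneg (a := t ^ 2 * α * r⁻¹) (by positivity)]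
      exact mul_le_mul (by gcongr) (h3'' _ _ _ _ hr u hu) (abs_nonneg _) (by positivity)
  · have i1 := (MM_int P a b c hbc hn t hU).const_mul (b * α * δ⁻¹)
    have i2 := (MM_int P a b (c - 1) (by intro h; simp [hbc h]) hn t hU).const_mul (c * δ⁻¹)
    have i3 := (MM_int P a (b + 1) c (by simp) hn t hU).const_mul (-(t ^ 2 * α * δ⁻¹))
    have i12 : IntegrableOn (fun u => b * α * δ⁻¹ * MM a b c t n σ δ α u +
      c * δ⁻¹ * MM a b (c - 1) t n σ δ α u) (Ioi 0) := i1.add i2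
    rw [cosint_add x i12 i3, cosint_add x i1 i2, cosint_smul, cosint_smul, cosint_smul]
    simp only [JJ]; ring

lemma JJ_deriv_a (P : Ctx) (a b c : ℕ) (hbc : b = 0 → c = 0) {n : ℕ} (hn : 1 ≤ n) (t x : ℝ)
    {σ δ α : ℝ} (hU : P.U σ δ α) :
    HasDerivAt (fun α => JJ a b c t n x σ δ α) (b * JJ a b (c + 1) t n x σ δ α
      - t ^ 2 * JJ a (b + 1) (c + 1) t n x σ δ α) α := by
  obtain ⟨g, h1, h2, h3⟩ := MM_dom' P a b (c + 1) hn
  obtain ⟨g'', h1'', h2'', h3''⟩ := MM_dom P a (b + 1) (c + 1) (by simp) hn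
  refine (hasDerivAt_cosint x (F := fun α u => MM a b c t n σ δ α u)
    (F' := fun α u => b * MM a b (c + 1) t n σ δ α u
        + (- (t ^ 2)) * MM a (b + 1) (c + 1) t n σ δ α u)
    (g := fun u => g u + t ^ 2 * g'' u)
    (U_nhds_a hU) (fun r hr u _ => (MM_deriv_a a b c t n σ δ r u).congr_deriv (by ring))
    (fun r => MM_continuousOn _ _ _ _ _ _ _ _)
    (((MM_continuousOn _ _ _ _ _ _ _ _).const_mul _).add
      ((MM_continuousOn _ _ _ _ _ _ _ _).const_mul _))
    (MM_int P a b c hbc hn t hU)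
    (by exact h1.add (h1''.const_mul _)) ?_).congr_deriv ?_
  · intro r hr u hu
    refine (abs_add_le _ _).trans (add_le_add (h3 _ _ _ _ hr u hu) ?_)
    rw [abs_mul, abs_neg, abs_of_nonneg (a := t ^ 2) (by positivity)]
    exact mul_le_mul_of_nonneg_left (h3'' _ _ _ _ hr u hu) (by positivity)
  · have i1 : IntegrableOn (fun u => (b : ℝ) * MM a b (c + 1) t n σ δ α u) (Ioi 0) :=
      integrableOn_of_dom h1 ((MM_continuousOn _ _ _ _ _ _ _ _).const_mul _)
        fun u hu => h3 t σ δ α hU u hu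
    have i3 := (MM_int P a (b + 1) (c + 1) (by simp) hn t hU).const_mul (-(t ^ 2))
    rw [cosint_add x i1 i3, cosint_smul, cosint_smul]
    simp only [JJ]; ring



/-! ### Gaussian part -/

lemma integral_cos_gauss {b : ℝ} (hb : 0 < b) (t : ℝ) :
    ∫ x : ℝ, Real.cos (t * x) * Real.exp (-b * x ^ 2) =
      Real.sqrt (Real.pi / b) * Real.exp (-t ^ 2 / (4 * b)) := by
  have h := fourierIntegral_gaussian (b := (b : ℂ)) (by simpa using hb) (t : ℂ)
  have hIntg : Integrable fun x : ℝ => Complex.exp (Complex.I * t * x) * Complex.exp (-b * x ^ 2) := by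
    have := integrable_cexp_neg_mul_sq (b := (b : ℂ)) (by simpa using hb)
    refine this.bdd_mul (c := 1) (by fun_prop) (Eventually.of_forall fun x => ?_)
    rw [Complex.norm_exp]; simp
  have h1 : (∫ x : ℝ, Complex.exp (Complex.I * t * x) * Complex.exp (-b * x ^ 2)).re =
      ∫ x : ℝ, Real.cos (t * x) * Real.exp (-b * x ^ 2) := by
    have := integral_re hIntg
    rw [RCLike.re_eq_complex_re] at this
    rw [← this]
    refine integral_congr_ae (Eventually.of_forall fun x => ?_)
    have e1 : Complex.exp (-b * x ^ 2) = ((Real.exp (-b * x ^ 2) : ℝ) : ℂ) := by push_cast; rfl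
    beta_reduce
    rw [e1, Complex.re_mul_ofReal, Complex.exp_re]
    simp
  rw [← h1, h]
  have e2 : ((Real.pi : ℂ) / b) ^ (1 / 2 : ℂ) = ((Real.sqrt (Real.pi / b) : ℝ) : ℂ) := by
    rw [Real.sqrt_eq_rpow, Complex.ofReal_cpow (by positivity)]; push_cast; rfl
  have e3 : Complex.exp (-(t : ℂ) ^ 2 / (4 * b)) = ((Real.exp (-t ^ 2 / (4 * b)) : ℝ) : ℂ) := by
    push_cast; rfl
  rw [e2, e3, ← Complex.ofReal_mul, Complex.ofReal_re]

/-- Unnormalised Gaussian. -/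
def Eg (x σ : ℝ) : ℝ := Real.exp (-(x ^ 2) / (2 * σ ^ 2))

lemma Eg_pos (x σ : ℝ) : 0 < Eg x σ := Real.exp_pos _

lemma Eg_deriv (x : ℝ) {σ : ℝ} (hσ : 0 < σ) :
    HasDerivAt (fun σ => Eg x σ) (x ^ 2 * σ⁻¹ ^ 3 * Eg x σ) σ := by
  unfold Eg
  have h := ((hasDerivAt_pow 2 σ).const_mul 2)
  have h2 := ((hasDerivAt_const σ (-(x ^ 2))).div h (by positivity)).exp
  refine h2.congr_deriv ?_
  simp only [Pi.div_apply, neg_div]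
  field_simp
  simp

/-- Gaussian density with standard deviation `σ`. -/
def phiS (σ x : ℝ) : ℝ := (Real.sqrt (2 * Real.pi))⁻¹ * σ⁻¹ * Eg x σ

lemma JJ_gauss (n : ℕ) (x : ℝ) {σ : ℝ} (hσ : 0 < σ) (δ α : ℝ) :
    JJ 0 0 0 0 n x σ δ α = phiS σ x := by
  have h := integral_cos_gauss (b := σ ^ 2 / 2) (by positivity) x
  have h2 : ∫ u : ℝ, Real.cos (x * u) * Real.exp (-(σ ^ 2 / 2) * u ^ 2) =
      2 * ∫ u in Ioi (0 : ℝ), Real.cos (x * u) * Real.exp (-(σ ^ 2 / 2) * u ^ 2) := by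
    rw [← integral_comp_abs]
    refine integral_congr_ae (Eventually.of_forall fun u => ?_)
    simp only [sq_abs]
    rcases abs_cases u with ⟨h, _⟩ | ⟨h, _⟩ <;> simp [h]
  have h3 : ∫ u in Ioi (0 : ℝ), Real.cos (u * x) * MM 0 0 0 0 n σ δ α u =
      ∫ u in Ioi (0 : ℝ), Real.cos (x * u) * Real.exp (-(σ ^ 2 / 2) * u ^ 2) := by
    refine integral_congr_ae (Eventually.of_forall fun u => ?_)
    simp only [MM]
    rw [mul_comm u x]; congr 1
    simp only [pow_zero, mul_zero, one_mul]
    congr 1; ring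
  have h4 : ∫ u in Ioi (0 : ℝ), Real.cos (x * u) * Real.exp (-(σ ^ 2 / 2) * u ^ 2) =
      (1 / 2) * (Real.sqrt (Real.pi / (σ ^ 2 / 2)) * Real.exp (-x ^ 2 / (4 * (σ ^ 2 / 2)))) := by
    linarith
  rw [JJ, h3, h4, phiS, Eg]
  have e1 : Real.sqrt (Real.pi / (σ ^ 2 / 2)) = Real.sqrt (2 * Real.pi) * σ⁻¹ := by
    rw [show Real.pi / (σ ^ 2 / 2) = (2 * Real.pi) * (σ⁻¹) ^ 2 by field_simp,
      Real.sqrt_mul (by positivity), Real.sqrt_sq (by positivity)]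
  have e2 : -x ^ 2 / (4 * (σ ^ 2 / 2)) = -(x ^ 2) / (2 * σ ^ 2) := by
    rw [show 4 * (σ ^ 2 / 2) = 2 * σ ^ 2 by ring]
  rw [e1, e2]
  have e3 : Real.sqrt (2 * Real.pi) * Real.sqrt (2 * Real.pi) = 2 * Real.pi :=
    Real.mul_self_sqrt (by positivity)
  have e4 : 0 < Real.sqrt (2 * Real.pi) := by positivity
  have e5 : Real.pi⁻¹ * (1 / 2 * Real.sqrt (2 * Real.pi)) = (Real.sqrt (2 * Real.pi))⁻¹ := by
    rw [eq_comm, inv_eq_iff_eq_inv, eq_comm]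
    field_simp
    rw [Real.sq_sqrt (by positivity)]
  rw [← e5]; ring

/-- Gaussian times polynomial. -/
inductive GP : ℕ → (ℝ → ℝ → ℝ) → Prop
  | mono (m i j : ℕ) (h : i ≤ m) : GP m (fun x σ => x ^ (2 * i) * σ⁻¹ ^ j * Eg x σ)
  | add {m : ℕ} {F G : ℝ → ℝ → ℝ} (hF : GP m F) (hG : GP m G) : GP m (fun x σ => F x σ + G x σ)
  | smul {m : ℕ} {F : ℝ → ℝ → ℝ} (r : ℝ) (hF : GP m F) : GP m (fun x σ => r * F x σ)

lemma GP.deriv {m : ℕ} {F : ℝ → ℝ → ℝ} (h : GP m F) : ∃ F', GP (m + 1) F' ∧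
    ∀ x σ, 0 < σ → HasDerivAt (fun σ => F x σ) (-σ * F' x σ) σ := by
  induction h with
  | mono i j hi =>
    refine ⟨_, GP.add (GP.smul j (GP.mono (m + 1) i (j + 2) (by omega)))
      (GP.smul (-1) (GP.mono (m + 1) (i + 1) (j + 4) (by omega))), fun x σ hσ => ?_⟩
    have h1 : HasDerivAt (fun σ : ℝ => σ⁻¹ ^ j) (-(j * σ⁻¹ ^ (j + 1))) σ := by
      have := (hasDerivAt_inv hσ.ne').pow j
      refine this.congr_deriv ?_
      rcases j with _ | j
      · simp
      · rw [show -(σ ^ 2)⁻¹ = -(σ⁻¹ ^ 2) by rw [inv_pow]]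
        rw [Nat.add_sub_cancel]; ring
    have h2 := ((h1.const_mul (x ^ (2 * i))).mul (Eg_deriv x hσ))
    refine h2.congr_deriv ?_
    have e : σ * σ⁻¹ = 1 := mul_inv_cancel₀ hσ.ne'
    generalize σ⁻¹ = w at *
    have e2 : ∀ k, σ * w ^ (k + 1) = w ^ k := fun k => by rw [pow_succ']; rw [← mul_assoc, e, one_mul]
    have e3 := e2 (j + 1)
    have e4 := e2 (j + 3)
    rw [show -σ * (↑j * (x ^ (2 * i) * w ^ (j + 2) * Eg x σ) +
      -1 * (x ^ (2 * (i + 1)) * w ^ (j + 4) * Eg x σ)) =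
      -(j * (x ^ (2 * i) * (σ * w ^ (j + 1 + 1)) * Eg x σ)) +
      (x ^ (2 * (i + 1)) * (σ * w ^ (j + 3 + 1)) * Eg x σ) by ring, e3, e4]
    ring
  | add _ _ ih1 ih2 =>
    obtain ⟨F', h1, h2⟩ := ih1
    obtain ⟨G', h3, h4⟩ := ih2
    exact ⟨_, h1.add h3, fun x σ hσ => ((h2 x σ hσ).add (h4 x σ hσ)).congr_deriv (by ring)⟩
  | smul r _ ih =>
    obtain ⟨F', h1, h2⟩ := ih
    exact ⟨_, h1.smul r, fun x σ hσ => ((h2 x σ hσ).const_mul r).congr_deriv (by ring)⟩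

lemma GP.bound {m : ℕ} {F : ℝ → ℝ → ℝ} (h : GP m F) {s : ℝ} (hs : 0 < s) : ∃ C > 0,
    ∀ x σ, s < σ → |F x σ| ≤ C * ((1 + |x|) ^ (2 * m) * Eg x σ) := by
  induction h with
  | mono i j hi =>
    refine ⟨s⁻¹ ^ j, by positivity, fun x σ hσ => ?_⟩
    have h0 : 0 < σ := hs.trans hσ
    have hE := Eg_pos x σ
    rw [abs_mul, abs_mul, abs_of_pos hE, abs_pow, abs_pow, abs_of_pos (inv_pos.2 h0)]
    have h1 : |x| ^ (2 * i) ≤ (1 + |x|) ^ (2 * m) :=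
      (pow_le_pow_left₀ (abs_nonneg x) (by linarith) _).trans
        (pow_le_pow_right₀ (by linarith [abs_nonneg x]) (by omega))
    have h2 : σ⁻¹ ^ j ≤ s⁻¹ ^ j := pow_le_pow_left₀ (by positivity) (inv_anti₀ hs hσ.le) _
    calc |x| ^ (2 * i) * σ⁻¹ ^ j * Eg x σ ≤ (1 + |x|) ^ (2 * m) * s⁻¹ ^ j * Eg x σ := by gcongr
      _ = _ := by ring
  | add _ _ ih1 ih2 =>
    obtain ⟨C, hC, h1⟩ := ih1
    obtain ⟨D, hD, h2⟩ := ih2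
    refine ⟨C + D, by positivity, fun x σ hσ => (abs_add_le _ _).trans ?_⟩
    rw [add_mul]; exact add_le_add (h1 x σ hσ) (h2 x σ hσ)
  | smul r _ ih =>
    obtain ⟨C, hC, h1⟩ := ih
    refine ⟨|r| * C + C, by positivity, fun x σ hσ => ?_⟩
    rw [abs_mul, add_mul, mul_assoc]
    have := mul_le_mul_of_nonneg_left (h1 x σ hσ) (abs_nonneg r)
    have := (abs_nonneg _).trans (h1 x σ hσ)
    linarith

lemma JJ_GP (P : Ctx) (a : ℕ) : ∃ F, GP a F ∧ ∀ n : ℕ, 1 ≤ n → ∀ x σ δ α, P.U σ δ α →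
    JJ a 0 0 0 n x σ δ α = F x σ := by
  induction a with
  | zero =>
    refine ⟨_, (GP.mono 0 0 1 le_rfl).smul ((Real.sqrt (2 * Real.pi))⁻¹), fun n _ x σ δ α hU => ?_⟩
    rw [JJ_gauss n x hU.pos.1, phiS]; ring
  | succ a ih =>
    obtain ⟨F, hF, H⟩ := ih
    obtain ⟨F', hF', H'⟩ := hF.deriv
    refine ⟨F', hF', fun n hn x σ δ α hU => ?_⟩
    have h1 := JJ_deriv_s P a 0 0 (fun _ => rfl) hn 0 x hU
    have h2 := H' x σ hU.pos.1
    have h3 : (fun σ => JJ a 0 0 0 n x σ δ α) =ᶠ[𝓝 σ] fun σ => F x σ := by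
      filter_upwards [U_nhds_s hU] with s hs
      exact H n hn x s δ α hs
    have h4 := h1.unique (h2.congr_of_eventuallyEq h3)
    have hσ := hU.pos.1
    exact mul_left_cancel₀ (neg_ne_zero.2 hσ.ne') h4

lemma JJ_gauss_le (P : Ctx) (a : ℕ) : ∃ C > 0, ∀ n : ℕ, 1 ≤ n → ∀ x σ δ α, P.U σ δ α →
    |JJ a 0 0 0 n x σ δ α| ≤ C * ((1 + |x|) ^ (2 * a) * Eg x σ) := by
  obtain ⟨F, hF, H⟩ := JJ_GP P a
  obtain ⟨C, hC, h⟩ := hF.bound (s := P.s0 / 2) (by have := P.hs; positivity)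
  exact ⟨C, hC, fun n hn x σ δ α hU => by rw [H n hn x σ δ α hU]; exact h x σ hU.1⟩

lemma JJ_t_diff (P : Ctx) (a b c : ℕ) (hbc : b = 0 → c = 0) : ∃ C > 0, ∀ n : ℕ, 1 ≤ n →
    ∀ t σ δ α, t ∈ Icc (0 : ℝ) 1 → P.U σ δ α → ∀ x,
    |JJ a b c t n x σ δ α - JJ a b c 0 n x σ δ α| ≤
      C * ((n : ℝ) ^ P.τ * P.Lam n ^ (b + 1)) * (1 + |x|) ^ (-(1 + P.β)) := by
  obtain ⟨C, hC, H⟩ := JJ_le P a b c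
  refine ⟨2 * C, by positivity, fun n hn t σ δ α ht hU x => ?_⟩
  have := Convex.norm_image_sub_le_of_norm_hasDerivWithin_le (s := Icc (0 : ℝ) 1)
    (f := fun t => JJ a b c t n x σ δ α) (f' := fun t => -(2 * t) * JJ a (b + 1) c t n x σ δ α)
    (C := 2 * (C * ((n : ℝ) ^ P.τ * P.Lam n ^ (b + 1)) * (1 + |x|) ^ (-(1 + P.β))))
    (fun s _ => (JJ_deriv_t P a b c hbc hn s x hU).hasDerivWithinAt) ?_ (convex_Icc _ _)
    (x := 0) (y := t) (by simp) ht
  · rw [Real.norm_eq_abs, Real.norm_eq_abs, sub_zero, abs_of_nonneg ht.1] at this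
    have hL := P.Lam_pos hn
    calc _ ≤ _ := this
      _ ≤ 2 * (C * ((n : ℝ) ^ P.τ * P.Lam n ^ (b + 1)) * (1 + |x|) ^ (-(1 + P.β))) * 1 := by
        gcongr; exact ht.2
      _ = _ := by ring
  · intro s hs
    rw [Real.norm_eq_abs, abs_mul, abs_neg, abs_mul, abs_two, abs_of_nonneg hs.1]
    refine mul_le_mul (by linarith [hs.2]) (H n hn s σ δ α ?_ hU x) (abs_nonneg _) (by norm_num)
    rw [abs_of_nonneg hs.1]; exact hs.2

/-- Bound of the non-stable class. -/
lemma JJ_le0 (P : Ctx) (a : ℕ) : ∃ C > 0, ∀ n : ℕ, 1 ≤ n → ∀ σ δ α, P.U σ δ α → ∀ x,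
    |JJ a 0 0 1 n x σ δ α| ≤ C * ((1 + |x|) ^ (2 * a) * Eg x σ +
      (n : ℝ) ^ P.τ * P.Lam n * (1 + |x|) ^ (-(1 + P.β))) := by
  obtain ⟨C, hC, H⟩ := JJ_gauss_le P a
  obtain ⟨D, hD, H'⟩ := JJ_t_diff P a 0 0 (fun _ => rfl)
  refine ⟨C + D, by positivity, fun n hn σ δ α hU x => ?_⟩
  have h1 := H n hn x σ δ α hU
  have h2 := H' n hn 1 σ δ α (by simp) hU x
  have h3 := abs_add_le (JJ a 0 0 1 n x σ δ α - JJ a 0 0 0 n x σ δ α) (JJ a 0 0 0 n x σ δ α)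
  rw [sub_add_cancel] at h3
  rw [zero_add, pow_one] at h2
  have hL := P.Lam_pos hn
  have p1 : 0 ≤ (1 + |x|) ^ (2 * a) * Eg x σ := by have := Eg_pos x σ; positivity
  have p2 : 0 ≤ (n : ℝ) ^ P.τ * P.Lam n * (1 + |x|) ^ (-(1 + P.β)) := by positivity
  nlinarith [mul_nonneg hC.le p2, mul_nonneg hD.le p1]

/-- Second order expansion. -/
lemma JJ_second (P : Ctx) : ∃ C > 0, ∀ n : ℕ, 1 ≤ n → ∀ σ δ α, P.U σ δ α → ∀ x,
    |JJ 0 0 0 1 n x σ δ α - phiS σ x + JJ 0 1 0 0 n x σ δ α| ≤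
      C * ((n : ℝ) ^ P.τ * P.Lam n ^ 2) * (1 + |x|) ^ (-(1 + P.β)) := by
  obtain ⟨C, hC, H⟩ := JJ_t_diff P 0 1 0 (by simp)
  refine ⟨2 * C, by positivity, fun n hn σ δ α hU x => ?_⟩
  have := Convex.norm_image_sub_le_of_norm_hasDerivWithin_le (s := Icc (0 : ℝ) 1)
    (f := fun t => JJ 0 0 0 t n x σ δ α + t ^ 2 * JJ 0 1 0 0 n x σ δ α)
    (f' := fun t => -(2 * t) * (JJ 0 1 0 t n x σ δ α - JJ 0 1 0 0 n x σ δ α))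
    (C := 2 * (C * ((n : ℝ) ^ P.τ * P.Lam n ^ 2) * (1 + |x|) ^ (-(1 + P.β))))
    (fun s _ => (((JJ_deriv_t P 0 0 0 (by simp) hn s x hU).add
      ((hasDerivAt_pow 2 s).mul_const _)).congr_deriv ?_).hasDerivWithinAt) ?_ (convex_Icc _ _)
    (x := 0) (y := 1) (by simp) (by simp)
  · rw [Real.norm_eq_abs, Real.norm_eq_abs, JJ_gauss n x hU.pos.1] at this
    have e : JJ 0 0 0 1 n x σ δ α - phiS σ x + JJ 0 1 0 0 n x σ δ α =
      JJ 0 0 0 1 n x σ δ α + 1 ^ 2 * JJ 0 1 0 0 n x σ δ α -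
        (phiS σ x + 0 ^ 2 * JJ 0 1 0 0 n x σ δ α) := by ring
    rw [e]
    refine this.trans_eq ?_
    simp; ring
  · simp; ring
  · intro s hs
    rw [Real.norm_eq_abs, abs_mul, abs_neg, abs_mul, abs_two, abs_of_nonneg hs.1]
    exact mul_le_mul (by linarith [hs.2]) (H n hn s σ δ α hs hU x) (abs_nonneg _) (by norm_num)



/-! ### Lower bound for the first order stable term -/

/-- Dominating kernel. -/
def mstar (P : Ctx) (z : ℝ) : ℝ :=
  if z ≤ 1 then z ^ (1 - P.a0 - P.τ) else z ^ (-1 - P.a0 + P.τ)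

lemma mstar_nonneg (P : Ctx) {z : ℝ} (hz : 0 < z) : 0 ≤ mstar P z := by
  unfold mstar; split_ifs <;> positivity

lemma mstar_int (P : Ctx) : IntegrableOn (mstar P) (Ioi 0) := by
  have h1 : IntegrableOn (mstar P) (Ioc 0 1) := by
    have := (intervalIntegral.intervalIntegrable_rpow' (a := 0) (b := 1)
      (r := 1 - P.a0 - P.τ) (by have := P.τ_lt; have := P.hτ; linarith))
    rw [intervalIntegrable_iff_integrableOn_Ioc_of_le zero_le_one] at this
    refine this.congr_fun (fun z hz => ?_) measurableSet_Ioc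
    simp only [mstar]; rw [if_pos hz.2]
  have h2 : IntegrableOn (mstar P) (Ioi 1) := by
    have := integrableOn_Ioi_rpow_of_lt (a := -1 - P.a0 + P.τ)
      (by have := P.hτ1; have := P.ha; linarith) one_pos
    refine this.congr_fun (fun z hz => ?_) measurableSet_Ioi
    simp only [mstar]; rw [if_neg (not_le.2 hz)]
  rw [← Ioc_union_Ioi_eq_Ioi zero_le_one]
  exact h1.union h2

def mz (z : ℝ) : ℝ := min (z ^ 2) 1

lemma mz_nonneg (z : ℝ) : 0 ≤ mz z := le_min (sq_nonneg _) zero_le_one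

lemma mz_le (P : Ctx) {σ δ α z : ℝ} (hU : P.U σ δ α) (hz : 0 < z) :
    mz z * z ^ (-1 - α) ≤ mstar P z := by
  obtain ⟨_, _, _, _, h5, h6⟩ := hU
  unfold mstar
  split_ifs with h
  · calc mz z * z ^ (-1 - α) ≤ z ^ (2 : ℝ) * z ^ (-1 - α) := by
          gcongr; rw [Real.rpow_two]; exact min_le_left _ _
      _ = z ^ (1 - α) := by rw [← Real.rpow_add hz]; congr 1; ring
      _ ≤ _ := Real.rpow_le_rpow_of_exponent_ge hz h (by linarith)
  · calc mz z * z ^ (-1 - α) ≤ 1 * z ^ (-1 - α) := by gcongr; exact min_le_right _ _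
      _ = z ^ (-1 - α) := one_mul _
      _ ≤ _ := Real.rpow_le_rpow_of_exponent_le (not_le.1 h).le (by linarith)

lemma one_sub_cos_le (u z : ℝ) : 1 - Real.cos (u * z) ≤ (2 + u ^ 2) * mz z := by
  have h1 := Real.one_sub_sq_div_two_le_cos (x := u * z)
  have h2 := Real.neg_one_le_cos (u * z)
  unfold mz
  rcases le_total (z ^ 2) 1 with h | h
  · rw [min_eq_left h]; nlinarith [sq_nonneg z, sq_nonneg (u * z)]
  · rw [min_eq_right h]; nlinarith [sq_nonneg u]

lemma ker_int (P : Ctx) {σ δ α : ℝ} (hU : P.U σ δ α) (u : ℝ) :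
    IntegrableOn (fun z => (1 - Real.cos (u * z)) * z ^ (-1 - α)) (Ioi 0) := by
  refine Integrable.mono' ((mstar_int P).const_mul (2 + u ^ 2)) (by fun_prop)
    ((ae_restrict_iff' measurableSet_Ioi).2 (Eventually.of_forall fun z hz => ?_))
  have hz : 0 < z := hz
  have h0 : 0 ≤ 1 - Real.cos (u * z) := by linarith [Real.cos_le_one (u * z)]
  rw [Real.norm_eq_abs, abs_of_nonneg (by positivity)]
  calc _ ≤ (2 + u ^ 2) * mz z * z ^ (-1 - α) := by gcongr; exact one_sub_cos_le u z
    _ = (2 + u ^ 2) * (mz z * z ^ (-1 - α)) := by ring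
    _ ≤ _ := by gcongr; exact mz_le P hU hz

def Ia (α : ℝ) : ℝ := ∫ z in Ioi (0 : ℝ), (1 - Real.cos z) * z ^ (-1 - α)

lemma Ia_scale (α : ℝ) {u : ℝ} (hu : 0 < u) :
    ∫ z in Ioi (0 : ℝ), (1 - Real.cos (u * z)) * z ^ (-1 - α) = u ^ α * Ia α := by
  have h := integral_comp_mul_left_Ioi (fun z => (1 - Real.cos z) * z ^ (-1 - α)) 0 hu
  rw [mul_zero, smul_eq_mul] at h
  have h2 : ∫ z in Ioi (0 : ℝ), (1 - Real.cos (u * z)) * (u * z) ^ (-1 - α) =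
      u ^ (-1 - α) * ∫ z in Ioi (0 : ℝ), (1 - Real.cos (u * z)) * z ^ (-1 - α) := by
    rw [← integral_const_mul]
    refine setIntegral_congr_fun measurableSet_Ioi fun z hz => ?_
    rw [Real.mul_rpow hu.le (le_of_lt hz)]; ring
  rw [h2] at h
  have h3 : u ^ (1 + α) * u ^ (-1 - α) = 1 := by
    rw [← Real.rpow_add hu]; simp
  have h4 : u ^ (1 + α) = u * u ^ α := by rw [Real.rpow_add hu, Real.rpow_one]
  have h5 := congrArg (fun t => u ^ (1 + α) * t) h
  simp only [← mul_assoc] at h5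
  rw [h3, one_mul, h4] at h5
  rw [h5, Ia]
  field_simp

lemma Ia_bounds (P : Ctx) : ∃ c > 0, ∃ C > 0, ∀ σ δ α, P.U σ δ α → c ≤ Ia α ∧ Ia α ≤ C := by
  have hc : 0 < 1 - Real.cos 1 := by have := Real.cos_lt_cos_of_nonneg_of_le_pi le_rfl (by linarith [Real.pi_gt_three]) (zero_lt_one (α := ℝ)); rw [Real.cos_zero] at this; linarith
  refine ⟨(1 - Real.cos 1) * 2 ^ (-3 : ℝ), by positivity,
    3 * (∫ z in Ioi (0 : ℝ), mstar P z) + 1, ?_, fun σ δ α hU => ⟨?_, ?_⟩⟩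
  · have : 0 ≤ ∫ z in Ioi (0 : ℝ), mstar P z :=
      setIntegral_nonneg measurableSet_Ioi fun z hz => mstar_nonneg P hz
    positivity
  · have hk := ker_int P hU 1
    simp only [one_mul] at hk
    have h1 : ∫ z in Ioc (1 : ℝ) 2, (1 - Real.cos z) * z ^ (-1 - α) ≤ Ia α := by
      refine setIntegral_mono_set hk ?_ (Eventually.of_forall fun z hz => ?_)
      · refine (ae_restrict_iff' measurableSet_Ioi).2 (Eventually.of_forall fun z hz => ?_)
        have hz : 0 < z := hz
        have : 0 ≤ 1 - Real.cos z := by linarith [Real.cos_le_one z]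
        exact mul_nonneg this (by positivity)
      · exact lt_trans one_pos hz.1
    refine le_trans ?_ h1
    have h2 : ∫ z in Ioc (1 : ℝ) 2, ((1 - Real.cos 1) * 2 ^ (-3 : ℝ)) ≤
        ∫ z in Ioc (1 : ℝ) 2, (1 - Real.cos z) * z ^ (-1 - α) := by
      refine setIntegral_mono_on (integrableOn_const (by simp)) (hk.mono_set fun z hz => lt_trans one_pos hz.1)
        measurableSet_Ioc fun z hz => ?_
      have hz0 : 0 < z := lt_trans one_pos hz.1
      have hcos : Real.cos z ≤ Real.cos 1 := by
        refine Real.cos_le_cos_of_nonneg_of_le_pi zero_le_one ?_ hz.1.le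
        linarith [hz.2, Real.pi_gt_three]
      have h3 : (2 : ℝ) ^ (-3 : ℝ) ≤ z ^ (-1 - α) :=
        calc (2 : ℝ) ^ (-3 : ℝ) ≤ 2 ^ (-1 - α) :=
              Real.rpow_le_rpow_of_exponent_le (by norm_num) (by linarith [hU.pos.2.2.2])
          _ ≤ z ^ (-1 - α) :=
              Real.rpow_le_rpow_of_nonpos hz0 hz.2 (by linarith [hU.pos.2.2.1])
      exact mul_le_mul (by linarith) h3 (by positivity) (by linarith)
    refine le_trans (le_of_eq ?_) h2
    simp; norm_num
  · have hk := ker_int P hU 1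
    simp only [one_mul] at hk
    have : Ia α ≤ ∫ z in Ioi (0 : ℝ), 3 * mstar P z := by
      refine setIntegral_mono_on hk ((mstar_int P).const_mul 3) measurableSet_Ioi fun z hz => ?_
      have hz : 0 < z := hz
      have := one_sub_cos_le 1 z
      rw [one_mul] at this
      calc _ ≤ (2 + 1 ^ 2) * mz z * z ^ (-1 - α) := by gcongr
        _ = 3 * (mz z * z ^ (-1 - α)) := by ring
        _ ≤ _ := by gcongr; exact mz_le P hU hz
    rw [integral_const_mul] at this
    linarith

lemma JJ01_eq (P : Ctx) {n : ℕ} (hn : 1 ≤ n) {σ δ α : ℝ} (hU : P.U σ δ α) (x : ℝ) :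
    Ia α * (-JJ 0 1 0 0 n x σ δ α) = (n : ℝ) ^ (α / 2 - 1) * δ ^ α *
      ∫ z in Ioi (0 : ℝ), z ^ (-1 - α) * ((phiS σ (x + z) + phiS σ (x - z)) / 2 - phiS σ x) ∧
    IntegrableOn (fun z => z ^ (-1 - α) *
      ((phiS σ (x + z) + phiS σ (x - z)) / 2 - phiS σ x)) (Ioi 0) := by
  obtain ⟨hσ, hδ, hα, hα2⟩ := hU.pos
  have hgi : IntegrableOn (fun u : ℝ => Real.exp (-(σ ^ 2 * u ^ 2) / 2)) (Ioi 0) := by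
    have := (integrable_exp_neg_mul_sq (b := σ ^ 2 / 2) (by positivity)).integrableOn (s := Ioi 0)
    refine this.congr_fun (fun u _ => ?_) measurableSet_Ioi
    simp only; congr 1; ring
  have hgi2 : IntegrableOn (fun u : ℝ => (2 + u ^ 2) * Real.exp (-(σ ^ 2 * u ^ 2) / 2)) (Ioi 0) := by
    have h1 := (integrable_rpow_mul_exp_neg_mul_sq (b := σ ^ 2 / 2) (by positivity)
      (s := 2) (by norm_num)).integrableOn (s := Ioi 0)
    have h2 : IntegrableOn (fun u : ℝ => 2 * Real.exp (-(σ ^ 2 * u ^ 2) / 2) +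
      u ^ (2 : ℝ) * Real.exp (-(σ ^ 2 / 2) * u ^ 2)) (Ioi 0) := (hgi.const_mul 2).add h1
    refine h2.congr_fun (fun u _ => ?_) measurableSet_Ioi
    simp only [Real.rpow_two]
    rw [show -(σ ^ 2 / 2) * u ^ 2 = -(σ ^ 2 * u ^ 2) / 2 by ring]; ring
  have hpg : ∀ y, Real.pi⁻¹ * ∫ u in Ioi (0 : ℝ), Real.cos (u * y) * Real.exp (-(σ ^ 2 * u ^ 2) / 2)
      = phiS σ y := by
    intro y
    rw [← JJ_gauss n y hσ δ α, JJ]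
    simp [MM]
  set f : ℝ → ℝ → ℝ := fun u z => Real.cos (u * x) * Real.exp (-(σ ^ 2 * u ^ 2) / 2) *
    ((1 - Real.cos (u * z)) * z ^ (-1 - α)) with hf
  have hfi : Integrable (Function.uncurry f)
      ((volume.restrict (Ioi (0 : ℝ))).prod (volume.restrict (Ioi (0 : ℝ)))) := by
    refine Integrable.mono' (hgi2.mul_prod (mstar_int P)) ?_ ?_
    · refine Measurable.aestronglyMeasurable ?_
      simp only [hf, Function.uncurry_def]
      fun_prop
    · rw [Measure.prod_restrict]
      refine (ae_restrict_iff' (measurableSet_Ioi.prod measurableSet_Ioi)).2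
        (Eventually.of_forall fun p hp => ?_)
      obtain ⟨u, z⟩ := p
      have hz : 0 < z := hp.2
      have h0 : 0 ≤ 1 - Real.cos (u * z) := by linarith [Real.cos_le_one (u * z)]
      simp only [hf, Function.uncurry]
      rw [Real.norm_eq_abs, abs_mul, abs_mul, Real.abs_exp,
        abs_of_nonneg (a := (1 - Real.cos (u * z)) * z ^ (-1 - α)) (by positivity)]
      calc _ ≤ 1 * Real.exp (-(σ ^ 2 * u ^ 2) / 2) * ((2 + u ^ 2) * mz z * z ^ (-1 - α)) := by
            gcongr
            · exact Real.abs_cos_le_one _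
            · exact one_sub_cos_le u z
        _ = (2 + u ^ 2) * Real.exp (-(σ ^ 2 * u ^ 2) / 2) * (mz z * z ^ (-1 - α)) := by ring
        _ ≤ _ := by gcongr; exact mz_le P hU hz
  have hsw := integral_integral_swap hfi
  have hL : ∫ u in Ioi (0 : ℝ), ∫ z in Ioi (0 : ℝ), f u z =
      Ia α * ∫ u in Ioi (0 : ℝ), Real.cos (u * x) * (u ^ α * Real.exp (-(σ ^ 2 * u ^ 2) / 2)) := by
    rw [← integral_const_mul]
    refine setIntegral_congr_fun measurableSet_Ioi fun u hu => ?_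
    simp only [hf]
    rw [integral_const_mul, Ia_scale α hu]; ring
  have hR : ∀ z, Real.pi⁻¹ * ∫ u in Ioi (0 : ℝ), f u z =
      z ^ (-1 - α) * (phiS σ x - (phiS σ (x + z) + phiS σ (x - z)) / 2) := by
    intro z
    have e1 : ∀ u, f u z = Real.cos (u * x) * (z ^ (-1 - α) * Real.exp (-(σ ^ 2 * u ^ 2) / 2)) +
      (Real.cos (u * (x + z)) * ((-(z ^ (-1 - α)) / 2) * Real.exp (-(σ ^ 2 * u ^ 2) / 2)) +
        Real.cos (u * (x - z)) * ((-(z ^ (-1 - α)) / 2) * Real.exp (-(σ ^ 2 * u ^ 2) / 2))) := by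
      intro u
      simp only [hf, mul_add, mul_sub, Real.cos_add, Real.cos_sub]; ring
    simp only [e1]
    have i1 := cos_int x (hgi.const_mul (z ^ (-1 - α)))
    have i2 := cos_int (x + z) (hgi.const_mul (-(z ^ (-1 - α)) / 2))
    have i3 := cos_int (x - z) (hgi.const_mul (-(z ^ (-1 - α)) / 2))
    rw [integral_add i1 (by exact i2.add i3), integral_add i2 i3, mul_add, mul_add, cosint_smul, cosint_smul,
      cosint_smul, hpg, hpg, hpg]
    ring
  have hJ : JJ 0 1 0 0 n x σ δ α = (n : ℝ) ^ (α / 2 - 1) * δ ^ α * (Real.pi⁻¹ *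
      ∫ u in Ioi (0 : ℝ), Real.cos (u * x) * (u ^ α * Real.exp (-(σ ^ 2 * u ^ 2) / 2))) := by
    rw [← cosint_smul, JJ]
    congr 1
    refine setIntegral_congr_fun measurableSet_Ioi fun u hu => ?_
    simp only [MM]
    rw [LL_eq hn α hδ hu]; simp
    left; ring
  have hF : Ia α * (Real.pi⁻¹ * ∫ u in Ioi (0 : ℝ), Real.cos (u * x) *
      (u ^ α * Real.exp (-(σ ^ 2 * u ^ 2) / 2))) =
      ∫ z in Ioi (0 : ℝ), z ^ (-1 - α) * (phiS σ x - (phiS σ (x + z) + phiS σ (x - z)) / 2) := by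
    simp only [← hR]
    rw [integral_const_mul, ← hsw, hL]; ring
  have hG : ∫ z in Ioi (0 : ℝ), z ^ (-1 - α) * ((phiS σ (x + z) + phiS σ (x - z)) / 2 - phiS σ x) =
      - ∫ z in Ioi (0 : ℝ), z ^ (-1 - α) * (phiS σ x - (phiS σ (x + z) + phiS σ (x - z)) / 2) := by
    rw [← integral_neg]; congr 1; ext z; ring
  refine ⟨by rw [hG, ← hF, hJ]; ring, ?_⟩
  have hi := (hfi.integral_prod_right).const_mul (-Real.pi⁻¹)
  refine IntegrableOn.congr_fun (s := Ioi 0) hi (fun z _ => ?_) measurableSet_Ioi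
  simp only [Function.uncurry]
  have := hR z
  linear_combination -this

lemma phiS_pos {σ : ℝ} (hσ : 0 < σ) (x : ℝ) : 0 < phiS σ x := by
  have := Eg_pos x σ; unfold phiS; positivity

lemma phiS_cont (σ : ℝ) : Continuous (phiS σ) := by unfold phiS Eg; fun_prop

lemma phiS_le {σ : ℝ} (hσ : 0 < σ) {x y : ℝ} (h : |x| ≤ |y|) : phiS σ y ≤ phiS σ x := by
  unfold phiS Eg
  have : x ^ 2 ≤ y ^ 2 := sq_le_sq.2 h
  gcongr

lemma phiS_avg {σ : ℝ} (hσ : 0 < σ) (x z : ℝ) :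
    phiS σ x * Real.exp (-(z ^ 2) / (2 * σ ^ 2)) ≤ (phiS σ (x + z) + phiS σ (x - z)) / 2 := by
  unfold phiS Eg
  set A := -((x + z) ^ 2) / (2 * σ ^ 2)
  set B := -((x - z) ^ 2) / (2 * σ ^ 2)
  have e : Real.exp (-(x ^ 2) / (2 * σ ^ 2)) * Real.exp (-(z ^ 2) / (2 * σ ^ 2)) =
      Real.exp (A / 2) * Real.exp (B / 2) := by
    rw [← Real.exp_add, ← Real.exp_add]; congr 1; simp only [A, B]; ring
  have e1 : Real.exp A = Real.exp (A / 2) ^ 2 := by rw [← Real.exp_nat_mul]; congr 1; ring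
  have e2 : Real.exp B = Real.exp (B / 2) ^ 2 := by rw [← Real.exp_nat_mul]; congr 1; ring
  have h : Real.exp (A / 2) * Real.exp (B / 2) ≤ (Real.exp A + Real.exp B) / 2 := by
    rw [e1, e2]; nlinarith [sq_nonneg (Real.exp (A / 2) - Real.exp (B / 2))]
  have hc : 0 ≤ (Real.sqrt (2 * Real.pi))⁻¹ * σ⁻¹ := by positivity
  have := mul_le_mul_of_nonneg_left h hc
  rw [mul_assoc, e]; linarith

lemma bracket_lower {σ : ℝ} (hσ : 0 < σ) (x : ℝ) {z : ℝ} (hz : 0 < z) :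
    -(1 + 1 / (2 * σ ^ 2)) * phiS σ x * mz z +
      (if z ∈ Ioc (|x| + 1) (|x| + 2) then phiS σ 2 / 2 else 0) ≤
      (phiS σ (x + z) + phiS σ (x - z)) / 2 - phiS σ x := by
  have hp := phiS_pos hσ x
  split_ifs with h
  · have hm : mz z = 1 := by
      unfold mz; refine min_eq_right ?_
      have : 1 ≤ z := by linarith [h.1, abs_nonneg x]
      nlinarith
    have h1 : phiS σ 2 ≤ phiS σ (x + z) + phiS σ (x - z) := by
      rcases le_total 0 x with hx | hx
      · rw [abs_of_nonneg hx] at h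
        have := phiS_le hσ (x := x - z) (y := 2) (by
          rw [abs_two, abs_le]; constructor <;> linarith [h.1, h.2])
        linarith [phiS_pos hσ (x + z)]
      · rw [abs_of_nonpos hx] at h
        have := phiS_le hσ (x := x + z) (y := 2) (by
          rw [abs_two, abs_le]; constructor <;> linarith [h.1, h.2])
        linarith [phiS_pos hσ (x - z)]
    rw [hm]
    have : 0 ≤ 1 / (2 * σ ^ 2) * phiS σ x := by positivity
    nlinarith
  · have h1 := phiS_avg hσ x z
    have h2 : 1 - Real.exp (-(z ^ 2) / (2 * σ ^ 2)) ≤ (1 + 1 / (2 * σ ^ 2)) * mz z := by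
      have e1 := Real.add_one_le_exp (-(z ^ 2) / (2 * σ ^ 2))
      have e2 := Real.exp_pos (-(z ^ 2) / (2 * σ ^ 2))
      have e3 : -(z ^ 2) / (2 * σ ^ 2) = -(1 / (2 * σ ^ 2) * z ^ 2) := by ring
      have e4 : 0 ≤ 1 / (2 * σ ^ 2) := by positivity
      unfold mz
      rcases le_total (z ^ 2) 1 with h | h
      · rw [min_eq_left h]; nlinarith [sq_nonneg z]
      · rw [min_eq_right h]; linarith
    have h3 := mul_le_mul_of_nonneg_left h2 hp.le
    nlinarith

lemma JJ01_lower (P : Ctx) : ∃ c > 0, ∃ C > 0, ∀ n : ℕ, 1 ≤ n → ∀ σ δ α, P.U σ δ α → ∀ x,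
    (n : ℝ) ^ (α / 2 - 1) * δ ^ α * (c * (1 + |x|) ^ (-1 - α) - C * phiS σ x) ≤
      -JJ 0 1 0 0 n x σ δ α := by
  obtain ⟨c0, hc0, C0, hC0, HI⟩ := Ia_bounds P
  have hs := P.hs
  set M := ∫ z in Ioi (0 : ℝ), mstar P z with hM
  have hM0 : 0 ≤ M := setIntegral_nonneg measurableSet_Ioi fun z hz => mstar_nonneg P hz
  set q := (Real.sqrt (2 * Real.pi))⁻¹ * (2 * P.s0)⁻¹ * Real.exp (-(2 ^ 2) / (2 * (P.s0 / 2) ^ 2))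
    with hq
  have hq0 : 0 < q := by positivity
  refine ⟨C0⁻¹ * (q / 2 * 8⁻¹), by positivity, c0⁻¹ * ((1 + 2 / P.s0 ^ 2) * (M + 1)),
    by positivity, fun n hn σ δ α hU x => ?_⟩
  obtain ⟨hσ, hδ, hα, hα2⟩ := hU.pos
  obtain ⟨hI1, hI2⟩ := HI σ δ α hU
  have hI0 : 0 < Ia α := hc0.trans_le hI1
  have hn0 : (0 : ℝ) < n := by exact_mod_cast hn
  obtain ⟨hJ, hGi⟩ := JJ01_eq P hn hU x
  set G := ∫ z in Ioi (0 : ℝ), z ^ (-1 - α) * ((phiS σ (x + z) + phiS σ (x - z)) / 2 - phiS σ x)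
    with hG
  have hp := phiS_pos hσ x
  have hq2 : q ≤ phiS σ 2 := by
    unfold phiS Eg
    rw [hq]
    have h1 : (2 * P.s0)⁻¹ ≤ σ⁻¹ := inv_anti₀ hσ hU.2.1.le
    have h2 : (P.s0 / 2) ^ 2 ≤ σ ^ 2 := pow_le_pow_left₀ (by positivity) hU.1.le 2
    have h3 : -(2 ^ 2 : ℝ) / (2 * (P.s0 / 2) ^ 2) ≤ -(2 ^ 2) / (2 * σ ^ 2) := by
      rw [neg_div, neg_div]
      refine neg_le_neg ?_
      gcongr
    gcongr
  have hmi : IntegrableOn (fun z => mz z * z ^ (-1 - α)) (Ioi 0) := by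
    refine Integrable.mono' (mstar_int P) (by unfold mz; fun_prop)
      ((ae_restrict_iff' measurableSet_Ioi).2 (Eventually.of_forall fun z hz => ?_))
    have hz : 0 < z := hz
    have := mz_nonneg z
    rw [Real.norm_eq_abs, abs_of_nonneg (by positivity)]
    exact mz_le P hU hz
  have hmM : ∫ z in Ioi (0 : ℝ), mz z * z ^ (-1 - α) ≤ M :=
    setIntegral_mono_on hmi (mstar_int P) measurableSet_Ioi fun z hz => mz_le P hU hz
  have hax := abs_nonneg x
  have hsub : Ioc (|x| + 1) (|x| + 2) ⊆ Ioi (0 : ℝ) := fun z hz => by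
    have := hz.1; show 0 < z; linarith
  have hci : IntegrableOn (fun z : ℝ => z ^ (-1 - α)) (Ioc (|x| + 1) (|x| + 2)) := by
    have h1 : ContinuousOn (fun z : ℝ => z ^ (-1 - α)) (Icc (|x| + 1) (|x| + 2)) := fun z hz =>
      (Real.continuousAt_rpow_const z _ (Or.inl (by
        have := hz.1; intro h; rw [h] at this; linarith))).continuousWithinAt
    exact h1.integrableOn_Icc.mono_set Ioc_subset_Icc_self
  have hind : IntegrableOn (fun z : ℝ => (Ioc (|x| + 1) (|x| + 2)).indicator
      (fun z => z ^ (-1 - α)) z) (Ioi 0) := by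
    rw [IntegrableOn, integrable_indicator_iff measurableSet_Ioc]
    rw [IntegrableOn, Measure.restrict_restrict measurableSet_Ioc, inter_eq_left.2 hsub]
    exact hci
  have hindv : (1 / 8) * (1 + |x|) ^ (-1 - α) ≤ ∫ z in Ioi (0 : ℝ),
      (Ioc (|x| + 1) (|x| + 2)).indicator (fun z => z ^ (-1 - α)) z := by
    rw [integral_indicator measurableSet_Ioc, Measure.restrict_restrict measurableSet_Ioc,
      inter_eq_left.2 hsub]
    have h1 : ∫ z in Ioc (|x| + 1) (|x| + 2), (2 * (1 + |x|)) ^ (-1 - α) ≤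
        ∫ z in Ioc (|x| + 1) (|x| + 2), z ^ (-1 - α) := by
      refine setIntegral_mono_on (integrableOn_const (by simp)) hci measurableSet_Ioc fun z hz => ?_
      have hz0 : 0 < z := hsub hz
      exact Real.rpow_le_rpow_of_nonpos hz0 (by linarith [hz.2]) (by linarith)
    refine le_trans ?_ h1
    have h8 : (1 / 8 : ℝ) ≤ 2 ^ (-1 - α) := by
      calc (1 / 8 : ℝ) = 2 ^ (-3 : ℝ) := by
            rw [Real.rpow_neg (by norm_num)]; norm_num
        _ ≤ _ := Real.rpow_le_rpow_of_exponent_le (by norm_num) (by linarith)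
    rw [setIntegral_const, Real.mul_rpow (by norm_num) (by positivity)]
    simp only [Measure.real, Real.volume_Ioc, smul_eq_mul]
    rw [show |x| + 2 - (|x| + 1) = 1 by ring, ENNReal.ofReal_one, ENNReal.toReal_one, one_mul]
    gcongr
  have hGl : -(1 + 1 / (2 * σ ^ 2)) * phiS σ x * M + phiS σ 2 / 2 * ((1 / 8) * (1 + |x|) ^ (-1 - α))
      ≤ G := by
    have h1 : ∫ z in Ioi (0 : ℝ), (-(1 + 1 / (2 * σ ^ 2)) * phiS σ x * (mz z * z ^ (-1 - α)) +
        phiS σ 2 / 2 * (Ioc (|x| + 1) (|x| + 2)).indicator (fun z => z ^ (-1 - α)) z) ≤ G := by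
      refine setIntegral_mono_on (by exact (hmi.const_mul _).add (hind.const_mul _)) hGi
        measurableSet_Ioi fun z hz => ?_
      have hz : 0 < z := hz
      have hb := mul_le_mul_of_nonneg_left (bracket_lower hσ x hz)
        (by positivity : 0 ≤ z ^ (-1 - α))
      refine le_trans (le_of_eq ?_) hb
      by_cases hzz : z ∈ Ioc (|x| + 1) (|x| + 2)
      · rw [indicator_of_mem hzz, if_pos hzz]; ring
      · rw [indicator_of_notMem hzz, if_neg hzz]; ring
    rw [integral_add (by exact hmi.const_mul _) (by exact hind.const_mul _), integral_const_mul,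
      integral_const_mul] at h1
    refine le_trans (add_le_add ?_ ?_) h1
    · have : 0 ≤ (1 + 1 / (2 * σ ^ 2)) * phiS σ x := by positivity
      nlinarith
    · have := phiS_pos hσ 2
      gcongr
  have hw : 0 < (1 + |x|) ^ (-1 - α) := by positivity
  have hsig : 1 / (2 * σ ^ 2) ≤ 2 / P.s0 ^ 2 := by
    have h2 : (P.s0 / 2) ^ 2 ≤ σ ^ 2 := pow_le_pow_left₀ (by positivity) hU.1.le 2
    rw [div_le_div_iff₀ (by positivity) (by positivity)]; linarith
  set lam0 := (n : ℝ) ^ (α / 2 - 1) * δ ^ α with hl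
  have hl0 : 0 < lam0 := by positivity
  have hGl2 : q / 2 * (8⁻¹ * (1 + |x|) ^ (-1 - α)) - (1 + 2 / P.s0 ^ 2) * (M + 1) * phiS σ x ≤ G := by
    refine le_trans ?_ hGl
    have a1 : (1 + 1 / (2 * σ ^ 2)) * phiS σ x * M ≤ (1 + 2 / P.s0 ^ 2) * (M + 1) * phiS σ x := by
      calc _ ≤ (1 + 2 / P.s0 ^ 2) * phiS σ x * (M + 1) := by gcongr; linarith
        _ = _ := by ring
    have a2 : q / 2 * (8⁻¹ * (1 + |x|) ^ (-1 - α)) ≤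
        phiS σ 2 / 2 * ((1 / 8) * (1 + |x|) ^ (-1 - α)) := by
      rw [one_div]; gcongr
    linarith
  have hJ2 : -JJ 0 1 0 0 n x σ δ α = lam0 * ((Ia α)⁻¹ * G) := by
    rw [← mul_assoc, mul_comm lam0, mul_assoc, ← hJ, ← mul_assoc, inv_mul_cancel₀ hI0.ne', one_mul]
  rw [hJ2]
  refine mul_le_mul_of_nonneg_left ?_ hl0.le
  have i1 : C0⁻¹ ≤ (Ia α)⁻¹ := inv_anti₀ hI0 hI2
  have i2 : (Ia α)⁻¹ ≤ c0⁻¹ := inv_anti₀ hc0 hI1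
  have i0 : 0 < (Ia α)⁻¹ := inv_pos.2 hI0
  have j1 : C0⁻¹ * (q / 2 * 8⁻¹) * (1 + |x|) ^ (-1 - α) ≤
      (Ia α)⁻¹ * (q / 2 * (8⁻¹ * (1 + |x|) ^ (-1 - α))) := by
    calc _ ≤ (Ia α)⁻¹ * (q / 2 * 8⁻¹) * (1 + |x|) ^ (-1 - α) := by gcongr
      _ = _ := by ring
  have j2 : (Ia α)⁻¹ * ((1 + 2 / P.s0 ^ 2) * (M + 1) * phiS σ x) ≤
      c0⁻¹ * ((1 + 2 / P.s0 ^ 2) * (M + 1)) * phiS σ x := by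
    calc _ ≤ c0⁻¹ * ((1 + 2 / P.s0 ^ 2) * (M + 1) * phiS σ x) := by gcongr
      _ = _ := by ring
  have j3 := mul_le_mul_of_nonneg_left hGl2 i0.le
  rw [mul_sub] at j3
  linarith



/-! ### Comparison functions -/

/-- Stable tail envelope. -/
def ZZ (P : Ctx) (n : ℕ) (x : ℝ) : ℝ := (n : ℝ) ^ (P.a0 / 2 - 1) * (1 + |x|) ^ (-(1 + P.β))

/-- Full envelope. -/
def NN (P : Ctx) (n : ℕ) (x σ : ℝ) : ℝ := Eg x σ + ZZ P n x

lemma ZZ_pos (P : Ctx) {n : ℕ} (hn : 1 ≤ n) (x : ℝ) : 0 < ZZ P n x := by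
  have hn0 : (0 : ℝ) < n := by exact_mod_cast hn
  unfold ZZ; positivity

lemma NN_pos (P : Ctx) {n : ℕ} (hn : 1 ≤ n) (x σ : ℝ) : 0 < NN P n x σ :=
  add_pos (Eg_pos x σ) (ZZ_pos P hn x)

lemma ZZ_le_NN (P : Ctx) (n : ℕ) (x σ : ℝ) : ZZ P n x ≤ NN P n x σ := by
  unfold NN; linarith [Eg_pos x σ]

lemma ZZ_lower (P : Ctx) {n : ℕ} (hn : 1 ≤ n) (x : ℝ) :
    (n : ℝ)⁻¹ * ((1 + |x|) ^ 3)⁻¹ ≤ ZZ P n x := by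
  have hn1 : (1 : ℝ) ≤ n := by exact_mod_cast hn
  have ha := P.ha; have hb := P.β_lt
  unfold ZZ
  have h1 : (n : ℝ)⁻¹ ≤ (n : ℝ) ^ (P.a0 / 2 - 1) := by
    rw [← Real.rpow_neg_one]
    exact Real.rpow_le_rpow_of_exponent_le hn1 (by linarith)
  have h2 : ((1 + |x|) ^ 3)⁻¹ ≤ (1 + |x|) ^ (-(1 + P.β)) := by
    have : ((1 + |x|) ^ 3)⁻¹ = (1 + |x|) ^ (-3 : ℝ) := by
      rw [Real.rpow_neg (by positivity)]; norm_cast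
    rw [this]
    exact Real.rpow_le_rpow_of_exponent_le (by linarith [abs_nonneg x]) (by linarith)
  gcongr

lemma Eg_poly (P : Ctx) (m : ℕ) : ∃ C > 0, ∀ x σ, 0 < σ → σ < 2 * P.s0 →
    (1 + |x|) ^ m * Eg x σ ≤ C := by
  have hs := P.hs
  obtain ⟨C, hC, H⟩ := poly_exp_le m (κ := 1 / (8 * P.s0 ^ 2)) (by positivity)
  refine ⟨C, hC, fun x σ hσ0 hσ => ?_⟩
  have h := H |x| (abs_nonneg x)
  rw [sq_abs] at h
  have h2 : Real.exp (-|x|) ≤ 1 := Real.exp_le_one_iff.2 (by linarith [abs_nonneg x])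
  have h3 : Eg x σ ≤ Real.exp (-(1 / (8 * P.s0 ^ 2) * x ^ 2)) := by
    unfold Eg
    refine Real.exp_le_exp.2 ?_
    rw [neg_div]
    refine neg_le_neg ?_
    have : σ ^ 2 ≤ (2 * P.s0) ^ 2 := pow_le_pow_left₀ hσ0.le hσ.le 2
    rw [one_div, inv_mul_eq_div]
    exact div_le_div_of_nonneg_left (by positivity) (by positivity) (by linarith)
  calc (1 + |x|) ^ m * Eg x σ ≤ (1 + |x|) ^ m * Real.exp (-(1 / (8 * P.s0 ^ 2) * x ^ 2)) := by
        gcongr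
    _ ≤ C * Real.exp (-|x|) := h
    _ ≤ C * 1 := by gcongr
    _ = C := mul_one C

lemma Eg_tail (P : Ctx) (m : ℕ) {κ : ℝ} (hκ : 0 < κ) : ∃ C > 0, ∀ n : ℕ, 1 ≤ n → ∀ x σ, 0 < σ →
    σ < 2 * P.s0 → (n : ℝ) ^ κ ≤ |x| → (1 + |x|) ^ m * Eg x σ ≤ C * ZZ P n x := by
  obtain ⟨k, hk⟩ := exists_nat_ge (1 / κ)
  obtain ⟨C, hC, H⟩ := Eg_poly P (m + 3 + k)
  refine ⟨C, hC, fun n hn x σ h0 h1 hx => ?_⟩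
  have hn1 : (1 : ℝ) ≤ n := by exact_mod_cast hn
  have hE := H x σ h0 h1
  have hnk : (n : ℝ) ≤ (1 + |x|) ^ k := by
    calc (n : ℝ) = (n : ℝ) ^ (1 : ℝ) := (Real.rpow_one _).symm
      _ ≤ (n : ℝ) ^ (κ * k) := by
        refine Real.rpow_le_rpow_of_exponent_le hn1 ?_
        rw [div_le_iff₀ hκ] at hk; linarith
      _ = ((n : ℝ) ^ κ) ^ k := by rw [Real.rpow_mul (by positivity), Real.rpow_natCast]
      _ ≤ (1 + |x|) ^ k := by gcongr; linarith
  have hz := ZZ_lower P hn x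
  have hEp := Eg_pos x σ
  have hx0 := abs_nonneg x
  calc (1 + |x|) ^ m * Eg x σ
      = ((1 + |x|) ^ (m + 3 + k) * Eg x σ) * (((1 + |x|) ^ k)⁻¹ * ((1 + |x|) ^ 3)⁻¹) := by
        have : 0 < 1 + |x| := by linarith
        generalize 1 + |x| = v at *
        field_simp; ring
    _ ≤ C * ((n : ℝ)⁻¹ * ((1 + |x|) ^ 3)⁻¹) := by gcongr
    _ ≤ _ := by gcongr

lemma Eg_poly_le (P : Ctx) (m : ℕ) : ∃ C > 0, ∀ n : ℕ, 1 ≤ n → ∀ x σ, 0 < σ →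
    σ < 2 * P.s0 → (1 + |x|) ^ m * Eg x σ ≤ C * ((n : ℝ) ^ P.τ * NN P n x σ) := by
  have hτ := P.hτ
  obtain ⟨C, hC, H⟩ := Eg_tail P m (κ := P.τ / (m + 1)) (by positivity)
  refine ⟨C + 2 ^ m, by positivity, fun n hn x σ h0 h1 => ?_⟩
  have hn1 : (1 : ℝ) ≤ n := by exact_mod_cast hn
  have hEp := Eg_pos x σ
  have hZ := ZZ_pos P hn x
  have hN := NN_pos P hn x σ
  have hnt : 1 ≤ (n : ℝ) ^ P.τ := Real.one_le_rpow hn1 hτ.le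
  rcases le_total ((n : ℝ) ^ (P.τ / (m + 1))) |x| with h | h
  · calc _ ≤ C * ZZ P n x := H n hn x σ h0 h1 h
      _ ≤ C * (1 * NN P n x σ) := by rw [one_mul]; gcongr; exact ZZ_le_NN P n x σ
      _ ≤ (C + 2 ^ m) * ((n : ℝ) ^ P.τ * NN P n x σ) := by gcongr; linarith [pow_pos (two_pos (α := ℝ)) m]
  · have h2 : (1 + |x|) ^ m ≤ 2 ^ m * (n : ℝ) ^ P.τ := by
      have h3 : 1 ≤ (n : ℝ) ^ (P.τ / (m + 1)) := Real.one_le_rpow hn1 (by positivity)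
      calc (1 + |x|) ^ m ≤ (2 * (n : ℝ) ^ (P.τ / (m + 1))) ^ m := by gcongr; linarith
        _ = 2 ^ m * (n : ℝ) ^ (P.τ / (m + 1) * m) := by
          rw [mul_pow, Real.rpow_mul (by positivity), Real.rpow_natCast]
        _ ≤ _ := by
          gcongr
          rw [div_mul_eq_mul_div, div_le_iff₀ (by positivity)]; nlinarith
    calc _ ≤ 2 ^ m * (n : ℝ) ^ P.τ * NN P n x σ := by
          gcongr; unfold NN; linarith
      _ = 2 ^ m * ((n : ℝ) ^ P.τ * NN P n x σ) := by ring
      _ ≤ _ := by gcongr; linarith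

lemma Lam_eq (P : Ctx) {n : ℕ} (hn : 1 ≤ n) : P.Lam n = (n : ℝ) ^ P.τ * (n : ℝ) ^ (P.a0 / 2 - 1) := by
  have hn0 : (0 : ℝ) < n := by exact_mod_cast hn
  rw [Ctx.Lam, ← Real.rpow_add hn0]; congr 1; ring

lemma nt2 (P : Ctx) {n : ℕ} (hn : 1 ≤ n) :
    (n : ℝ) ^ P.τ * (n : ℝ) ^ P.τ = (n : ℝ) ^ (2 * P.τ) := by
  have hn0 : (0 : ℝ) < n := by exact_mod_cast hn
  rw [← Real.rpow_add hn0]; congr 1; ring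

lemma JJ_up1 (P : Ctx) (a b c : ℕ) : ∃ C > 0, ∀ n : ℕ, 1 ≤ n → ∀ σ δ α, P.U σ δ α → ∀ x,
    |JJ a (b + 1) c 1 n x σ δ α| ≤ C * ((n : ℝ) ^ (2 * P.τ) * ZZ P n x) := by
  obtain ⟨C, hC, H⟩ := JJ_le P a b c
  refine ⟨C, hC, fun n hn σ δ α hU x => ?_⟩
  have hn0 : (0 : ℝ) < n := by exact_mod_cast hn
  have hL := P.Lam_pos hn
  have h1 : P.Lam n ^ (b + 1) ≤ P.Lam n := pow_le_of_le_one hL.le (P.Lam_le hn) (by omega)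
  calc _ ≤ _ := H n hn 1 σ δ α (by simp) hU x
    _ ≤ C * ((n : ℝ) ^ P.τ * P.Lam n) * (1 + |x|) ^ (-(1 + P.β)) := by gcongr
    _ = _ := by rw [Lam_eq P hn, ← nt2 P hn, ZZ]; ring

lemma JJ_up0 (P : Ctx) (a : ℕ) : ∃ C > 0, ∀ n : ℕ, 1 ≤ n → ∀ σ δ α, P.U σ δ α → ∀ x,
    |JJ a 0 0 1 n x σ δ α| ≤ C * ((n : ℝ) ^ (2 * P.τ) * NN P n x σ) := by
  obtain ⟨C, hC, H⟩ := JJ_le0 P a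
  obtain ⟨D, hD, H'⟩ := Eg_poly_le P (2 * a)
  refine ⟨C * (D + 1), by positivity, fun n hn σ δ α hU x => ?_⟩
  have hn1 : (1 : ℝ) ≤ n := by exact_mod_cast hn
  have hN := NN_pos P hn x σ
  have hτ := P.hτ
  have h1 : (n : ℝ) ^ P.τ ≤ (n : ℝ) ^ (2 * P.τ) :=
    Real.rpow_le_rpow_of_exponent_le hn1 (by linarith)
  have h2 := ZZ_le_NN P n x σ
  calc _ ≤ _ := H n hn σ δ α hU x
    _ ≤ C * (D * ((n : ℝ) ^ (2 * P.τ) * NN P n x σ) + (n : ℝ) ^ (2 * P.τ) * NN P n x σ) := by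
      gcongr ?_ * (?_ + ?_)
      · exact (H' n hn x σ hU.pos.1 hU.2.1).trans (by gcongr)
      · calc _ = (n : ℝ) ^ (2 * P.τ) * ZZ P n x := by rw [Lam_eq P hn, ← nt2 P hn, ZZ]; ring
          _ ≤ _ := by gcongr
    _ = _ := by ring

/-- Comparison of Gaussians with nearby standard deviations. -/
lemma Eg_cmp (P : Ctx) (D : ℝ) (hD : 0 ≤ D) : ∃ C > 0, ∀ n : ℕ, 1 ≤ n → ∀ x σ σ', P.s0 / 2 < σ →
    σ < 2 * P.s0 → P.s0 / 2 < σ' → σ' < 2 * P.s0 → |σ - σ'| ≤ D * (n : ℝ) ^ (-(1 / 2) : ℝ) →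
    NN P n x σ' ≤ C * NN P n x σ := by
  have hs := P.hs
  obtain ⟨C, hC, H⟩ := Eg_tail P 0 (κ := 1 / 4) (by norm_num)
  set B := 32 * D / P.s0 ^ 3 with hB
  refine ⟨C + Real.exp B + 1, by positivity, fun n hn x σ σ' h1 h2 h3 h4 h => ?_⟩
  have hn0 : (0 : ℝ) < n := by exact_mod_cast hn
  have hZ := ZZ_pos P hn x
  have hE := Eg_pos x σ
  have hσ : 0 < σ := by linarith
  have hσ' : 0 < σ' := by linarith
  have key : Eg x σ' ≤ C * ZZ P n x + Real.exp B * Eg x σ := by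
    rcases le_total ((n : ℝ) ^ (1 / 4 : ℝ)) |x| with hx | hx
    · have := H n hn x σ' hσ' h4 hx
      rw [pow_zero, one_mul] at this
      have : 0 ≤ Real.exp B * Eg x σ := by positivity
      linarith
    · have hx2 : x ^ 2 ≤ (n : ℝ) ^ (1 / 2 : ℝ) := by
        rw [← sq_abs]
        calc |x| ^ 2 ≤ ((n : ℝ) ^ (1 / 4 : ℝ)) ^ 2 := by gcongr
          _ = _ := by rw [← Real.rpow_natCast, ← Real.rpow_mul hn0.le]; norm_num
      have hxx : x ^ 2 * |σ - σ'| ≤ D := by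
        calc _ ≤ (n : ℝ) ^ (1 / 2 : ℝ) * (D * (n : ℝ) ^ (-(1 / 2) : ℝ)) := by gcongr
          _ = D * ((n : ℝ) ^ (1 / 2 : ℝ) * (n : ℝ) ^ (-(1 / 2) : ℝ)) := by ring
          _ = D := by rw [← Real.rpow_add hn0]; simp
      have hexp : -(x ^ 2) / (2 * σ' ^ 2) ≤ B + -(x ^ 2) / (2 * σ ^ 2) := by
        have e1 : -(x ^ 2) / (2 * σ' ^ 2) - -(x ^ 2) / (2 * σ ^ 2) =
            (x ^ 2 * (σ' - σ)) * ((σ' + σ) / (2 * σ ^ 2 * σ' ^ 2)) := by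
          field_simp; ring
        have e2 : x ^ 2 * (σ' - σ) ≤ D := by
          refine le_trans ?_ hxx
          gcongr; rw [abs_sub_comm]; exact le_abs_self _
        have e3 : (σ' + σ) / (2 * σ ^ 2 * σ' ^ 2) ≤ (2 * P.s0 + 2 * P.s0) / (2 * (P.s0 / 2) ^ 2 * (P.s0 / 2) ^ 2) := by
          gcongr
        have e4 : (2 * P.s0 + 2 * P.s0) / (2 * (P.s0 / 2) ^ 2 * (P.s0 / 2) ^ 2) = 32 / P.s0 ^ 3 := by
          field_simp; norm_num
        have e5 : (x ^ 2 * (σ' - σ)) * ((σ' + σ) / (2 * σ ^ 2 * σ' ^ 2)) ≤ D * (32 / P.s0 ^ 3) := by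
          rw [← e4]
          exact mul_le_mul e2 e3 (by positivity) hD
        have e6 : D * (32 / P.s0 ^ 3) = B := by rw [hB]; ring
        linarith
      have : Eg x σ' ≤ Real.exp B * Eg x σ := by
        unfold Eg
        rw [← Real.exp_add]; exact Real.exp_le_exp.2 hexp
      have : 0 ≤ C * ZZ P n x := by positivity
      linarith
  unfold NN
  have : 0 ≤ C * Eg x σ := by positivity
  have : 0 ≤ Real.exp B * ZZ P n x := by positivity
  nlinarith

/-! ### Lower bound of the density -/

lemma tendsto_rpow_neg_nat {e : ℝ} (he : e < 0) :
    Tendsto (fun n : ℕ => (n : ℝ) ^ e) atTop (𝓝 0) := by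
  have := tendsto_rpow_neg_atTop (y := -e) (by linarith)
  rw [neg_neg] at this
  exact this.comp tendsto_natCast_atTop_atTop

set_option maxHeartbeats 1000000 in
lemma Q_lower (P : Ctx) : ∃ c > 0, ∃ N : ℕ, 1 ≤ N ∧ ∀ n : ℕ, N ≤ n → ∀ σ δ α, P.U σ δ α → ∀ x,
    |x| ≤ (n : ℝ) ^ P.K →
    c * ((n : ℝ) ^ (-((3 * P.K + 1) * P.τ)) * NN P n x σ) ≤ JJ 0 0 0 1 n x σ δ α := by
  have hs := P.hs; have hd := P.hd; have hτ := P.hτ; have hK := P.K_pos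
  obtain ⟨c, hc, C, hC, H⟩ := JJ01_lower P
  obtain ⟨D, hD, H2⟩ := JJ_second P
  -- bounds for δ^α
  obtain ⟨d1, hd1, hdl⟩ : ∃ d1 > 0, ∀ σ δ α, P.U σ δ α → d1 ≤ δ ^ α := by
    refine ⟨(min 1 (P.d0 / 2)) ^ (2 : ℝ), by positivity, fun σ δ α hU => ?_⟩
    obtain ⟨_, hδ, hα, hα2⟩ := hU.pos
    calc _ ≤ (min 1 (P.d0 / 2)) ^ α :=
          Real.rpow_le_rpow_of_exponent_ge (by positivity) (min_le_left _ _) hα2.le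
      _ ≤ δ ^ α := Real.rpow_le_rpow (by positivity) ((min_le_right _ _).trans hU.2.2.1.le) hα.le
  obtain ⟨d2, hd2, hdu⟩ : ∃ d2 > 0, ∀ σ δ α, P.U σ δ α → δ ^ α ≤ d2 := by
    refine ⟨(max 1 (2 * P.d0)) ^ (2 : ℝ), by positivity, fun σ δ α hU => ?_⟩
    obtain ⟨_, hδ, hα, hα2⟩ := hU.pos
    calc δ ^ α ≤ (max 1 (2 * P.d0)) ^ α :=
          Real.rpow_le_rpow hδ.le (hU.2.2.2.1.le.trans (le_max_right _ _)) hα.le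
      _ ≤ _ := Real.rpow_le_rpow_of_exponent_le (le_max_left _ _) hα2.le
  -- small quantities
  have t1 := (tendsto_rpow_neg_nat (e := P.a0 / 2 - 1 + P.τ)
    (by have := P.τ_lt; linarith)).const_mul (d2 * C)
  have t2 := (tendsto_rpow_neg_nat (e := P.a0 / 2 - 1 + (3 * P.K + 6) * P.τ)
    P.hτ2).const_mul D
  rw [mul_zero] at t1 t2
  set e3 := c * d1 * 2 ^ (-(3 * P.τ)) with he3
  have he3p : 0 < e3 := by positivity
  obtain ⟨N1, hN1⟩ := eventually_atTop.1 (t1.eventually_lt_const (u := 1 / 2) (by norm_num))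
  obtain ⟨N2, hN2⟩ := eventually_atTop.1 (t2.eventually_lt_const (u := e3 / 2) (by positivity))
  set g0 := (Real.sqrt (2 * Real.pi))⁻¹ * (2 * P.s0)⁻¹ with hg0
  have hg0p : 0 < g0 := by positivity
  refine ⟨min (g0 / 2) (e3 / 2), by positivity, max 1 (max N1 N2), le_max_left _ _,
    fun n hn σ δ α hU x hx => ?_⟩
  have hn1' : 1 ≤ n := (le_max_left _ _).trans hn
  have hn1 : (1 : ℝ) ≤ n := by exact_mod_cast hn1'
  have hn0 : (0 : ℝ) < n := by linarith
  have s1 := hN1 n (((le_max_left _ _).trans (le_max_right _ _)).trans hn)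
  have s2 := hN2 n (((le_max_right _ _).trans (le_max_right _ _)).trans hn)
  have h1 := H n hn1' σ δ α hU x
  have h2 := (abs_le.1 (H2 n hn1' σ δ α hU x)).1
  have hp := phiS_pos hU.pos.1 x
  obtain ⟨hσ, hδ, hα, hα2⟩ := hU.pos
  have hα3 := hU.2.2.2.2.1; have hα4 := hU.2.2.2.2.2
  have hx0 := abs_nonneg x
  set w := (1 + |x|) ^ (-(1 + P.β)) with hw
  have hwp : 0 < w := by positivity
  set lam := (n : ℝ) ^ (α / 2 - 1) * δ ^ α with hlam
  have hdp : 0 < δ ^ α := by positivity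
  -- upper bound of λ C
  have l1 : lam * C ≤ 1 / 2 := by
    calc lam * C ≤ ((n : ℝ) ^ (P.a0 / 2 - 1 + P.τ) * d2) * C := by
          rw [hlam]; gcongr
          · linarith
          · exact hdu σ δ α hU
      _ ≤ 1 / 2 := by linarith
  -- lower bound of the stable term
  have l2 : e3 * (n : ℝ) ^ (-((3 * P.K + 1) * P.τ)) * ((n : ℝ) ^ (P.a0 / 2 - 1) * w) ≤
      lam * (c * (1 + |x|) ^ (-1 - α)) := by
    have a1 : d1 * ((n : ℝ) ^ (-P.τ) * (n : ℝ) ^ (P.a0 / 2 - 1)) ≤ lam := by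
      rw [hlam, mul_comm, ← Real.rpow_add hn0]
      have := hdl σ δ α hU
      gcongr
      linarith
    have a2 : 2 ^ (-(3 * P.τ)) * (n : ℝ) ^ (-(3 * P.K * P.τ)) * w ≤ (1 + |x|) ^ (-1 - α) := by
      have b1 : 1 + |x| ≤ 2 * (n : ℝ) ^ P.K := by
        have := Real.one_le_rpow hn1 hK.le; linarith
      have b2 : (2 * (n : ℝ) ^ P.K) ^ (-(3 * P.τ)) ≤ (1 + |x|) ^ (-(3 * P.τ)) :=
        Real.rpow_le_rpow_of_nonpos (by positivity) b1 (by linarith)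
      have b3 : (2 * (n : ℝ) ^ P.K) ^ (-(3 * P.τ)) = 2 ^ (-(3 * P.τ)) * (n : ℝ) ^ (-(3 * P.K * P.τ)) := by
        rw [Real.mul_rpow (by norm_num) (by positivity), ← Real.rpow_mul hn0.le]
        congr 2; ring
      rw [← b3]
      calc _ ≤ (1 + |x|) ^ (-(3 * P.τ)) * w := by gcongr
        _ = (1 + |x|) ^ (-(3 * P.τ) + -(1 + P.β)) := by rw [hw, ← Real.rpow_add (by positivity)]
        _ ≤ _ := by
          refine Real.rpow_le_rpow_of_exponent_le (by linarith) ?_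
          unfold Ctx.β; linarith
    have a3 : (n : ℝ) ^ (-((3 * P.K + 1) * P.τ)) = (n : ℝ) ^ (-P.τ) * (n : ℝ) ^ (-(3 * P.K * P.τ)) := by
      rw [← Real.rpow_add hn0]; congr 1; ring
    calc _ = (d1 * ((n : ℝ) ^ (-P.τ) * (n : ℝ) ^ (P.a0 / 2 - 1))) *
          (c * (2 ^ (-(3 * P.τ)) * (n : ℝ) ^ (-(3 * P.K * P.τ)) * w)) := by rw [he3, a3]; ring
      _ ≤ _ := by gcongr
  -- remainder
  have l3 : D * ((n : ℝ) ^ P.τ * P.Lam n ^ 2) * w ≤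
      e3 / 2 * (n : ℝ) ^ (-((3 * P.K + 1) * P.τ)) * ((n : ℝ) ^ (P.a0 / 2 - 1) * w) := by
    have a1 : (n : ℝ) ^ P.τ * P.Lam n ^ 2 ≤ (n : ℝ) ^ (P.a0 / 2 - 1 + (3 * P.K + 6) * P.τ) *
        ((n : ℝ) ^ (-((3 * P.K + 1) * P.τ)) * (n : ℝ) ^ (P.a0 / 2 - 1)) := by
      rw [Ctx.Lam, ← Real.rpow_natCast, ← Real.rpow_mul hn0.le, ← Real.rpow_add hn0,
        ← Real.rpow_add hn0, ← Real.rpow_add hn0]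
      refine Real.rpow_le_rpow_of_exponent_le hn1 ?_
      push_cast; nlinarith
    calc _ ≤ D * ((n : ℝ) ^ (P.a0 / 2 - 1 + (3 * P.K + 6) * P.τ) *
        ((n : ℝ) ^ (-((3 * P.K + 1) * P.τ)) * (n : ℝ) ^ (P.a0 / 2 - 1))) * w := by gcongr
      _ = (D * (n : ℝ) ^ (P.a0 / 2 - 1 + (3 * P.K + 6) * P.τ)) *
        ((n : ℝ) ^ (-((3 * P.K + 1) * P.τ)) * (n : ℝ) ^ (P.a0 / 2 - 1)) * w := by ring
      _ ≤ (e3 / 2) * ((n : ℝ) ^ (-((3 * P.K + 1) * P.τ)) * (n : ℝ) ^ (P.a0 / 2 - 1)) * w := by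
        gcongr
      _ = _ := by ring
  have hgE : g0 * Eg x σ ≤ phiS σ x := by
    have := Eg_pos x σ
    have h1 : (2 * P.s0)⁻¹ ≤ σ⁻¹ := inv_anti₀ hσ hU.2.1.le
    rw [hg0, phiS]; gcongr
  have hnk : (n : ℝ) ^ (-((3 * P.K + 1) * P.τ)) ≤ 1 :=
    Real.rpow_le_one_of_one_le_of_nonpos hn1 (by nlinarith [mul_pos hK hτ])
  have hnk0 : 0 < (n : ℝ) ^ (-((3 * P.K + 1) * P.τ)) := by positivity
  have hEp := Eg_pos x σ
  have hZ := ZZ_pos P hn1' x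
  have hQ : 1 / 2 * phiS σ x + e3 / 2 * (n : ℝ) ^ (-((3 * P.K + 1) * P.τ)) * ZZ P n x ≤
      JJ 0 0 0 1 n x σ δ α := by
    have hZe : ZZ P n x = (n : ℝ) ^ (P.a0 / 2 - 1) * w := rfl
    rw [hZe]
    have m1 := mul_le_mul_of_nonneg_right l1 hp.le
    have m2 : lam * (c * (1 + |x|) ^ (-1 - α) - C * phiS σ x) =
      lam * (c * (1 + |x|) ^ (-1 - α)) - lam * C * phiS σ x := by ring
    rw [m2] at h1
    generalize lam * (c * (1 + |x|) ^ (-1 - α)) = g1 at *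
    generalize lam * C * phiS σ x = g2 at *
    generalize D * ((n : ℝ) ^ P.τ * P.Lam n ^ 2) * w = g3 at *
    linarith
  refine le_trans ?_ hQ
  have q1 : min (g0 / 2) (e3 / 2) * ((n : ℝ) ^ (-((3 * P.K + 1) * P.τ)) * Eg x σ) ≤
      1 / 2 * phiS σ x := by
    calc _ ≤ g0 / 2 * (1 * Eg x σ) := by gcongr; exact min_le_left _ _
      _ ≤ _ := by linarith
  have q2 : min (g0 / 2) (e3 / 2) * ((n : ℝ) ^ (-((3 * P.K + 1) * P.τ)) * ZZ P n x) ≤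
      e3 / 2 * (n : ℝ) ^ (-((3 * P.K + 1) * P.τ)) * ZZ P n x := by
    rw [← mul_assoc]; gcongr; exact min_le_right _ _
  unfold NN
  rw [mul_add, mul_add]; linarith



/-! ### The class of functions closed under differentiation in the parameter -/

def TT (p q r a b c : ℕ) (n : ℕ) (x : ℝ) (θ : Fin 3 → ℝ) : ℝ :=
  θ 0 ^ p * (θ 1)⁻¹ ^ q * θ 2 ^ r * JJ a b c 1 n x (θ 0) (θ 1) (θ 2)

inductive Cls : ℕ → (ℕ → ℝ → (Fin 3 → ℝ) → ℝ) → Prop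
  | gen0 (p a : ℕ) : Cls 0 (TT p 0 0 a 0 0)
  | gen1 (p q r a b c : ℕ) : Cls 1 (TT p q r a (b + 1) c)
  | add {k : ℕ} {F G : ℕ → ℝ → (Fin 3 → ℝ) → ℝ} : Cls k F → Cls k G →
      Cls k (fun n x θ => F n x θ + G n x θ)
  | smul {k : ℕ} {F : ℕ → ℝ → (Fin 3 → ℝ) → ℝ} (s : ℝ) : Cls k F →
      Cls k (fun n x θ => s * F n x θ)

/-- Parameter neighbourhood as a predicate on vectors. -/
def Ctx.V (P : Ctx) (θ : Fin 3 → ℝ) : Prop := P.U (θ 0) (θ 1) (θ 2)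

def IsD (P : Ctx) (i : Fin 3) (F F' : ℕ → ℝ → (Fin 3 → ℝ) → ℝ) : Prop :=
  ∀ n : ℕ, 1 ≤ n → ∀ x θ, P.V θ →
    HasDerivAt (fun t => F n x (Function.update θ i t)) (F' n x θ) (θ i)

def kd (k : ℕ) (i : Fin 3) : ℕ := if i = 0 then k else 1

lemma TT_d0 (P : Ctx) (p q r a b c : ℕ) (hbc : b = 0 → c = 0) :
    IsD P 0 (TT p q r a b c) (fun n x θ => (p : ℝ) * TT (p - 1) q r a b c n x θ +
      (-1) * TT (p + 1) q r (a + 1) b c n x θ) := by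
  intro n hn x θ hθ
  have h1 := JJ_deriv_s P a b c hbc hn 1 x hθ
  have h2 := (hasDerivAt_pow p (θ 0)).mul h1
  have h3 := h2.mul_const ((θ 1)⁻¹ ^ q * θ 2 ^ r)
  have e : (fun t => TT p q r a b c n x (Function.update θ 0 t)) = fun t =>
      (t ^ p * JJ a b c 1 n x t (θ 1) (θ 2)) * ((θ 1)⁻¹ ^ q * θ 2 ^ r) := by
    funext t; simp [TT]; ring
  rw [e]
  refine h3.congr_deriv ?_
  simp only [TT]; ring

lemma TT_d1 (P : Ctx) (p q r a b c : ℕ) (hbc : b = 0 → c = 0) :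
    IsD P 1 (TT p q r a b c) (fun n x θ => (b - 0 : ℝ) * TT p (q + 1) (r + 1) a b c n x θ +
      ((c : ℝ) * TT p (q + 1) r a b (c - 1) n x θ +
      ((-1) * TT p (q + 1) (r + 1) a (b + 1) c n x θ +
      (-q : ℝ) * TT p (q + 1) r a b c n x θ))) := by
  intro n hn x θ hθ
  have hδ := hθ.pos.2.1
  have h1 := JJ_deriv_d P a b c hbc hn 1 x hθ
  have h2 := ((hasDerivAt_inv hδ.ne').pow q).mul h1
  have h3 := h2.mul_const (θ 0 ^ p * θ 2 ^ r)
  have e : (fun t => TT p q r a b c n x (Function.update θ 1 t)) = fun t =>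
      (t⁻¹ ^ q * JJ a b c 1 n x (θ 0) t (θ 2)) * (θ 0 ^ p * θ 2 ^ r) := by
    funext t; simp [TT]; ring
  rw [e]
  refine h3.congr_deriv ?_
  simp only [TT]
  rcases q with _ | q
  · simp; ring
  · simp only [Nat.add_sub_cancel]
    push_cast
    rw [← inv_pow]
    simp only [Pi.inv_apply, Pi.pow_apply]
    ring

lemma TT_d2 (P : Ctx) (p q r a b c : ℕ) (hbc : b = 0 → c = 0) :
    IsD P 2 (TT p q r a b c) (fun n x θ => (b : ℝ) * TT p q r a b (c + 1) n x θ +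
      ((-1) * TT p q r a (b + 1) (c + 1) n x θ +
      (r : ℝ) * TT p q (r - 1) a b c n x θ)) := by
  intro n hn x θ hθ
  have h1 := JJ_deriv_a P a b c hbc hn 1 x hθ
  have h2 := (hasDerivAt_pow r (θ 2)).mul h1
  have h3 := h2.mul_const (θ 0 ^ p * (θ 1)⁻¹ ^ q)
  have e : (fun t => TT p q r a b c n x (Function.update θ 2 t)) = fun t =>
      (t ^ r * JJ a b c 1 n x (θ 0) (θ 1) t) * (θ 0 ^ p * (θ 1)⁻¹ ^ q) := by
    funext t; simp [TT]; ring
  rw [e]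
  refine h3.congr_deriv ?_
  simp only [TT]; ring

lemma fin3_cases (i : Fin 3) : i = 0 ∨ i = 1 ∨ i = 2 := by
  fin_cases i <;> simp

lemma Cls.deriv (P : Ctx) {k : ℕ} {F : ℕ → ℝ → (Fin 3 → ℝ) → ℝ} (hF : Cls k F) (i : Fin 3) :
    ∃ F', Cls (kd k i) F' ∧ IsD P i F F' := by
  induction hF with
  | gen0 p a =>
    rcases fin3_cases i with rfl | rfl | rfl
    · exact ⟨_, ((Cls.gen0 _ _).smul _).add ((Cls.gen0 _ _).smul _),
        TT_d0 P p 0 0 a 0 0 (fun _ => rfl)⟩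
    · refine ⟨_, (Cls.gen1 p 1 1 a 0 0).smul (-1), fun n hn x θ hθ => ?_⟩
      refine (TT_d1 P p 0 0 a 0 0 (fun _ => rfl) n hn x θ hθ).congr_deriv ?_
      simp
    · refine ⟨_, (Cls.gen1 p 0 0 a 0 1).smul (-1), fun n hn x θ hθ => ?_⟩
      refine (TT_d2 P p 0 0 a 0 0 (fun _ => rfl) n hn x θ hθ).congr_deriv ?_
      simp
  | gen1 p q r a b c =>
    rcases fin3_cases i with rfl | rfl | rfl
    · exact ⟨_, ((Cls.gen1 _ _ _ _ _ _).smul _).add ((Cls.gen1 _ _ _ _ _ _).smul _),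
        TT_d0 P p q r a (b + 1) c (by simp)⟩
    · exact ⟨_, ((Cls.gen1 _ _ _ _ _ _).smul _).add (((Cls.gen1 _ _ _ _ _ _).smul _).add
        (((Cls.gen1 _ _ _ _ _ _).smul _).add ((Cls.gen1 _ _ _ _ _ _).smul _))),
        TT_d1 P p q r a (b + 1) c (by simp)⟩
    · exact ⟨_, ((Cls.gen1 _ _ _ _ _ _).smul _).add (((Cls.gen1 _ _ _ _ _ _).smul _).add
        ((Cls.gen1 _ _ _ _ _ _).smul _)),
        TT_d2 P p q r a (b + 1) c (by simp)⟩
  | add _ _ ih1 ih2 =>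
    obtain ⟨F', h1, h2⟩ := ih1
    obtain ⟨G', h3, h4⟩ := ih2
    exact ⟨_, h1.add h3, fun n hn x θ hθ => (h2 n hn x θ hθ).add (h4 n hn x θ hθ)⟩
  | smul s _ ih =>
    obtain ⟨F', h1, h2⟩ := ih
    exact ⟨_, h1.smul s, fun n hn x θ hθ => (h2 n hn x θ hθ).const_mul s⟩

def env (P : Ctx) (k n : ℕ) (x σ : ℝ) : ℝ := if k = 0 then NN P n x σ else ZZ P n x

lemma env_pos (P : Ctx) (k : ℕ) {n : ℕ} (hn : 1 ≤ n) (x σ : ℝ) : 0 < env P k n x σ := by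
  unfold env; split_ifs
  · exact NN_pos P hn x σ
  · exact ZZ_pos P hn x

lemma coef_le (P : Ctx) (p q r : ℕ) {θ : Fin 3 → ℝ} (hθ : P.V θ) :
    |θ 0 ^ p * (θ 1)⁻¹ ^ q * θ 2 ^ r| ≤ (2 * P.s0) ^ p * (P.d0 / 2)⁻¹ ^ q * 2 ^ r := by
  obtain ⟨h1, h2, h3, h4⟩ := hθ.pos
  obtain ⟨g1, g2, g3, g4, g5, g6⟩ := hθ
  have := P.hs; have := P.hd
  rw [abs_of_nonneg (by positivity)]
  gcongr

lemma Cls.bound (P : Ctx) {k : ℕ} {F : ℕ → ℝ → (Fin 3 → ℝ) → ℝ} (hF : Cls k F) :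
    ∃ C > 0, ∀ n : ℕ, 1 ≤ n → ∀ x θ, P.V θ →
      |F n x θ| ≤ C * ((n : ℝ) ^ (2 * P.τ) * env P k n x (θ 0)) := by
  have hs := P.hs; have hd := P.hd
  induction hF with
  | gen0 p a =>
    obtain ⟨C, hC, H⟩ := JJ_up0 P a
    refine ⟨(2 * P.s0) ^ p * (P.d0 / 2)⁻¹ ^ 0 * 2 ^ 0 * C, by positivity, fun n hn x θ hθ => ?_⟩
    rw [TT, abs_mul, mul_assoc _ C]
    have := coef_le P p 0 0 hθ
    exact mul_le_mul this (H n hn _ _ _ hθ x) (abs_nonneg _) (by positivity)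
  | gen1 p q r a b c =>
    obtain ⟨C, hC, H⟩ := JJ_up1 P a b c
    refine ⟨(2 * P.s0) ^ p * (P.d0 / 2)⁻¹ ^ q * 2 ^ r * C, by positivity, fun n hn x θ hθ => ?_⟩
    rw [TT, abs_mul, mul_assoc _ C]
    have := coef_le P p q r hθ
    exact mul_le_mul this (H n hn _ _ _ hθ x) (abs_nonneg _) (by positivity)
  | add _ _ ih1 ih2 =>
    obtain ⟨C, hC, h1⟩ := ih1
    obtain ⟨D, hD, h2⟩ := ih2
    refine ⟨C + D, by positivity, fun n hn x θ hθ => ?_⟩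
    rw [add_mul]
    exact (abs_add_le _ _).trans (add_le_add (h1 n hn x θ hθ) (h2 n hn x θ hθ))
  | smul s _ ih =>
    obtain ⟨C, hC, h1⟩ := ih
    refine ⟨(|s| + 1) * C, by positivity, fun n hn x θ hθ => ?_⟩
    have := env_pos P ‹ℕ› hn x (θ 0)
    rw [abs_mul, mul_assoc]
    exact mul_le_mul (by linarith) (h1 n hn x θ hθ) (abs_nonneg _) (by positivity)

/-! ### Derivatives up to order three of the (rescaled) density -/

def QQ : ℕ → ℝ → (Fin 3 → ℝ) → ℝ := TT 0 0 0 0 0 0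

lemma QQ_eq (n : ℕ) (x : ℝ) (θ : Fin 3 → ℝ) : QQ n x θ = JJ 0 0 0 1 n x (θ 0) (θ 1) (θ 2) := by
  simp [QQ, TT]

lemma exists_Qd (P : Ctx) : ∃ (q1 : Fin 3 → ℕ → ℝ → (Fin 3 → ℝ) → ℝ)
    (q2 : Fin 3 → Fin 3 → ℕ → ℝ → (Fin 3 → ℝ) → ℝ)
    (q3 : Fin 3 → Fin 3 → Fin 3 → ℕ → ℝ → (Fin 3 → ℝ) → ℝ),
    (∀ i, Cls (kd 0 i) (q1 i) ∧ IsD P i QQ (q1 i)) ∧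
    (∀ i j, Cls (kd (kd 0 i) j) (q2 i j) ∧ IsD P j (q1 i) (q2 i j)) ∧
    (∀ i j l, Cls (kd (kd (kd 0 i) j) l) (q3 i j l) ∧ IsD P l (q2 i j) (q3 i j l)) := by
  choose q1 h1 using fun i => Cls.deriv P (Cls.gen0 0 0) i
  choose q2 h2 using fun i j => Cls.deriv P (h1 i).1 j
  choose q3 h3 using fun i j l => Cls.deriv P (h2 i j).1 l
  exact ⟨q1, q2, q3, h1, h2, h3⟩



def rr (k : ℕ) (z : ℝ) : ℝ := if k = 0 then 1 else z

def zz (P : Ctx) (n : ℕ) (x σ : ℝ) : ℝ := ZZ P n x / NN P n x σ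

def mm (P : Ctx) (n : ℕ) : ℝ := (n : ℝ) ^ ((3 * P.K + 3) * P.τ)

lemma zz_pos (P : Ctx) {n : ℕ} (hn : 1 ≤ n) (x σ : ℝ) : 0 < zz P n x σ :=
  div_pos (ZZ_pos P hn x) (NN_pos P hn x σ)

lemma zz_le (P : Ctx) {n : ℕ} (hn : 1 ≤ n) (x σ : ℝ) : zz P n x σ ≤ 1 :=
  (div_le_one (NN_pos P hn x σ)).2 (ZZ_le_NN P n x σ)

lemma mm_ge (P : Ctx) {n : ℕ} (hn : 1 ≤ n) : 1 ≤ mm P n := by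
  have hn1 : (1 : ℝ) ≤ n := by exact_mod_cast hn
  have := P.K_pos; have := P.hτ
  exact Real.one_le_rpow hn1 (by positivity)

lemma env_div (P : Ctx) (k : ℕ) {n : ℕ} (hn : 1 ≤ n) (x σ : ℝ) :
    env P k n x σ = rr k (zz P n x σ) * NN P n x σ := by
  have := (NN_pos P hn x σ).ne'
  unfold env rr zz
  split_ifs
  · ring
  · field_simp

/-- Lower bound of the density, packaged. -/
def QL (P : Ctx) (c : ℝ) (N : ℕ) : Prop := ∀ n : ℕ, N ≤ n → ∀ σ δ α, P.U σ δ α → ∀ x,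
    |x| ≤ (n : ℝ) ^ P.K →
    c * ((n : ℝ) ^ (-((3 * P.K + 1) * P.τ)) * NN P n x σ) ≤ JJ 0 0 0 1 n x σ δ α

lemma Cls.ratio (P : Ctx) {c : ℝ} (hc : 0 < c) {N : ℕ} (hN : 1 ≤ N) (hQ : QL P c N)
    {k : ℕ} {F : ℕ → ℝ → (Fin 3 → ℝ) → ℝ} (hF : Cls k F) :
    ∃ C, ∀ n : ℕ, N ≤ n → ∀ x θ, P.V θ → |x| ≤ (n : ℝ) ^ P.K →
      |F n x θ / QQ n x θ| ≤ C * (mm P n * rr k (zz P n x (θ 0))) := by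
  obtain ⟨C, hC, H⟩ := hF.bound P
  refine ⟨C / c, fun n hn x θ hθ hx => ?_⟩
  have hn' : 1 ≤ n := hN.trans hn
  have hn0 : (0 : ℝ) < n := by exact_mod_cast hn'
  have h1 := hQ n hn _ _ _ hθ x hx
  have hNN := NN_pos P hn' x (θ 0)
  rw [← QQ_eq] at h1
  have hpos : 0 < c * ((n : ℝ) ^ (-((3 * P.K + 1) * P.τ)) * NN P n x (θ 0)) := by positivity
  have hQ0 : 0 < QQ n x θ := hpos.trans_le h1
  rw [abs_div, abs_of_pos hQ0]
  have h2 := H n hn' x θ hθ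
  rw [env_div P k hn'] at h2
  have hz := zz_pos P hn' x (θ 0)
  have hr : 0 ≤ rr k (zz P n x (θ 0)) := by unfold rr; split_ifs <;> linarith
  have hm : mm P n = (n : ℝ) ^ (2 * P.τ) / (n : ℝ) ^ (-((3 * P.K + 1) * P.τ)) := by
    rw [← Real.rpow_sub hn0, mm]; congr 1; ring
  calc _ ≤ (C * ((n : ℝ) ^ (2 * P.τ) * (rr k (zz P n x (θ 0)) * NN P n x (θ 0)))) /
        (c * ((n : ℝ) ^ (-((3 * P.K + 1) * P.τ)) * NN P n x (θ 0))) := by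
        gcongr
    _ = _ := by
      rw [hm]; field_simp

/-- All data about derivatives of the density. -/
structure QD (P : Ctx) where
  c : ℝ
  N : ℕ
  C : ℝ
  q1 : Fin 3 → ℕ → ℝ → (Fin 3 → ℝ) → ℝ
  q2 : Fin 3 → Fin 3 → ℕ → ℝ → (Fin 3 → ℝ) → ℝ
  q3 : Fin 3 → Fin 3 → Fin 3 → ℕ → ℝ → (Fin 3 → ℝ) → ℝ
  hc : 0 < c
  hN : 1 ≤ N
  hC : 0 ≤ C
  hQ : QL P c N
  d1 : ∀ i, IsD P i QQ (q1 i)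
  d2 : ∀ i j, IsD P j (q1 i) (q2 i j)
  d3 : ∀ i j l, IsD P l (q2 i j) (q3 i j l)
  b1 : ∀ i, ∀ n : ℕ, N ≤ n → ∀ x θ, P.V θ → |x| ≤ (n : ℝ) ^ P.K →
      |q1 i n x θ / QQ n x θ| ≤ C * (mm P n * rr (kd 0 i) (zz P n x (θ 0)))
  b2 : ∀ i j, ∀ n : ℕ, N ≤ n → ∀ x θ, P.V θ → |x| ≤ (n : ℝ) ^ P.K →
      |q2 i j n x θ / QQ n x θ| ≤ C * (mm P n * rr (kd (kd 0 i) j) (zz P n x (θ 0)))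
  b3 : ∀ i j l, ∀ n : ℕ, N ≤ n → ∀ x θ, P.V θ → |x| ≤ (n : ℝ) ^ P.K →
      |q3 i j l n x θ / QQ n x θ| ≤ C * (mm P n * rr (kd (kd (kd 0 i) j) l) (zz P n x (θ 0)))

lemma exists_QD (P : Ctx) : Nonempty (QD P) := by
  obtain ⟨c, hc, N, hN, hQ⟩ := Q_lower P
  obtain ⟨q1, q2, q3, h1, h2, h3⟩ := exists_Qd P
  choose C1 H1 using fun i => Cls.ratio P hc hN hQ (h1 i).1
  choose C2 H2 using fun i j => Cls.ratio P hc hN hQ (h2 i j).1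
  choose C3 H3 using fun i j l => Cls.ratio P hc hN hQ (h3 i j l).1
  obtain ⟨M1, hM1⟩ := Finite.exists_le C1
  obtain ⟨M2, hM2⟩ := Finite.exists_le (fun p : Fin 3 × Fin 3 => C2 p.1 p.2)
  obtain ⟨M3, hM3⟩ := Finite.exists_le (fun p : Fin 3 × Fin 3 × Fin 3 => C3 p.1 p.2.1 p.2.2)
  have mono : ∀ {A B : ℝ} (_ : A ≤ B) (k n : ℕ), N ≤ n → ∀ x (θ : Fin 3 → ℝ),
      A * (mm P n * rr k (zz P n x (θ 0))) ≤ B * (mm P n * rr k (zz P n x (θ 0))) := by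
    intro A B h k n hn x θ
    have hz := zz_pos P (hN.trans hn) x (θ 0)
    have := mm_ge P (hN.trans hn)
    have hr : 0 ≤ rr k (zz P n x (θ 0)) := by unfold rr; split_ifs <;> linarith
    exact mul_le_mul_of_nonneg_right h (mul_nonneg (by linarith) hr)
  set M := max 0 (max M1 (max M2 M3)) with hM
  have a1 : M1 ≤ M := (le_max_left _ _).trans (le_max_right _ _)
  have a2 : M2 ≤ M := (le_max_left _ _).trans ((le_max_right _ _).trans (le_max_right _ _))
  have a3 : M3 ≤ M := (le_max_right _ _).trans ((le_max_right _ _).trans (le_max_right _ _))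
  exact ⟨⟨c, N, M, q1, q2, q3, hc, hN, le_max_left _ _, hQ, fun i => (h1 i).2,
    fun i j => (h2 i j).2, fun i j l => (h3 i j l).2,
    fun i n hn x θ hθ hx => (H1 i n hn x θ hθ hx).trans (mono ((hM1 i).trans a1) _ n hn x θ),
    fun i j n hn x θ hθ hx => (H2 i j n hn x θ hθ hx).trans
      (mono ((hM2 (i, j)).trans a2) _ n hn x θ),
    fun i j l n hn x θ hθ hx => (H3 i j l n hn x θ hθ hx).trans
      (mono ((hM3 (i, j, l)).trans a3) _ n hn x θ)⟩⟩

lemma QD.Q_pos {P : Ctx} (D : QD P) {n : ℕ} (hn : D.N ≤ n) {x : ℝ} {θ : Fin 3 → ℝ} (hθ : P.V θ)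
    (hx : |x| ≤ (n : ℝ) ^ P.K) : 0 < QQ n x θ := by
  have hn' : 1 ≤ n := D.hN.trans hn
  have hn0 : (0 : ℝ) < n := by exact_mod_cast hn'
  have h1 := D.hQ n hn _ _ _ hθ x hx
  have hNN := NN_pos P hn' x (θ 0)
  have hc := D.hc
  rw [← QQ_eq] at h1
  exact lt_of_lt_of_le (by positivity) h1

/-- Second logarithmic derivatives. -/
def QD.A {P : Ctx} (D : QD P) (i j : Fin 3) (n : ℕ) (x : ℝ) (θ : Fin 3 → ℝ) : ℝ :=
  D.q2 j i n x θ / QQ n x θ - (D.q1 j n x θ / QQ n x θ) * (D.q1 i n x θ / QQ n x θ)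

/-- Third logarithmic derivatives. -/
def QD.B {P : Ctx} (D : QD P) (i j l : Fin 3) (n : ℕ) (x : ℝ) (θ : Fin 3 → ℝ) : ℝ :=
  D.q3 j i l n x θ / QQ n x θ - (D.q2 j i n x θ / QQ n x θ) * (D.q1 l n x θ / QQ n x θ)
    - (D.q2 j l n x θ / QQ n x θ) * (D.q1 i n x θ / QQ n x θ)
    - (D.q2 i l n x θ / QQ n x θ) * (D.q1 j n x θ / QQ n x θ)
    + 2 * ((D.q1 i n x θ / QQ n x θ) * (D.q1 j n x θ / QQ n x θ) * (D.q1 l n x θ / QQ n x θ))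

lemma QD.ratio_deriv {P : Ctx} (D : QD P) {n : ℕ} (hn : 1 ≤ n) {x : ℝ} {θ : Fin 3 → ℝ}
    (hθ : P.V θ) (hQ : QQ n x θ ≠ 0) (l : Fin 3) {F F' : ℕ → ℝ → (Fin 3 → ℝ) → ℝ}
    (hF : IsD P l F F') :
    HasDerivAt (fun t => F n x (Function.update θ l t) / QQ n x (Function.update θ l t))
      (F' n x θ / QQ n x θ - (F n x θ / QQ n x θ) * (D.q1 l n x θ / QQ n x θ)) (θ l) := by
  have h1 := hF n hn x θ hθ
  have h2 := D.d1 l n hn x θ hθ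
  have h3 := h1.div h2 (by simpa using hQ)
  refine h3.congr_deriv ?_
  simp only [Function.update_eq_self]
  field_simp

lemma QD.A_deriv {P : Ctx} (D : QD P) {n : ℕ} (hn : 1 ≤ n) {x : ℝ} {θ : Fin 3 → ℝ}
    (hθ : P.V θ) (hQ : QQ n x θ ≠ 0) (i j l : Fin 3) :
    HasDerivAt (fun t => D.A i j n x (Function.update θ l t)) (D.B i j l n x θ) (θ l) := by
  have h1 := D.ratio_deriv hn hθ hQ l (D.d3 j i l)
  have h2 := D.ratio_deriv hn hθ hQ l (D.d2 j l)
  have h3 := D.ratio_deriv hn hθ hQ l (D.d2 i l)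
  refine (h1.sub (h2.mul h3)).congr_deriv ?_
  simp only [Function.update_eq_self, QD.B]
  ring

def RR (i j l : Fin 3) (z : ℝ) : ℝ := if i = 0 ∧ j = 0 ∧ l = 0 then 1 else z

lemma abs_mul_bound {a b A B m r s R : ℝ} (ha : |a| ≤ A * (m * r)) (hb : |b| ≤ B * (m * s))
    (hA : 0 ≤ A) (hB : 0 ≤ B) (hm : 0 ≤ m) (hr : 0 ≤ r) (hR : r * s ≤ R) :
    |a * b| ≤ (A * B) * (m ^ 2 * R) := by
  rw [abs_mul]
  calc |a| * |b| ≤ (A * (m * r)) * (B * (m * s)) :=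
        mul_le_mul ha hb (abs_nonneg _) (by positivity)
    _ = (A * B) * (m ^ 2 * (r * s)) := by ring
    _ ≤ _ := by gcongr

set_option maxHeartbeats 1000000 in
lemma QD.B_bound {P : Ctx} (D : QD P) (i j l : Fin 3) : ∀ n : ℕ, D.N ≤ n → ∀ x θ, P.V θ →
    |x| ≤ (n : ℝ) ^ P.K → |D.B i j l n x θ| ≤ (D.C + 3 * D.C ^ 2 + 2 * D.C ^ 3) *
      (mm P n ^ 3 * RR i j l (zz P n x (θ 0))) := by
  intro n hn x θ hθ hx
  have hn' : 1 ≤ n := D.hN.trans hn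
  have hz := zz_pos P hn' x (θ 0)
  have hz1 := zz_le P hn' x (θ 0)
  have hm := mm_ge P hn'
  have hC := D.hC
  have hi := D.b1 i n hn x θ hθ hx
  have hj := D.b1 j n hn x θ hθ hx
  have hl := D.b1 l n hn x θ hθ hx
  have hji := D.b2 j i n hn x θ hθ hx
  have hjl := D.b2 j l n hn x θ hθ hx
  have hil := D.b2 i l n hn x θ hθ hx
  have hjil := D.b3 j i l n hn x θ hθ hx
  unfold QD.B
  generalize zz P n x (θ 0) = z at *
  generalize mm P n = m at *
  generalize D.q1 i n x θ / QQ n x θ = ai at *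
  generalize D.q1 j n x θ / QQ n x θ = aj at *
  generalize D.q1 l n x θ / QQ n x θ = al at *
  generalize D.q2 j i n x θ / QQ n x θ = aji at *
  generalize D.q2 j l n x θ / QQ n x θ = ajl at *
  generalize D.q2 i l n x θ / QQ n x θ = ail at *
  generalize D.q3 j i l n x θ / QQ n x θ = ajil at *
  generalize D.C = C at *
  have hr : ∀ k, 0 ≤ rr k z := by intro k; unfold rr; split_ifs <;> linarith
  have hR : 0 ≤ RR i j l z := by unfold RR; split_ifs <;> linarith
  have hzz : z * z ≤ z := by nlinarith
  have hzzz : z * z * z ≤ z := by nlinarith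
  have r1 : rr (kd (kd (kd 0 j) i) l) z ≤ RR i j l z := by
    by_cases h1 : i = 0 <;> by_cases h2 : j = 0 <;> by_cases h3 : l = 0 <;>
      simp [rr, kd, RR, h1, h2, h3]
  have r2 : rr (kd (kd 0 j) i) z * rr (kd 0 l) z ≤ RR i j l z := by
    by_cases h1 : i = 0 <;> by_cases h2 : j = 0 <;> by_cases h3 : l = 0 <;>
      simp [rr, kd, RR, h1, h2, h3] <;> linarith
  have r3 : rr (kd (kd 0 j) l) z * rr (kd 0 i) z ≤ RR i j l z := by
    by_cases h1 : i = 0 <;> by_cases h2 : j = 0 <;> by_cases h3 : l = 0 <;>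
      simp [rr, kd, RR, h1, h2, h3] <;> linarith
  have r4 : rr (kd (kd 0 i) l) z * rr (kd 0 j) z ≤ RR i j l z := by
    by_cases h1 : i = 0 <;> by_cases h2 : j = 0 <;> by_cases h3 : l = 0 <;>
      simp [rr, kd, RR, h1, h2, h3] <;> linarith
  have r5 : rr (kd 0 i) z * rr (kd 0 j) z * rr (kd 0 l) z ≤ RR i j l z := by
    by_cases h1 : i = 0 <;> by_cases h2 : j = 0 <;> by_cases h3 : l = 0 <;>
      simp [rr, kd, RR, h1, h2, h3] <;> linarith
  generalize RR i j l z = R at *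
  have m0 : 0 ≤ m := by linarith
  have m13 : m ≤ m ^ 3 := le_self_pow₀ hm (by norm_num)
  have m23 : m ^ 2 ≤ m ^ 3 := pow_le_pow_right₀ hm (by norm_num)
  have t1 : |ajil| ≤ C * (m ^ 3 * R) := hjil.trans (by gcongr; exact hr _)
  have t2 : |aji * al| ≤ C * C * (m ^ 3 * R) :=
    (abs_mul_bound hji hl hC hC m0 (hr _) r2).trans (by gcongr)
  have t3 : |ajl * ai| ≤ C * C * (m ^ 3 * R) :=
    (abs_mul_bound hjl hi hC hC m0 (hr _) r3).trans (by gcongr)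
  have t4 : |ail * aj| ≤ C * C * (m ^ 3 * R) :=
    (abs_mul_bound hil hj hC hC m0 (hr _) r4).trans (by gcongr)
  have t5 : |ai * aj * al| ≤ C * C * C * (m ^ 3 * R) := by
    rw [abs_mul, abs_mul]
    calc _ ≤ (C * (m * rr (kd 0 i) z)) * (C * (m * rr (kd 0 j) z)) * (C * (m * rr (kd 0 l) z)) := by
          have := hr (kd 0 i); have := hr (kd 0 j); have := hr (kd 0 l)
          gcongr
      _ = C * C * C * (m ^ 3 * (rr (kd 0 i) z * rr (kd 0 j) z * rr (kd 0 l) z)) := by ring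
      _ ≤ _ := by gcongr
  rw [abs_le] at *
  constructor <;> nlinarith

/-! ### Mean value estimate on boxes -/

lemma tele1 (A B : (Fin 3 → ℝ) → ℝ) (l : Fin 3) {M ρ s : ℝ} (θ : Fin 3 → ℝ)
    (h : ∀ t, |t - s| ≤ ρ → HasDerivAt (fun t' => A (Function.update θ l t')) (B (Function.update θ l t)) t
      ∧ |B (Function.update θ l t)| ≤ M) (hM : 0 ≤ M) {t : ℝ} (ht : |t - s| ≤ ρ) :
    |A (Function.update θ l t) - A (Function.update θ l s)| ≤ M * ρ := by
  have hρ : 0 ≤ ρ := (abs_nonneg _).trans ht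
  have hc : Convex ℝ (Metric.closedBall s ρ) := convex_closedBall _ _
  have hb : ∀ u ∈ Metric.closedBall s ρ, |u - s| ≤ ρ := fun u hu => by
    rwa [Metric.mem_closedBall, Real.dist_eq] at hu
  have := hc.norm_image_sub_le_of_norm_hasDerivWithin_le
    (f := fun t' => A (Function.update θ l t')) (f' := fun t => B (Function.update θ l t))
    (C := M) (fun u hu => (h u (hb u hu)).1.hasDerivWithinAt) (fun u hu => (h u (hb u hu)).2)
    (Metric.mem_closedBall_self hρ) (y := t) (by rwa [Metric.mem_closedBall, Real.dist_eq])
  rw [Real.norm_eq_abs, Real.norm_eq_abs] at this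
  exact this.trans (by gcongr)

def Bx (ρ θ0 θ : Fin 3 → ℝ) : Prop := ∀ i, |θ i - θ0 i| ≤ ρ i

lemma Bx.update {ρ θ0 θ : Fin 3 → ℝ} (h : Bx ρ θ0 θ) (l : Fin 3) {t : ℝ}
    (ht : |t - θ0 l| ≤ ρ l) : Bx ρ θ0 (Function.update θ l t) := by
  intro i
  by_cases hi : i = l
  · subst hi; simpa using ht
  · simpa [hi] using h i

lemma tele (A : (Fin 3 → ℝ) → ℝ) (B : Fin 3 → (Fin 3 → ℝ) → ℝ) (ρ θ0 : Fin 3 → ℝ) (M : Fin 3 → ℝ)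
    (hM : ∀ l, 0 ≤ M l) (hρ : ∀ l, 0 ≤ ρ l)
    (h : ∀ θ, Bx ρ θ0 θ → ∀ l, HasDerivAt (fun t => A (Function.update θ l t)) (B l θ) (θ l) ∧
      |B l θ| ≤ M l) {θ : Fin 3 → ℝ} (hθ : Bx ρ θ0 θ) :
    |A θ - A θ0| ≤ M 0 * ρ 0 + M 1 * ρ 1 + M 2 * ρ 2 := by
  have step : ∀ (θ' : Fin 3 → ℝ) (l : Fin 3), Bx ρ θ0 θ' → θ' l = θ0 l →
      |A (Function.update θ' l (θ l)) - A θ'| ≤ M l * ρ l := by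
    intro θ' l hb he
    have := tele1 A (B l) l (M := M l) (ρ := ρ l) (s := θ0 l) θ' (fun t ht => by
      have := h _ (hb.update l ht) l
      simpa using this) (hM l) (hθ l)
    rwa [← he, Function.update_eq_self] at this
  have h0 : Bx ρ θ0 θ0 := fun i => by simpa using hρ i
  have s0 := step θ0 0 h0 rfl
  have h1 := h0.update 0 (hθ 0)
  have s1 := step _ 1 h1 (by simp)
  have h2 := h1.update 1 (hθ 1)
  have s2 := step _ 2 h2 (by simp)
  have e : Function.update (Function.update (Function.update θ0 0 (θ 0)) 1 (θ 1)) 2 (θ 2) = θ := by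
    funext i
    rcases fin3_cases i with rfl | rfl | rfl <;> simp
  rw [e] at s2
  rw [abs_le] at *
  constructor <;> linarith



/-! ### The density as a cosine integral -/

lemma gauss_integrable : Integrable gauss := by
  have := (integrable_exp_neg_mul_sq (b := 1 / 2) (by norm_num)).const_mul (Real.sqrt (2 * Real.pi))⁻¹
  refine this.congr (ae_of_all _ fun y => ?_)
  simp only [gauss]
  congr 2; ring

lemma gauss_nonneg (y : ℝ) : 0 ≤ gauss y := by unfold gauss; positivity

lemma gauss_cont : Continuous gauss := by unfold gauss; fun_prop

lemma stable_exp_integrable {α : ℝ} (hα : 0 < α) :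
    Integrable (fun u : ℝ => Real.exp (-(|u| ^ α))) := by
  by_contra h
  have h1 := integral_undef h
  have h2 := integral_comp_abs (f := fun u : ℝ => Real.exp (-(u ^ α)))
  rw [h1] at h2
  have h3 := integral_exp_neg_rpow hα
  rw [h3] at h2
  have := Real.Gamma_pos_of_pos (s := 1 / α + 1) (by positivity)
  linarith

lemma gauss_cos_int (Y : ℝ) {w : ℝ} (hw : 0 < w) (u : ℝ) :
    ∫ z : ℝ, gauss (Y - w * z) * Real.cos (z * u) =
      w⁻¹ * (Real.cos (Y * (u / w)) * Real.exp (-((u / w) ^ 2) / 2)) := by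
  set t := u / w with ht
  have e1 : (fun z : ℝ => gauss (Y - w * z) * Real.cos (z * u)) =
      fun z => (fun s => (fun v => gauss v * Real.cos ((Y - v) * t)) (Y - s)) (w * z) := by
    funext z
    simp only
    congr 2
    rw [ht]; field_simp; ring
  rw [e1, Measure.integral_comp_mul_left (fun s => (fun v => gauss v * Real.cos ((Y - v) * t)) (Y - s)) w,
    integral_sub_left_eq_self (fun v => gauss v * Real.cos ((Y - v) * t)) volume Y,
    abs_of_pos (by positivity), smul_eq_mul]
  congr 1
  have hi1 : Integrable (fun v => gauss v * Real.cos (v * t)) := by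
    refine gauss_integrable.mono' (gauss_cont.mul (by fun_prop)).aestronglyMeasurable
      (ae_of_all _ fun v => ?_)
    rw [norm_mul, Real.norm_of_nonneg (gauss_nonneg v)]
    exact mul_le_of_le_one_right (gauss_nonneg v) (Real.abs_cos_le_one _)
  have hi2 : Integrable (fun v => gauss v * Real.sin (v * t)) := by
    refine gauss_integrable.mono' (gauss_cont.mul (by fun_prop)).aestronglyMeasurable
      (ae_of_all _ fun v => ?_)
    rw [norm_mul, Real.norm_of_nonneg (gauss_nonneg v)]
    exact mul_le_of_le_one_right (gauss_nonneg v) (Real.abs_sin_le_one _)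
  have hs : ∫ v, gauss v * Real.sin (v * t) = 0 := by
    have h := integral_neg_eq_self (fun v => gauss v * Real.sin (v * t)) volume
    have e : (fun v => gauss (-v) * Real.sin (-v * t)) = fun v => -(gauss v * Real.sin (v * t)) := by
      funext v; simp [gauss]
    rw [e, integral_neg] at h
    linarith
  have hcint : ∫ v, gauss v * Real.cos (v * t) = Real.exp (-(t ^ 2) / 2) := by
    have h := integral_cos_gauss (b := 1 / 2) (by norm_num) t
    have e : (fun v => gauss v * Real.cos (v * t)) = fun v => (Real.sqrt (2 * Real.pi))⁻¹ *
        (Real.cos (t * v) * Real.exp (-(1 / 2) * v ^ 2)) := by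
      funext v
      rw [gauss, mul_comm v t, show -(v ^ 2) / 2 = -(1 / 2) * v ^ 2 by ring]; ring
    rw [e, integral_const_mul, h, show Real.pi / (1 / 2) = 2 * Real.pi by ring, ← mul_assoc,
      inv_mul_cancel₀ (by positivity), one_mul]
    congr 1; ring
  have e2 : (fun v => gauss v * Real.cos ((Y - v) * t)) = fun v =>
      Real.cos (Y * t) * (gauss v * Real.cos (v * t)) +
      Real.sin (Y * t) * (gauss v * Real.sin (v * t)) := by
    funext v
    rw [sub_mul, Real.cos_sub]; ring
  rw [e2, integral_add (hi1.const_mul _) (hi2.const_mul _), integral_const_mul, integral_const_mul,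
    hs, hcint]
  ring

lemma fFun_eq {α : ℝ} (hα : 0 < α) (Y : ℝ) {w : ℝ} (hw : 0 < w) :
    fFun α Y w = (2 * Real.pi)⁻¹ * ∫ u : ℝ, Real.exp (-(|u| ^ α)) *
      (w⁻¹ * (Real.cos (Y * (u / w)) * Real.exp (-((u / w) ^ 2) / 2))) := by
  have hg : Integrable (fun z => gauss (Y - w * z)) :=
    (gauss_integrable.comp_sub_left Y).comp_mul_left' hw.ne'
  have hprod := hg.mul_prod (stable_exp_integrable hα)
  have hF : Integrable (Function.uncurry fun z u => gauss (Y - w * z) *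
      (Real.cos (z * u) * Real.exp (-(|u| ^ α)))) (volume.prod volume) := by
    refine hprod.mono' ?_ (ae_of_all _ ?_)
    · have : Measurable (Function.uncurry fun z u => gauss (Y - w * z) *
          (Real.cos (z * u) * Real.exp (-(|u| ^ α)))) := by
        have h1 : Measurable gauss := gauss_cont.measurable
        simp only [Function.uncurry_def]
        fun_prop
      exact this.aestronglyMeasurable
    · rintro ⟨z, u⟩
      simp only [Function.uncurry]
      rw [norm_mul, norm_mul, Real.norm_of_nonneg (gauss_nonneg _),
        Real.norm_of_nonneg (Real.exp_nonneg _)]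
      gcongr
      · exact gauss_nonneg _
      · exact mul_le_of_le_one_left (Real.exp_nonneg _) (Real.abs_cos_le_one _)
  have hsw := integral_integral_swap hF
  unfold fFun stableDensity
  calc _ = ∫ z, (2 * Real.pi)⁻¹ * ∫ u, gauss (Y - w * z) *
        (Real.cos (z * u) * Real.exp (-(|u| ^ α))) := by
        congr 1; funext z
        rw [integral_const_mul]; ring
    _ = (2 * Real.pi)⁻¹ * ∫ u, ∫ z, gauss (Y - w * z) *
        (Real.cos (z * u) * Real.exp (-(|u| ^ α))) := by rw [integral_const_mul, hsw]
    _ = _ := by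
      congr 2; funext u
      rw [← gauss_cos_int Y hw u, ← integral_const_mul]
      congr 1; funext z; ring

lemma pdens_eq {n : ℕ} (hn : 1 ≤ n) {θ : Fin 3 → ℝ} (h0 : 0 < θ 0) (h1 : 0 < θ 1) (h2 : 0 < θ 2)
    (y : ℝ) : pdens n θ y = Real.sqrt n * QQ n (Real.sqrt n * y) θ := by
  have hn0 : (0 : ℝ) < n := by exact_mod_cast hn
  set w := wn n (θ 0) (θ 1) (θ 2) with hw
  have hwp : 0 < w := by rw [hw]; unfold wn; positivity
  have hws : 0 < w * θ 0 := by positivity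
  rw [pdens, ← hw, fFun_eq h2 _ hwp, QQ_eq, JJ]
  set g : ℝ → ℝ := fun u => Real.exp (-(|u| ^ θ 2)) *
      (w⁻¹ * (Real.cos (Real.sqrt n * y / θ 0 * (u / w)) * Real.exp (-((u / w) ^ 2) / 2))) with hg
  have hsub := Measure.integral_comp_mul_left g (w * θ 0)
  rw [abs_of_pos (by positivity), smul_eq_mul] at hsub
  have hsub2 : ∫ u, g u = (w * θ 0) * ∫ v, g (w * θ 0 * v) := by
    rw [hsub, ← mul_assoc, mul_inv_cancel₀ hws.ne', one_mul]
  rw [hsub2]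
  have e : (fun v => g (w * θ 0 * v)) = fun v => w⁻¹ *
      ((fun a => Real.cos (a * (Real.sqrt n * y)) *
        Real.exp (-(θ 0 ^ 2 * a ^ 2) / 2 - (w * θ 0) ^ θ 2 * a ^ θ 2)) |v|) := by
    funext v
    simp only [hg]
    have c1 : Real.cos (Real.sqrt n * y / θ 0 * (w * θ 0 * v / w)) =
        Real.cos (|v| * (Real.sqrt n * y)) := by
      have : Real.sqrt n * y / θ 0 * (w * θ 0 * v / w) = v * (Real.sqrt n * y) := by field_simp
      rw [this]
      rcases abs_choice v with h | h <;> rw [h]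
      rw [neg_mul, Real.cos_neg]
    have c2 : -((w * θ 0 * v / w) ^ 2) / 2 = -(θ 0 ^ 2 * |v| ^ 2) / 2 := by
      rw [sq_abs]; field_simp
    have c3 : |w * θ 0 * v| ^ θ 2 = (w * θ 0) ^ θ 2 * |v| ^ θ 2 := by
      rw [abs_mul, abs_of_pos hws, Real.mul_rpow hws.le (abs_nonneg _)]
    rw [c1, c2, c3, sub_eq_add_neg, Real.exp_add]; ring
  rw [e, integral_const_mul, integral_comp_abs (f := fun a => Real.cos (a * (Real.sqrt n * y)) *
        Real.exp (-(θ 0 ^ 2 * a ^ 2) / 2 - (w * θ 0) ^ θ 2 * a ^ θ 2))]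
  have e2 : ∫ a in Ioi (0 : ℝ), Real.cos (a * (Real.sqrt n * y)) *
        Real.exp (-(θ 0 ^ 2 * a ^ 2) / 2 - (w * θ 0) ^ θ 2 * a ^ θ 2) =
      ∫ u in Ioi (0 : ℝ), Real.cos (u * (Real.sqrt n * y)) * MM 0 0 0 1 n (θ 0) (θ 1) (θ 2) u := by
    refine setIntegral_congr_fun measurableSet_Ioi fun u hu => ?_
    simp only [MM, pow_zero, mul_zero, one_mul, one_pow]
    rw [LL_eq hn _ h1 hu]
    have : (w * θ 0) ^ θ 2 = (n : ℝ) ^ (θ 2 / 2 - 1) * θ 1 ^ θ 2 := by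
      have : w * θ 0 = (n : ℝ) ^ ((1 : ℝ) / 2 - 1 / θ 2) * θ 1 := by
        rw [hw, wn]; field_simp
      rw [this, Real.mul_rpow (by positivity) h1.le, ← Real.rpow_mul hn0.le]
      congr 2; field_simp
    rw [this]
  rw [e2]
  generalize ∫ u in Ioi (0 : ℝ), Real.cos (u * (Real.sqrt n * y)) *
    MM 0 0 0 1 n (θ 0) (θ 1) (θ 2) u = I
  field_simp



/-! ### Integrals of the density at the true parameter -/

def Ctx.th (P : Ctx) : Fin 3 → ℝ := ![P.s0, P.d0, P.a0]

lemma Ctx.th_V (P : Ctx) : P.V P.th := by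
  have := P.hs; have := P.hd; have := P.hτ
  simp only [Ctx.V, Ctx.U, Ctx.th, Matrix.cons_val_zero, Matrix.cons_val_one, Matrix.cons_val]
  refine ⟨?_, ?_, ?_, ?_, ?_, ?_⟩ <;> linarith

lemma QQ_cont (P : Ctx) {n : ℕ} (hn : 1 ≤ n) {θ : Fin 3 → ℝ} (hθ : P.V θ) :
    Continuous (fun x => QQ n x θ) := by
  simp only [QQ_eq, JJ]
  refine Continuous.mul continuous_const ?_
  have hM := MM_int P 0 0 0 (fun _ => rfl) hn 1 hθ
  refine continuous_of_dominated (bound := fun u => ‖MM 0 0 0 1 n (θ 0) (θ 1) (θ 2) u‖)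
    (fun x => (cos_int x hM).aestronglyMeasurable) (fun x => ae_of_all _ fun u => ?_) hM.norm
    (ae_of_all _ fun u => by fun_prop)
  rw [norm_mul]
  exact mul_le_of_le_one_left (norm_nonneg _) (Real.abs_cos_le_one _)

lemma QQ_bound (P : Ctx) : ∃ C > 0, ∀ n : ℕ, 1 ≤ n → ∀ x θ, P.V θ →
      |QQ n x θ| ≤ C * ((n : ℝ) ^ (2 * P.τ) * NN P n x (θ 0)) := by
  obtain ⟨C, hC, H⟩ := (Cls.gen0 0 0).bound P
  exact ⟨C, hC, fun n hn x θ hθ => by simpa [env, QQ] using H n hn x θ hθ⟩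

lemma brk_int {r : ℝ} (hr : 0 < r) : Integrable (fun x : ℝ => (1 + |x|) ^ (-(1 + r))) := by
  have := integrable_one_add_norm (E := ℝ) (μ := volume) (r := 1 + r) (by simp; exact hr)
  simpa using this

lemma ZZ_int (P : Ctx) (n : ℕ) : Integrable (fun x => ZZ P n x) :=
  (brk_int P.β_pos).const_mul _

lemma Eg_int {σ : ℝ} (hσ : 0 < σ) : Integrable (fun x => Eg x σ) := by
  have := integrable_exp_neg_mul_sq (b := 1 / (2 * σ ^ 2)) (by positivity)
  refine this.congr (ae_of_all _ fun x => ?_)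
  simp only [Eg]; congr 1; ring

lemma NN_int (P : Ctx) (n : ℕ) {σ : ℝ} (hσ : 0 < σ) : Integrable (fun x => NN P n x σ) :=
  (Eg_int hσ).add (ZZ_int P n)

lemma QQ_int (P : Ctx) {n : ℕ} (hn : 1 ≤ n) {θ : Fin 3 → ℝ} (hθ : P.V θ) :
    Integrable (fun x => QQ n x θ) := by
  obtain ⟨C, hC, H⟩ := QQ_bound P
  exact (((NN_int P n hθ.pos.1).const_mul ((n : ℝ) ^ (2 * P.τ))).const_mul C).mono'
    (QQ_cont P hn hθ).aestronglyMeasurable (ae_of_all _ fun x => H n hn x θ hθ)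

lemma QQ_reg (P : Ctx) {n : ℕ} (hn : 1 ≤ n) {θ : Fin 3 → ℝ} (hθ : P.V θ) {b : ℝ} (hb : 0 < b) :
    ∫ x, QQ n x θ * Real.exp (-b * x ^ 2) ≤ 1 := by
  have hM := MM_int P 0 0 0 (fun _ => rfl) hn 1 hθ
  set M := fun u => MM 0 0 0 1 n (θ 0) (θ 1) (θ 2) u with hMdef
  have hg := integrable_exp_neg_mul_sq hb
  have hprod := hg.mul_prod hM
  have hF : Integrable (Function.uncurry fun x u => Real.exp (-b * x ^ 2) *
      (Real.cos (u * x) * M u)) (volume.prod (volume.restrict (Ioi 0))) := by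
    have hc : Continuous fun z : ℝ × ℝ => Real.cos (z.2 * z.1) := by fun_prop
    have := hprod.bdd_mul (c := 1) hc.aestronglyMeasurable
      (Eventually.of_forall fun u => Real.abs_cos_le_one _)
    refine this.congr (ae_of_all _ fun z => ?_)
    simp only [Function.uncurry]; ring
  have hsw := integral_integral_swap hF
  have e1 : ∫ x, QQ n x θ * Real.exp (-b * x ^ 2) = Real.pi⁻¹ * ∫ x, ∫ u in Ioi (0 : ℝ),
      Real.exp (-b * x ^ 2) * (Real.cos (u * x) * M u) := by
    rw [← integral_const_mul]
    congr 1; funext x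
    rw [integral_const_mul, QQ_eq, JJ]; ring
  have e2 : ∀ u, ∫ x, Real.exp (-b * x ^ 2) * (Real.cos (u * x) * M u) =
      M u * (Real.sqrt (Real.pi / b) * Real.exp (-u ^ 2 / (4 * b))) := by
    intro u
    rw [← integral_cos_gauss hb u, ← integral_const_mul]
    congr 1; funext x; ring
  rw [e1, hsw]
  simp only [e2]
  have hgi : IntegrableOn (fun u : ℝ => Real.sqrt (Real.pi / b) * Real.exp (-u ^ 2 / (4 * b))) (Ioi 0) := by
    have := (integrable_exp_neg_mul_sq (b := 1 / (4 * b)) (by positivity)).const_mul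
      (Real.sqrt (Real.pi / b))
    refine (this.congr (ae_of_all _ fun x => ?_)).integrableOn
    beta_reduce
    congr 2; ring
  have hle : ∫ u in Ioi (0 : ℝ), M u * (Real.sqrt (Real.pi / b) * Real.exp (-u ^ 2 / (4 * b))) ≤
      ∫ u in Ioi (0 : ℝ), Real.sqrt (Real.pi / b) * Real.exp (-u ^ 2 / (4 * b)) := by
    refine integral_mono_of_nonneg (ae_of_all _ fun u => ?_) hgi (ae_of_all _ fun u => ?_)
    · simp only [hMdef, MM, Pi.zero_apply, pow_zero, mul_zero, one_mul]; positivity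
    · have h1 : M u ≤ 1 := by
        simp only [hMdef, MM, pow_zero, mul_zero, one_mul]
        refine Real.exp_le_one_iff.2 ?_
        have := LL_nonneg n (θ 1) (θ 2) u
        have : 0 ≤ θ 0 ^ 2 * u ^ 2 := by positivity
        linarith
      exact mul_le_of_le_one_left (by positivity) h1
  have hval : ∫ u in Ioi (0 : ℝ), Real.sqrt (Real.pi / b) * Real.exp (-u ^ 2 / (4 * b)) = Real.pi := by
    have h := integral_gaussian_Ioi (1 / (4 * b))
    rw [integral_const_mul]
    have e : (fun u : ℝ => Real.exp (-u ^ 2 / (4 * b))) = fun u => Real.exp (-(1 / (4 * b)) * u ^ 2) := by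
      funext u; congr 1; ring
    rw [e, h, mul_div_assoc', ← Real.sqrt_mul (by positivity),
      show Real.pi / b * (Real.pi / (1 / (4 * b))) = (2 * Real.pi) ^ 2 by field_simp; ring,
      Real.sqrt_sq (by positivity)]
    ring
  calc _ ≤ Real.pi⁻¹ * Real.pi := by rw [hval] at hle; gcongr
    _ = 1 := inv_mul_cancel₀ Real.pi_ne_zero

lemma QQ_le_one (P : Ctx) {n : ℕ} (hn : 1 ≤ n) {θ : Fin 3 → ℝ} (hθ : P.V θ) :
    ∫ x, QQ n x θ ≤ 1 := by
  have hq := QQ_int P hn hθ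
  have ht : Tendsto (fun k : ℕ => ∫ x, QQ n x θ * Real.exp (-(1 / ((k : ℝ) + 1)) * x ^ 2)) atTop
      (𝓝 (∫ x, QQ n x θ)) := by
    refine tendsto_integral_of_dominated_convergence (fun x => ‖QQ n x θ‖)
      (fun k => ?_) hq.norm (fun k => ae_of_all _ fun x => ?_) (ae_of_all _ fun x => ?_)
    · exact ((QQ_cont P hn hθ).mul (by fun_prop)).aestronglyMeasurable
    · rw [norm_mul, Real.norm_of_nonneg (Real.exp_nonneg _)]
      refine mul_le_of_le_one_right (norm_nonneg _) (Real.exp_le_one_iff.2 ?_)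
      have : 0 ≤ (1 / ((k : ℝ) + 1)) * x ^ 2 := by positivity
      linarith
    · have h1 := tendsto_one_div_add_atTop_nhds_zero_nat (𝕜 := ℝ)
      have h2 : Tendsto (fun k : ℕ => QQ n x θ * Real.exp (-(1 / ((k : ℝ) + 1)) * x ^ 2)) atTop
          (𝓝 (QQ n x θ * Real.exp (-0 * x ^ 2))) :=
        ((Real.continuous_exp.tendsto _).comp (h1.neg.mul_const _)).const_mul _
      simpa using h2
  exact le_of_tendsto' ht fun k => QQ_reg P hn hθ (by positivity)

/-- The tail part of the density. -/
def qt (P : Ctx) (n : ℕ) (x : ℝ) : ℝ := {x : ℝ | (n : ℝ) ^ P.K < |x|}.indicator (fun x => |QQ n x P.th|) x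

lemma qt_nonneg (P : Ctx) (n : ℕ) (x : ℝ) : 0 ≤ qt P n x :=
  indicator_nonneg (fun _ _ => abs_nonneg _) x

lemma th0 (P : Ctx) : P.th 0 = P.s0 := by simp [Ctx.th]

lemma qt_tail (P : Ctx) : ∃ C > 0, ∀ n : ℕ, 1 ≤ n → Integrable (qt P n) ∧
    ∫ x, qt P n x ≤ C * (n : ℝ) ^ (-2 : ℝ) := by
  obtain ⟨C, hC, H⟩ := QQ_bound P
  obtain ⟨D, hD, H2⟩ := Eg_tail P 0 P.K_pos
  have hs := P.hs; have ha := P.ha; have hτ := P.hτ; have hb := P.β_pos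
  have hb2 : P.a0 / 2 ≤ P.β := by have := P.hτ1; unfold Ctx.β; linarith
  set I := ∫ x : ℝ, (1 + |x|) ^ (-(1 + P.β / 2)) with hI
  have hI0 : 0 ≤ I := integral_nonneg fun x => by positivity
  have hbi := brk_int (r := P.β / 2) (by positivity)
  refine ⟨C * (D + 1) * (I + 1), by positivity, fun n hn => ?_⟩
  have hn1 : (1 : ℝ) ≤ n := by exact_mod_cast hn
  have hn0 : (0 : ℝ) < n := by linarith
  have hset : MeasurableSet {x : ℝ | (n : ℝ) ^ P.K < |x|} :=
    measurableSet_lt measurable_const measurable_norm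
  have hIntg : Integrable (qt P n) := ((QQ_int P hn P.th_V).abs).indicator hset
  refine ⟨hIntg, ?_⟩
  have hpt : ∀ x, qt P n x ≤ C * (D + 1) * (n : ℝ) ^ (-2 : ℝ) * (1 + |x|) ^ (-(1 + P.β / 2)) := by
    intro x
    unfold qt indicator
    split_ifs with hx
    · have hx' : (n : ℝ) ^ P.K < |x| := hx
      have h1 := H n hn x P.th P.th_V
      rw [th0] at h1
      have h2 := H2 n hn x P.s0 hs (by linarith) hx'.le
      rw [pow_zero, one_mul] at h2
      have h3 : NN P n x P.s0 ≤ (D + 1) * ZZ P n x := by unfold NN; linarith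
      have hp : (0 : ℝ) < 1 + |x| := by positivity
      have h4 : ZZ P n x ≤ (n : ℝ) ^ (-3 : ℝ) * (1 + |x|) ^ (-(1 + P.β / 2)) := by
        have s : (1 + |x|) ^ (-(1 + P.β)) = (1 + |x|) ^ (-(P.β / 2)) * (1 + |x|) ^ (-(1 + P.β / 2)) := by
          rw [← Real.rpow_add hp]; congr 1; ring
        have s1 : (n : ℝ) ^ (P.a0 / 2 - 1) ≤ 1 :=
          Real.rpow_le_one_of_one_le_of_nonpos hn1 (by have := P.ha2; linarith)
        have s2 : (1 + |x|) ^ (-(P.β / 2)) ≤ (n : ℝ) ^ (-3 : ℝ) := by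
          calc (1 + |x|) ^ (-(P.β / 2)) ≤ ((n : ℝ) ^ P.K) ^ (-(P.β / 2)) :=
                Real.rpow_le_rpow_of_nonpos (by positivity) (by linarith) (by linarith)
            _ = (n : ℝ) ^ (-(P.K * P.β / 2)) := by
                rw [← Real.rpow_mul hn0.le]; congr 1; ring
            _ ≤ _ := by
                refine Real.rpow_le_rpow_of_exponent_le hn1 ?_
                have : P.K * (P.a0 / 2) ≤ P.K * P.β := mul_le_mul_of_nonneg_left hb2 P.K_pos.le
                have e : P.K * (P.a0 / 2) = 6 := by rw [P.hK]; field_simp; norm_num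
                linarith
        unfold ZZ
        rw [s, ← mul_assoc]
        have : 0 < (1 + |x|) ^ (-(P.β / 2)) := by positivity
        gcongr
        calc _ ≤ 1 * (n : ℝ) ^ (-3 : ℝ) := by gcongr
          _ = _ := one_mul _
      have h5 : (n : ℝ) ^ (2 * P.τ) * (n : ℝ) ^ (-3 : ℝ) ≤ (n : ℝ) ^ (-2 : ℝ) := by
        rw [← Real.rpow_add hn0]
        exact Real.rpow_le_rpow_of_exponent_le hn1 (by have := P.τ_lt1; linarith)
      calc _ ≤ _ := h1
        _ ≤ C * ((n : ℝ) ^ (2 * P.τ) * ((D + 1) * ((n : ℝ) ^ (-3 : ℝ) * (1 + |x|) ^ (-(1 + P.β / 2))))) := by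
          gcongr; exact h3.trans (by gcongr)
        _ = C * (D + 1) * ((n : ℝ) ^ (2 * P.τ) * (n : ℝ) ^ (-3 : ℝ)) * (1 + |x|) ^ (-(1 + P.β / 2)) := by ring
        _ ≤ _ := by gcongr
    · positivity
  calc _ ≤ ∫ x, C * (D + 1) * (n : ℝ) ^ (-2 : ℝ) * (1 + |x|) ^ (-(1 + P.β / 2)) :=
        integral_mono hIntg (hbi.const_mul _) hpt
    _ = C * (D + 1) * (n : ℝ) ^ (-2 : ℝ) * I := by rw [integral_const_mul]
    _ ≤ C * (D + 1) * (n : ℝ) ^ (-2 : ℝ) * (I + 1) := by gcongr; linarith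
    _ = _ := by ring

lemma pos_part_int (P : Ctx) : ∃ C > 0, ∃ N : ℕ, 1 ≤ N ∧ ∀ n : ℕ, N ≤ n →
    Integrable (fun x => max (QQ n x P.th) 0) ∧
    ∫ x, max (QQ n x P.th) 0 ≤ 1 + C * (n : ℝ) ^ (-2 : ℝ) := by
  obtain ⟨C, hC, H⟩ := qt_tail P
  obtain ⟨D⟩ := exists_QD P
  refine ⟨C, hC, D.N, D.hN, fun n hn => ?_⟩
  have hn' := D.hN.trans hn
  have hq := QQ_int P hn' P.th_V
  obtain ⟨h1, h2⟩ := H n hn'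
  refine ⟨hq.pos_part, ?_⟩
  calc _ ≤ ∫ x, (QQ n x P.th + qt P n x) := by
        refine integral_mono hq.pos_part (by exact hq.add h1) fun x => ?_
        by_cases hx : |x| ≤ (n : ℝ) ^ P.K
        · have := D.Q_pos hn P.th_V hx
          have h0 := qt_nonneg P n x
          exact max_le (by linarith) (by linarith)
        · have : qt P n x = |QQ n x P.th| := indicator_of_mem (s := {x : ℝ | (n : ℝ) ^ P.K < |x|})
            (by simpa using hx) _
          simp only [this]
          refine max_le (by linarith [abs_nonneg (QQ n x P.th)]) ?_
          linarith [neg_abs_le (QQ n x P.th)]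
    _ = (∫ x, QQ n x P.th) + ∫ x, qt P n x := integral_add hq h1
    _ ≤ _ := add_le_add (QQ_le_one P hn' P.th_V) h2



/-! ### Union bound and Markov inequality for the product measure -/

lemma pi_bound (n : ℕ) (μ : Measure ℝ) [IsFiniteMeasure μ] {E : Set ℝ} (hE : MeasurableSet E)
    {T : ℝ → ENNReal} (hT : Measurable T) {ε : ENNReal} (h0 : ε ≠ 0) (hi : ε ≠ ⊤) :
    (Measure.pi fun _ : Fin n => μ) {x | (∃ i, x i ∈ E) ∨ ε ≤ ∑ i, T (x i)} ≤
      n * (μ univ) ^ (n - 1) * (μ E + (∫⁻ y, T y ∂μ) / ε) := by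
  have hmap : ∀ i : Fin n, (Measure.pi fun _ : Fin n => μ).map (Function.eval i) =
      (μ univ) ^ (n - 1) • μ := by
    intro i
    rw [Measure.pi_map_eval]
    simp
  have h1 : (Measure.pi fun _ : Fin n => μ) {x | ∃ i, x i ∈ E} ≤ n * ((μ univ) ^ (n - 1) * μ E) := by
    have : {x : Fin n → ℝ | ∃ i, x i ∈ E} = ⋃ i, (Function.eval i) ⁻¹' E := by
      ext x; simp
    rw [this]
    calc _ ≤ ∑ i : Fin n, (Measure.pi fun _ : Fin n => μ) ((Function.eval i) ⁻¹' E) :=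
          measure_iUnion_fintype_le _ _
      _ = ∑ i : Fin n, (μ univ) ^ (n - 1) * μ E := by
          refine Finset.sum_congr rfl fun i _ => ?_
          rw [← Measure.map_apply (measurable_pi_apply i) hE, hmap]; simp
      _ = _ := by simp
  have h2 : (Measure.pi fun _ : Fin n => μ) {x | ε ≤ ∑ i, T (x i)} ≤
      n * ((μ univ) ^ (n - 1) * (∫⁻ y, T y ∂μ)) / ε := by
    have hm : Measurable fun x : Fin n → ℝ => ∑ i, T (x i) := by fun_prop
    refine (meas_ge_le_lintegral_div hm.aemeasurable h0 hi).trans ?_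
    gcongr
    have hsum : ∫⁻ x : Fin n → ℝ, ∑ i, T (x i) ∂(Measure.pi fun _ : Fin n => μ) =
        ∑ i, ∫⁻ x : Fin n → ℝ, T (x i) ∂(Measure.pi fun _ : Fin n => μ) :=
      lintegral_finsetSum _ (fun i _ => hT.comp (measurable_pi_apply i))
    rw [hsum]
    calc _ = ∑ i : Fin n, (μ univ) ^ (n - 1) * ∫⁻ y, T y ∂μ := by
          refine Finset.sum_congr rfl fun i _ => ?_
          have := lintegral_map (μ := Measure.pi fun _ : Fin n => μ) hT (measurable_pi_apply i)
          have h3 : ∫⁻ y, T y ∂((Measure.pi fun _ : Fin n => μ).map (Function.eval i)) =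
              ∫⁻ x, T (x i) ∂(Measure.pi fun _ : Fin n => μ) := this
          rw [← h3, hmap, lintegral_smul_measure]; rfl
      _ ≤ _ := by simp
  calc _ ≤ (Measure.pi fun _ : Fin n => μ) ({x | ∃ i, x i ∈ E} ∪ {x | ε ≤ ∑ i, T (x i)}) :=
        measure_mono fun x hx => hx
    _ ≤ _ := measure_union_le _ _
    _ ≤ _ := add_le_add h1 h2
    _ = _ := by rw [mul_add, ENNReal.div_eq_inv_mul, ENNReal.div_eq_inv_mul]; ring

/-! ### The single observation law -/

def mu (P : Ctx) (n : ℕ) : Measure ℝ :=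
  volume.withDensity fun y => ENNReal.ofReal (pdens n P.th y)

lemma scale_lint {n : ℕ} (hn : 1 ≤ n) {G : ℝ → ℝ} (hG : Integrable G) (h0 : ∀ x, 0 ≤ G x) :
    ∫⁻ y, ENNReal.ofReal (Real.sqrt n * G (Real.sqrt n * y)) = ENNReal.ofReal (∫ x, G x) := by
  have hn0 : (0 : ℝ) < n := by exact_mod_cast hn
  have hs : 0 < Real.sqrt n := Real.sqrt_pos.2 hn0
  have hi := (hG.comp_mul_left' hs.ne').const_mul (Real.sqrt n)
  rw [← ofReal_integral_eq_lintegral_ofReal hi (ae_of_all _ fun x => mul_nonneg hs.le (h0 _)),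
    integral_const_mul, Measure.integral_comp_mul_left, abs_of_pos (by positivity), smul_eq_mul,
    ← mul_assoc, mul_inv_cancel₀ hs.ne', one_mul]

lemma th_pdens (P : Ctx) {n : ℕ} (hn : 1 ≤ n) (y : ℝ) :
    pdens n P.th y = Real.sqrt n * QQ n (Real.sqrt n * y) P.th :=
  pdens_eq hn P.th_V.pos.1 P.th_V.pos.2.1 P.th_V.pos.2.2.1 y

lemma mu_lint_le (P : Ctx) {n : ℕ} (hn : 1 ≤ n) {f : ℝ → ENNReal} (hf : Measurable f) {G : ℝ → ℝ}
    (hG : Integrable G) (h0 : ∀ x, 0 ≤ G x)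
    (h : ∀ y, f y * ENNReal.ofReal (QQ n (Real.sqrt n * y) P.th) ≤
      ENNReal.ofReal (G (Real.sqrt n * y))) :
    ∫⁻ y, f y ∂(mu P n) ≤ ENNReal.ofReal (∫ x, G x) := by
  have hm : Measurable fun y => ENNReal.ofReal (pdens n P.th y) := by
    simp only [th_pdens P hn]
    have := (QQ_cont P hn P.th_V).measurable
    exact ENNReal.measurable_ofReal.comp ((this.comp (measurable_const_mul _)).const_mul _)
  rw [mu, lintegral_withDensity_eq_lintegral_mul _ hm hf, ← scale_lint hn hG h0]
  refine lintegral_mono fun y => ?_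
  simp only [Pi.mul_apply, th_pdens P hn]
  rw [ENNReal.ofReal_mul (Real.sqrt_nonneg _), ENNReal.ofReal_mul (Real.sqrt_nonneg _),
    mul_assoc, mul_comm _ (f y)]
  gcongr
  exact h y

lemma mu_univ (P : Ctx) : ∃ C > 0, ∃ N : ℕ, 1 ≤ N ∧ ∀ n : ℕ, N ≤ n →
    mu P n univ ≤ ENNReal.ofReal (1 + C * (n : ℝ) ^ (-2 : ℝ)) := by
  obtain ⟨C, hC, N, hN, H⟩ := pos_part_int P
  refine ⟨C, hC, N, hN, fun n hn => ?_⟩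
  obtain ⟨h1, h2⟩ := H n hn
  have := mu_lint_le P (hN.trans hn) (f := fun _ => 1) measurable_const h1 (fun x => le_max_right _ _)
    (fun y => by
      rw [one_mul]; exact ENNReal.ofReal_le_ofReal (le_max_left _ _))
  rw [lintegral_one] at this
  exact this.trans (ENNReal.ofReal_le_ofReal h2)

lemma mu_pow (P : Ctx) : ∃ C > 0, ∃ N : ℕ, 1 ≤ N ∧ ∀ n : ℕ, N ≤ n →
    IsFiniteMeasure (mu P n) ∧ mu P n univ ^ (n - 1) ≤ ENNReal.ofReal C := by
  obtain ⟨C, hC, N, hN, H⟩ := mu_univ P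
  refine ⟨Real.exp C, by positivity, N, hN, fun n hn => ?_⟩
  have h := H n hn
  have hn1 : (1 : ℝ) ≤ n := by exact_mod_cast hN.trans hn
  have hn0 : (0 : ℝ) < n := by linarith
  refine ⟨⟨h.trans_lt ENNReal.ofReal_lt_top⟩, ?_⟩
  calc _ ≤ ENNReal.ofReal (1 + C * (n : ℝ) ^ (-2 : ℝ)) ^ (n - 1) := by gcongr
    _ = ENNReal.ofReal ((1 + C * (n : ℝ) ^ (-2 : ℝ)) ^ (n - 1)) := by
        rw [ENNReal.ofReal_pow (by positivity)]
    _ ≤ _ := by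
      refine ENNReal.ofReal_le_ofReal ?_
      have e1 : 1 + C * (n : ℝ) ^ (-2 : ℝ) ≤ Real.exp (C * (n : ℝ) ^ (-2 : ℝ)) := by
        linarith [Real.add_one_le_exp (C * (n : ℝ) ^ (-2 : ℝ))]
      calc _ ≤ Real.exp (C * (n : ℝ) ^ (-2 : ℝ)) ^ (n - 1) := by gcongr
        _ ≤ Real.exp (C * (n : ℝ) ^ (-2 : ℝ)) ^ n :=
            pow_le_pow_right₀ (Real.one_le_exp (by positivity)) (by omega)
        _ = Real.exp (C * (n * (n : ℝ) ^ (-2 : ℝ))) := by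
            rw [← Real.exp_nat_mul]; congr 1; ring
        _ ≤ Real.exp (C * 1) := by
            gcongr
            have : (n : ℝ) * (n : ℝ) ^ (-2 : ℝ) = (n : ℝ) ^ (-1 : ℝ) := by
              nth_rewrite 1 [← Real.rpow_one (n : ℝ)]
              rw [← Real.rpow_add hn0]; norm_num
            rw [this]
            exact Real.rpow_le_one_of_one_le_of_nonpos hn1 (by norm_num)
        _ = _ := by rw [mul_one]

lemma mu_tail (P : Ctx) : ∃ C > 0, ∀ n : ℕ, 1 ≤ n →
    mu P n {y | (n : ℝ) ^ P.K < |Real.sqrt n * y|} ≤ ENNReal.ofReal (C * (n : ℝ) ^ (-2 : ℝ)) := by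
  obtain ⟨C, hC, H⟩ := qt_tail P
  refine ⟨C, hC, fun n hn => ?_⟩
  obtain ⟨h1, h2⟩ := H n hn
  have hset : MeasurableSet {y : ℝ | (n : ℝ) ^ P.K < |Real.sqrt n * y|} :=
    measurableSet_lt measurable_const (by fun_prop)
  rw [← lintegral_indicator_one hset]
  refine (mu_lint_le P hn ((measurable_one : Measurable (1 : ℝ → ENNReal)).indicator hset) h1 (qt_nonneg P n)
    (fun y => ?_)).trans (ENNReal.ofReal_le_ofReal h2)
  by_cases hy : (n : ℝ) ^ P.K < |Real.sqrt n * y|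
  · rw [indicator_of_mem (by exact hy), Pi.one_apply, one_mul, qt, indicator_of_mem (by exact hy)]
    exact ENNReal.ofReal_le_ofReal (le_abs_self _)
  · rw [indicator_of_notMem (by exact hy), zero_mul]
    exact zero_le

/-! ### The majorant -/

def Tn (P : Ctx) (n : ℕ) (x : ℝ) : ℝ :=
  mm P n ^ 3 * (((n : ℝ) ^ (-(1 / 2) : ℝ)) ^ 3 + ((n : ℝ) ^ (-P.a0 / 4 + P.τ)) ^ 3 * zz P n x P.s0)

lemma Tn_nonneg (P : Ctx) {n : ℕ} (hn : 1 ≤ n) (x : ℝ) : 0 ≤ Tn P n x := by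
  have := zz_pos P hn x P.s0
  have := mm_ge P hn
  unfold Tn; positivity

lemma Tn_meas (P : Ctx) (n : ℕ) : Measurable (Tn P n) := by
  unfold Tn zz NN ZZ Eg; fun_prop

set_option maxHeartbeats 1000000 in
lemma mu_Tn (P : Ctx) : ∃ C > 0, ∀ n : ℕ, 1 ≤ n →
    ∫⁻ y, ENNReal.ofReal (Tn P n (Real.sqrt n * y)) ∂(mu P n) ≤
      ENNReal.ofReal (C * ((n : ℝ) ^ (-1 : ℝ) * (n : ℝ) ^ (-P.a0 / 4 + (9 * P.K + 20) * P.τ))) := by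
  obtain ⟨C, hC, H⟩ := QQ_bound P
  have hs := P.hs; have hτ := P.hτ; have hK := P.K_pos
  set I := ∫ x : ℝ, (1 + |x|) ^ (-(1 + P.β)) with hI
  have hI0 : 0 ≤ I := integral_nonneg fun x => by positivity
  set J := ∫ x : ℝ, Eg x P.s0 with hJ
  have hJ0 : 0 ≤ J := integral_nonneg fun x => (Eg_pos x P.s0).le
  refine ⟨C * (J + 2 * I + 1), by positivity, fun n hn => ?_⟩
  have hn1 : (1 : ℝ) ≤ n := by exact_mod_cast hn
  have hn0 : (0 : ℝ) < n := by linarith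
  set ρ0 := ((n : ℝ) ^ (-(1 / 2) : ℝ)) ^ 3 with hρ0
  set ρ1 := ((n : ℝ) ^ (-P.a0 / 4 + P.τ)) ^ 3 with hρ1
  have p0 : 0 < ρ0 := by positivity
  have p1 : 0 < ρ1 := by positivity
  have hm := mm_ge P hn
  set A := C * (n : ℝ) ^ (2 * P.τ) * mm P n ^ 3 with hA
  have hA0 : 0 ≤ A := by positivity
  set G : ℝ → ℝ := fun x => A * (ρ0 * NN P n x P.s0 + ρ1 * ZZ P n x) with hG
  have hGi : Integrable G := by
    exact (((NN_int P n hs).const_mul ρ0).add ((ZZ_int P n).const_mul ρ1)).const_mul A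
  have hG0 : ∀ x, 0 ≤ G x := fun x => by
    have := NN_pos P hn x P.s0; have := ZZ_pos P hn x
    simp only [hG]; positivity
  refine (mu_lint_le P hn (G := G) ?_ hGi hG0 fun y => ?_).trans (ENNReal.ofReal_le_ofReal ?_)
  · exact ENNReal.measurable_ofReal.comp ((Tn_meas P n).comp (measurable_const_mul _))
  · generalize Real.sqrt n * y = x
    rw [← ENNReal.ofReal_mul (Tn_nonneg P hn x)]
    refine ENNReal.ofReal_le_ofReal ?_
    have h1 := (le_abs_self _).trans (H n hn x P.th P.th_V)
    rw [th0] at h1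
    have hN := NN_pos P hn x P.s0
    calc _ ≤ Tn P n x * (C * ((n : ℝ) ^ (2 * P.τ) * NN P n x P.s0)) :=
          mul_le_mul_of_nonneg_left h1 (Tn_nonneg P hn x)
      _ = G x := by
          simp only [hG, Tn, zz, hA, ← hρ0, ← hρ1]
          field_simp
  · have e1 : ∫ x, G x = A * (ρ0 * (J + (n : ℝ) ^ (P.a0 / 2 - 1) * I) +
        ρ1 * ((n : ℝ) ^ (P.a0 / 2 - 1) * I)) := by
      have eZ : ∫ x, ZZ P n x = (n : ℝ) ^ (P.a0 / 2 - 1) * I := by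
        simp only [ZZ]; rw [integral_const_mul]
      have eN : ∫ x, NN P n x P.s0 = J + (n : ℝ) ^ (P.a0 / 2 - 1) * I := by
        simp only [NN]; rw [integral_add (Eg_int hs) (ZZ_int P n), eZ]
      simp only [hG]
      rw [integral_const_mul, integral_add ((NN_int P n hs).const_mul ρ0)
        ((ZZ_int P n).const_mul ρ1), integral_const_mul, integral_const_mul, eN, eZ]
    rw [e1]
    have l1 : (n : ℝ) ^ (P.a0 / 2 - 1) ≤ 1 :=
      Real.rpow_le_one_of_one_le_of_nonpos hn1 (by have := P.ha2; linarith)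
    set R := (n : ℝ) ^ (-1 : ℝ) * (n : ℝ) ^ (-P.a0 / 4 + (9 * P.K + 20) * P.τ) with hR
    have hR0 : 0 < R := by positivity
    have hm3 : mm P n ^ 3 = (n : ℝ) ^ (3 * ((3 * P.K + 3) * P.τ)) := by
      rw [mm, ← Real.rpow_natCast, ← Real.rpow_mul hn0.le]; congr 1; push_cast; ring
    have k0 : (n : ℝ) ^ (2 * P.τ) * mm P n ^ 3 * ρ0 ≤ R := by
      rw [hm3, hρ0, hR, ← Real.rpow_natCast, ← Real.rpow_mul hn0.le, ← Real.rpow_add hn0,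
        ← Real.rpow_add hn0, ← Real.rpow_add hn0]
      refine Real.rpow_le_rpow_of_exponent_le hn1 ?_
      have := P.ha2; push_cast; nlinarith
    have k1 : (n : ℝ) ^ (2 * P.τ) * mm P n ^ 3 * (ρ1 * (n : ℝ) ^ (P.a0 / 2 - 1)) ≤ R := by
      rw [hm3, hρ1, hR, ← Real.rpow_natCast, ← Real.rpow_mul hn0.le, ← Real.rpow_add hn0,
        ← Real.rpow_add hn0, ← Real.rpow_add hn0, ← Real.rpow_add hn0]
      refine Real.rpow_le_rpow_of_exponent_le hn1 ?_
      push_cast; nlinarith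
    calc _ = C * (((n : ℝ) ^ (2 * P.τ) * mm P n ^ 3 * ρ0) * (J + (n : ℝ) ^ (P.a0 / 2 - 1) * I) +
          ((n : ℝ) ^ (2 * P.τ) * mm P n ^ 3 * (ρ1 * (n : ℝ) ^ (P.a0 / 2 - 1))) * I) := by
          rw [hA]; ring
      _ ≤ C * (R * (J + 1 * I) + R * I) := by gcongr
      _ ≤ _ := by nlinarith

lemma prob_small (P : Ctx) {ε : ℝ} (hε : 0 < ε) :
    Tendsto (fun n : ℕ => (Pn n P.th) {x | (∃ i, (n : ℝ) ^ P.K < |Real.sqrt n * x i|) ∨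
      ε ≤ ∑ i, Tn P n (Real.sqrt n * x i)}) atTop (𝓝 0) := by
  obtain ⟨A, hA, N, hN, HA⟩ := mu_pow P
  obtain ⟨B, hB, HB⟩ := mu_tail P
  obtain ⟨D, hD, HD⟩ := mu_Tn P
  have key : ∀ n : ℕ, N ≤ n → (Pn n P.th) {x | (∃ i, (n : ℝ) ^ P.K < |Real.sqrt n * x i|) ∨
      ε ≤ ∑ i, Tn P n (Real.sqrt n * x i)} ≤
      ENNReal.ofReal (A * (B * (n : ℝ) ^ (-1 : ℝ) +
        D * (n : ℝ) ^ (-P.a0 / 4 + (9 * P.K + 20) * P.τ) / ε)) := by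
    intro n hn
    have hn' := hN.trans hn
    have hn1 : (1 : ℝ) ≤ n := by exact_mod_cast hn'
    have hn0 : (0 : ℝ) < n := by linarith
    obtain ⟨hfin, hpow⟩ := HA n hn
    have hset : MeasurableSet {y : ℝ | (n : ℝ) ^ P.K < |Real.sqrt n * y|} :=
      measurableSet_lt measurable_const (by fun_prop)
    have hTm : Measurable fun y => ENNReal.ofReal (Tn P n (Real.sqrt n * y)) :=
      ENNReal.measurable_ofReal.comp ((Tn_meas P n).comp (measurable_const_mul _))
    have h := pi_bound n (mu P n) hset hTm (ε := ENNReal.ofReal ε)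
      (by simpa using hε) ENNReal.ofReal_ne_top
    have hsub : {x : Fin n → ℝ | (∃ i, (n : ℝ) ^ P.K < |Real.sqrt n * x i|) ∨
        ε ≤ ∑ i, Tn P n (Real.sqrt n * x i)} ⊆
        {x | (∃ i, x i ∈ {y : ℝ | (n : ℝ) ^ P.K < |Real.sqrt n * y|}) ∨
          ENNReal.ofReal ε ≤ ∑ i, ENNReal.ofReal (Tn P n (Real.sqrt n * x i))} := by
      rintro x (hx | hx)
      · exact Or.inl hx
      · refine Or.inr ?_
        rw [← ENNReal.ofReal_sum_of_nonneg fun i _ => Tn_nonneg P hn' _]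
        exact ENNReal.ofReal_le_ofReal hx
    refine (measure_mono hsub).trans (h.trans ?_)
    calc _ ≤ ENNReal.ofReal n * ENNReal.ofReal A * (ENNReal.ofReal (B * (n : ℝ) ^ (-2 : ℝ)) +
          ENNReal.ofReal (D * ((n : ℝ) ^ (-1 : ℝ) * (n : ℝ) ^ (-P.a0 / 4 + (9 * P.K + 20) * P.τ))) /
            ENNReal.ofReal ε) := by
          rw [ENNReal.ofReal_natCast]
          gcongr
          · exact HB n hn'
          · exact HD n hn'
      _ = ENNReal.ofReal (n * A * (B * (n : ℝ) ^ (-2 : ℝ) +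
          D * ((n : ℝ) ^ (-1 : ℝ) * (n : ℝ) ^ (-P.a0 / 4 + (9 * P.K + 20) * P.τ)) / ε)) := by
          rw [← ENNReal.ofReal_div_of_pos hε, ← ENNReal.ofReal_add (by positivity) (by positivity),
            ← ENNReal.ofReal_mul (by positivity), ← ENNReal.ofReal_mul (by positivity)]
      _ = _ := by
          congr 1
          have e1 : (n : ℝ) ^ (-1 : ℝ) = (n : ℝ)⁻¹ := Real.rpow_neg_one _
          have e2 : (n : ℝ) ^ (-2 : ℝ) = (n : ℝ)⁻¹ * (n : ℝ)⁻¹ := by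
            rw [← Real.rpow_neg_one, ← Real.rpow_add hn0]; norm_num
          rw [e1, e2]
          generalize (n : ℝ) ^ (-P.a0 / 4 + (9 * P.K + 20) * P.τ) = X
          field_simp
  have hlim : Tendsto (fun n : ℕ => ENNReal.ofReal (A * (B * (n : ℝ) ^ (-1 : ℝ) +
        D * (n : ℝ) ^ (-P.a0 / 4 + (9 * P.K + 20) * P.τ) / ε))) atTop (𝓝 0) := by
    have h1 := (tendsto_rpow_neg_nat (e := -1) (by norm_num)).const_mul B
    have h2 := ((tendsto_rpow_neg_nat P.hτ3).const_mul D).div_const ε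
    have h3 := (h1.add h2).const_mul A
    have h4 := ENNReal.tendsto_ofReal h3
    simpa using h4
  refine tendsto_of_tendsto_of_tendsto_of_le_of_le' tendsto_const_nhds hlim
    (Eventually.of_forall fun _ => zero_le) ?_
  filter_upwards [eventually_ge_atTop N] with n hn using key n hn



/-! ### The Hessian of the log-likelihood -/

lemma V_nhds {P : Ctx} {θ : Fin 3 → ℝ} (h : P.V θ) (j : Fin 3) :
    ∀ᶠ t in 𝓝 (θ j), P.V (Function.update θ j t) := by
  rcases fin3_cases j with rfl | rfl | rfl
  · filter_upwards [U_nhds_s h] with t ht; simpa [Ctx.V] using ht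
  · filter_upwards [U_nhds_d h] with t ht; simpa [Ctx.V] using ht
  · filter_upwards [U_nhds_a h] with t ht; simpa [Ctx.V] using ht

lemma grad_eq {P : Ctx} (D : QD P) {n : ℕ} (hn : D.N ≤ n) {x : Fin n → ℝ}
    (hx : ∀ k, |Real.sqrt n * x k| ≤ (n : ℝ) ^ P.K) {θ : Fin 3 → ℝ} (hθ : P.V θ) (j : Fin 3) :
    pderiv j (fun θ' => logLik n θ' x) θ =
      ∑ k, D.q1 j n (Real.sqrt n * x k) θ / QQ n (Real.sqrt n * x k) θ := by
  have hn' : 1 ≤ n := D.hN.trans hn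
  have hn0 : (0 : ℝ) < n := by exact_mod_cast hn'
  have hs : 0 < Real.sqrt n := Real.sqrt_pos.2 hn0
  have he : (fun t => logLik n (Function.update θ j t) x) =ᶠ[𝓝 (θ j)]
      fun t => ∑ k, Real.log (Real.sqrt n * QQ n (Real.sqrt n * x k) (Function.update θ j t)) := by
    filter_upwards [V_nhds hθ j] with t ht
    refine Finset.sum_congr rfl fun k _ => ?_
    obtain ⟨h0, h1, h2, -⟩ := Ctx.U.pos ht
    rw [pdens_eq hn' h0 h1 h2]
  rw [pderiv, he.deriv_eq]
  refine HasDerivAt.deriv ?_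
  refine HasDerivAt.fun_sum fun k _ => ?_
  have hQ := D.Q_pos hn hθ (hx k)
  have hd := (D.d1 j n hn' (Real.sqrt n * x k) θ hθ).const_mul (Real.sqrt n)
  refine (hd.log ?_).congr_deriv ?_
  · rw [Function.update_eq_self]; positivity
  · rw [Function.update_eq_self, mul_div_mul_left _ _ hs.ne']

lemma hess_eq {P : Ctx} (D : QD P) {n : ℕ} (hn : D.N ≤ n) {x : Fin n → ℝ}
    (hx : ∀ k, |Real.sqrt n * x k| ≤ (n : ℝ) ^ P.K) {θ : Fin 3 → ℝ} (hθ : P.V θ) (i j : Fin 3) :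
    hessMat n θ x i j = ∑ k, D.A i j n (Real.sqrt n * x k) θ := by
  have hn' : 1 ≤ n := D.hN.trans hn
  have he : (fun t => pderiv j (fun θ'' => logLik n θ'' x) (Function.update θ i t)) =ᶠ[𝓝 (θ i)]
      fun t => ∑ k, D.q1 j n (Real.sqrt n * x k) (Function.update θ i t) /
        QQ n (Real.sqrt n * x k) (Function.update θ i t) := by
    filter_upwards [V_nhds hθ i] with t ht
    exact grad_eq D hn hx ht j
  have h0 : hessMat n θ x i j =
      deriv (fun t => pderiv j (fun θ'' => logLik n θ'' x) (Function.update θ i t)) (θ i) := rfl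
  rw [h0, he.deriv_eq]
  refine HasDerivAt.deriv (HasDerivAt.fun_sum fun k _ => ?_)
  exact D.ratio_deriv hn' hθ (D.Q_pos hn hθ (hx k)).ne' i (D.d2 j i)

/-! ### Matrix sandwich -/

lemma sandwich (u M : Matrix (Fin 3) (Fin 3) ℝ) (ρ : Fin 3 → ℝ) {S : ℝ}
    (hu : ∀ i a, |u i a| ≤ ρ i) (hM : ∀ i j, ρ i * ρ j * |M i j| ≤ S) :
    frobNorm (uᵀ * M * u) ≤ 27 * S := by
  have hρ : ∀ i, 0 ≤ ρ i := fun i => (abs_nonneg _).trans (hu i 0)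
  have hS : 0 ≤ S := (by have := hρ 0; positivity : 0 ≤ ρ 0 * ρ 0 * |M 0 0|).trans (hM 0 0)
  have hent : ∀ a b, |(uᵀ * M * u) a b| ≤ 9 * S := by
    intro a b
    have h1 : (uᵀ * M * u) a b = ∑ j, ∑ i, u i a * M i j * u j b := by
      simp [Matrix.mul_apply, Finset.sum_mul]
    rw [h1]
    calc _ ≤ ∑ j : Fin 3, |∑ i, u i a * M i j * u j b| := Finset.abs_sum_le_sum_abs _ _
      _ ≤ ∑ j : Fin 3, ∑ i : Fin 3, |u i a * M i j * u j b| :=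
          Finset.sum_le_sum fun j _ => Finset.abs_sum_le_sum_abs _ _
      _ ≤ ∑ j : Fin 3, ∑ i : Fin 3, S := by
          refine Finset.sum_le_sum fun j _ => Finset.sum_le_sum fun i _ => ?_
          refine le_trans ?_ (hM i j)
          rw [abs_mul, abs_mul]
          have h2 := hu i a
          have h3 := hu j b
          have h4 := hρ i
          calc |u i a| * |M i j| * |u j b| ≤ ρ i * |M i j| * ρ j := by gcongr
            _ = _ := by ring
      _ = _ := by simp; ring
  unfold frobNorm
  refine Real.sqrt_le_iff.2 ⟨by positivity, ?_⟩
  calc _ ≤ ∑ i : Fin 3, ∑ j : Fin 3, (9 * S) ^ 2 := by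
        refine Finset.sum_le_sum fun i _ => Finset.sum_le_sum fun j _ => ?_
        rw [← sq_abs]
        exact pow_le_pow_left₀ (abs_nonneg _) (hent i j) 2
    _ = _ := by simp; ring

/-! ### Increment of the Hessian on the box -/

def ee (P : Ctx) (n : ℕ) (i : Fin 3) : ℝ :=
  if i = 0 then (n : ℝ) ^ (-(1 / 2) : ℝ) else (n : ℝ) ^ (-P.a0 / 4 + P.τ)

lemma ee_pos (P : Ctx) {n : ℕ} (hn : 1 ≤ n) (i : Fin 3) : 0 < ee P n i := by
  have hn0 : (0 : ℝ) < n := by exact_mod_cast hn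
  unfold ee; split_ifs <;> positivity

lemma ee_le (P : Ctx) {n : ℕ} (hn : 1 ≤ n) (i : Fin 3) :
    ee P n i ≤ (n : ℝ) ^ (-P.a0 / 4 + P.τ) := by
  have hn1 : (1 : ℝ) ≤ n := by exact_mod_cast hn
  unfold ee; split_ifs
  · exact Real.rpow_le_rpow_of_exponent_le hn1 (by have := P.ha2; have := P.hτ; linarith)
  · exact le_rfl

lemma ee_RR (P : Ctx) {n : ℕ} (hn : 1 ≤ n) (i j l : Fin 3) (x : ℝ) :
    mm P n ^ 3 * (ee P n i * ee P n j * ee P n l * RR i j l (zz P n x P.s0)) ≤ Tn P n x := by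
  have hn0 : (0 : ℝ) < n := by exact_mod_cast hn
  have hm := mm_ge P hn
  have hz := zz_pos P hn x P.s0
  unfold Tn
  refine mul_le_mul_of_nonneg_left ?_ (by positivity)
  unfold RR
  split_ifs with h
  · obtain ⟨rfl, rfl, rfl⟩ := h
    have : ee P n 0 = (n : ℝ) ^ (-(1 / 2) : ℝ) := by simp [ee]
    rw [this]
    have h2 : 0 ≤ ((n : ℝ) ^ (-P.a0 / 4 + P.τ)) ^ 3 * zz P n x P.s0 := by positivity
    linarith [show ((n : ℝ) ^ (-(1 / 2) : ℝ)) ^ 3 = (n : ℝ) ^ (-(1 / 2) : ℝ) * (n : ℝ) ^ (-(1 / 2) : ℝ) * (n : ℝ) ^ (-(1 / 2) : ℝ) * 1 by ring]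
  · have h1 := ee_pos P hn i
    have h2 := ee_pos P hn j
    have h3 := ee_pos P hn l
    have h1' := ee_le P hn i
    have h2' := ee_le P hn j
    have h3' := ee_le P hn l
    set b := (n : ℝ) ^ (-P.a0 / 4 + P.τ) with hb
    have hb0 : 0 < b := by positivity
    have : ee P n i * ee P n j * ee P n l ≤ b ^ 3 :=
      calc _ ≤ b * b * b := by gcongr
        _ = _ := by ring
    have h4 : 0 ≤ ((n : ℝ) ^ (-(1 / 2) : ℝ)) ^ 3 := by positivity
    have := mul_le_mul_of_nonneg_right this hz.le
    linarith

lemma RR_scale (i j l : Fin 3) {z z' C : ℝ} (hC : 1 ≤ C) (h : z ≤ C * z') :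
    RR i j l z ≤ C * RR i j l z' := by
  unfold RR; split_ifs <;> linarith

lemma box_bound {P : Ctx} (D : QD P) {c : ℝ} (hc : 1 ≤ c) : ∃ C > 0, ∀ n : ℕ, D.N ≤ n →
    (∀ θ, Bx (fun i => c * ee P n i) P.th θ → P.V θ) → ∀ x : ℝ, |x| ≤ (n : ℝ) ^ P.K →
    ∀ i j θ, Bx (fun i => c * ee P n i) P.th θ →
    (c * ee P n i) * (c * ee P n j) * |D.A i j n x θ - D.A i j n x P.th| ≤ C * Tn P n x := by
  obtain ⟨C1, hC1, H1⟩ := Eg_cmp P c (by linarith)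
  set C2 := D.C + 3 * D.C ^ 2 + 2 * D.C ^ 3 with hC2
  have hC20 : 0 ≤ C2 := by have := D.hC; positivity
  refine ⟨c ^ 3 * (C2 + 1) * (C1 + 1) * 3, by positivity, fun n hn hV x hx i j θ hθ => ?_⟩
  have hn' : 1 ≤ n := D.hN.trans hn
  have hm := mm_ge P hn'
  have hz0 := zz_pos P hn' x P.s0
  have hRR0 : ∀ l, 0 ≤ RR i j l (zz P n x P.s0) := fun l => by
    unfold RR; split_ifs <;> linarith
  set ρ : Fin 3 → ℝ := fun i => c * ee P n i with hρ
  have hρ0 : ∀ l, 0 < ρ l := fun l => by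
    have := ee_pos P hn' l
    simp only [hρ]; positivity
  have hz : ∀ θ', Bx ρ P.th θ' → zz P n x (θ' 0) ≤ (C1 + 1) * zz P n x P.s0 := by
    intro θ' hb
    have hv := hV _ hb
    have hv0 := P.th_V
    have hb0 := hb 0
    have hNt := NN_pos P hn' x (θ' 0)
    have hNs := NN_pos P hn' x P.s0
    have hZ := ZZ_pos P hn' x
    have h := H1 n hn' x (θ' 0) P.s0 hv.1 hv.2.1 hv0.1 hv0.2.1
      (by simpa [hρ, ee, th0] using hb0)
    unfold zz
    rw [div_le_iff₀ hNt, ← mul_div_assoc, div_mul_eq_mul_div, le_div_iff₀ hNs]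
    calc ZZ P n x * NN P n x P.s0 ≤ ZZ P n x * (C1 * NN P n x (θ' 0)) := by gcongr
      _ ≤ _ := by nlinarith [mul_pos hZ hNt]
  have ht := tele (fun θ => D.A i j n x θ) (fun l θ => D.B i j l n x θ) ρ P.th
    (fun l => C2 * (mm P n ^ 3 * ((C1 + 1) * RR i j l (zz P n x P.s0))))
    (fun l => by have := hRR0 l; positivity) (fun l => (hρ0 l).le)
    (fun θ' hb l => ⟨D.A_deriv hn' (hV _ hb) (D.Q_pos hn (hV _ hb) hx).ne' i j l, by
      refine (D.B_bound i j l n hn x θ' (hV _ hb) hx).trans ?_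
      gcongr
      exact RR_scale i j l (by linarith) (hz _ hb)⟩) hθ
  have hT := Tn_nonneg P hn' x
  have key : ∀ l, ρ i * ρ j * (C2 * (mm P n ^ 3 * ((C1 + 1) * RR i j l (zz P n x P.s0))) * ρ l) ≤
      c ^ 3 * (C2 + 1) * (C1 + 1) * Tn P n x := by
    intro l
    have h := ee_RR P hn' i j l x
    have e1 : ρ i * ρ j * (C2 * (mm P n ^ 3 * ((C1 + 1) * RR i j l (zz P n x P.s0))) * ρ l) =
        c ^ 3 * C2 * (C1 + 1) *
          (mm P n ^ 3 * (ee P n i * ee P n j * ee P n l * RR i j l (zz P n x P.s0))) := by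
      simp only [hρ]; ring
    rw [e1]
    calc _ ≤ c ^ 3 * C2 * (C1 + 1) * Tn P n x := by gcongr
      _ ≤ _ := by gcongr; linarith
  calc _ ≤ ρ i * ρ j * _ :=
        mul_le_mul_of_nonneg_left ht (mul_pos (hρ0 i) (hρ0 j)).le
    _ ≤ _ := by linarith [key 0, key 1, key 2]



/-! ### The normalising matrix and the final assembly -/

lemma log_ge_one {n : ℕ} (hn : 3 ≤ n) : 1 ≤ Real.log n := by
  have h3 : (3 : ℝ) ≤ n := by exact_mod_cast hn
  rw [Real.le_log_iff_exp_le (by linarith)]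
  linarith [Real.exp_one_lt_d9]

lemma un_bound (P : Ctx) : ∃ C ≥ 1, ∀ n : ℕ, 3 ≤ n → ∀ i a, |un n P.th i a| ≤ C * ee P n i := by
  have hd := P.hd; have ha := P.ha; have hτ := P.hτ; have ha2 := P.ha2
  set κ := P.d0 / (2 * P.a0) with hκ
  have hκ0 : 0 < κ := by positivity
  set C := 1 + (1 + κ) * (4 / P.τ ^ 2) with hC
  have hC1 : 1 ≤ C := by rw [hC]; have : 0 < (1 + κ) * (4 / P.τ ^ 2) := by positivity
                         linarith
  refine ⟨C, hC1, fun n hn i a => ?_⟩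
  have hn0 : (0 : ℝ) < n := by exact_mod_cast (by omega : 0 < n)
  have hl := log_ge_one hn
  set L := Real.log n with hL
  have hL0 : 0 < L := by linarith
  have hLL : 0 ≤ Real.log L := Real.log_nonneg hl
  have hLL2 : Real.log L ≤ L := (Real.log_le_sub_one_of_pos hL0).trans (by linarith)
  have hLr : L ≤ (n : ℝ) ^ (P.τ / 2) / (P.τ / 2) := Real.log_le_rpow_div hn0.le (by positivity)
  have hL2 : L ^ 2 ≤ 4 / P.τ ^ 2 * (n : ℝ) ^ P.τ := by
    calc L ^ 2 ≤ ((n : ℝ) ^ (P.τ / 2) / (P.τ / 2)) ^ 2 := by gcongr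
      _ = 4 / P.τ ^ 2 * ((n : ℝ) ^ (P.τ / 2) * (n : ℝ) ^ (P.τ / 2)) := by field_simp; ring
      _ = _ := by rw [← Real.rpow_add hn0]; congr 2; ring
  have hrate0 : 0 ≤ rate n P.a0 := by unfold rate; positivity
  have hrate : rate n P.a0 ≤ L * (n : ℝ) ^ (-P.a0 / 4) := by
    unfold rate
    rw [show (-P.a0 / 4) = -(P.a0 / 4) by ring, Real.rpow_neg hn0.le, div_eq_mul_inv]
    gcongr
    calc L ^ (P.a0 / 4) ≤ L ^ (1 : ℝ) := Real.rpow_le_rpow_of_exponent_le hl (by linarith)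
      _ = L := Real.rpow_one _
  have hn4 : 0 < (n : ℝ) ^ (-P.a0 / 4) := by positivity
  have hmain : L ^ 2 * (n : ℝ) ^ (-P.a0 / 4) ≤ 4 / P.τ ^ 2 * (n : ℝ) ^ (-P.a0 / 4 + P.τ) := by
    rw [Real.rpow_add hn0]
    calc _ ≤ (4 / P.τ ^ 2 * (n : ℝ) ^ P.τ) * (n : ℝ) ^ (-P.a0 / 4) := by gcongr
      _ = _ := by ring
  set e := (n : ℝ) ^ (-P.a0 / 4 + P.τ) with he
  have he0 : 0 < e := by positivity
  have hsmall : rate n P.a0 ≤ C * e := by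
    calc rate n P.a0 ≤ L * (n : ℝ) ^ (-P.a0 / 4) := hrate
      _ ≤ L ^ 2 * (n : ℝ) ^ (-P.a0 / 4) := by gcongr; nlinarith
      _ ≤ 4 / P.τ ^ 2 * e := hmain
      _ ≤ C * e := by
        gcongr
        rw [hC]
        have : 0 < κ * (4 / P.τ ^ 2) := by positivity
        linarith
  have hbig : |-(rate n P.a0 * κ * (L - Real.log L))| ≤ C * e := by
    rw [abs_neg, abs_of_nonneg (by have : 0 ≤ L - Real.log L := by linarith
                                   positivity)]
    calc rate n P.a0 * κ * (L - Real.log L) ≤ (L * (n : ℝ) ^ (-P.a0 / 4)) * κ * L := by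
          have h1 : 0 ≤ L - Real.log L := by linarith
          have h2 : L - Real.log L ≤ L := by linarith
          gcongr
      _ = κ * (L ^ 2 * (n : ℝ) ^ (-P.a0 / 4)) := by ring
      _ ≤ κ * (4 / P.τ ^ 2 * e) := by gcongr
      _ = κ * (4 / P.τ ^ 2) * e := by ring
      _ ≤ C * e := by
        gcongr
        rw [hC]
        have : 0 < (4 / P.τ ^ 2) := by positivity
        linarith
  have he1 : ee P n 1 = e := by simp [ee, he]
  have he2 : ee P n 2 = e := by simp [ee, he]
  have he3 : ee P n 0 = (n : ℝ) ^ (-(1 / 2) : ℝ) := by simp [ee]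
  have hs : (1 : ℝ) / Real.sqrt n = ee P n 0 := by
    rw [he3, Real.rpow_neg hn0.le, ← Real.sqrt_eq_rpow, one_div]
  have hp0 := ee_pos P (by omega : 1 ≤ n) 0
  have hCe : 0 ≤ C * e := by positivity
  have hCe0 : 0 ≤ C * ee P n 0 := by positivity
  have t1 : P.th 1 = P.d0 := rfl
  have t2 : P.th 2 = P.a0 := rfl
  have h00 : |(1 : ℝ) / Real.sqrt n| ≤ C * ee P n 0 := by
    rw [hs, abs_of_pos hp0]; nlinarith
  have h11 : |rate n P.a0| ≤ C * e := by rw [abs_of_nonneg hrate0]; exact hsmall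
  have e0 : un n P.th 0 = ![1 / Real.sqrt n, 0, 0] := rfl
  have e1 : un n P.th 1 = ![0, rate n P.a0, -(rate n P.a0 * κ * (L - Real.log L))] := rfl
  have e2 : un n P.th 2 = ![0, 0, rate n P.a0] := rfl
  rcases fin3_cases i with rfl | rfl | rfl
  · rw [e0]
    rcases fin3_cases a with rfl | rfl | rfl
    · exact h00
    · simpa using hCe0
    · simpa using hCe0
  · rw [e1, he1]
    rcases fin3_cases a with rfl | rfl | rfl
    · simpa using hCe
    · exact h11
    · exact hbig
  · rw [e2, he2]
    rcases fin3_cases a with rfl | rfl | rfl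
    · simpa using hCe
    · simpa using hCe
    · exact h11

lemma un_det (P : Ctx) {n : ℕ} (hn : 3 ≤ n) : IsUnit (un n P.th).det := by
  have hn0 : (0 : ℝ) < n := by exact_mod_cast (by omega : 0 < n)
  have hl := log_ge_one hn
  have hr : 0 < rate n (P.th 2) := by unfold rate; positivity
  have : (un n P.th).det = 1 / Real.sqrt n * rate n (P.th 2) * rate n (P.th 2) := by
    unfold un; rw [Matrix.det_fin_three]; simp
  rw [this]
  exact (by positivity : (1 / Real.sqrt n * rate n (P.th 2) * rate n (P.th 2)) ≠ 0).isUnit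

lemma abs_le_vecNorm (v : Fin 3 → ℝ) (i : Fin 3) : |v i| ≤ vecNorm v := by
  unfold vecNorm
  refine Real.abs_le_sqrt ?_
  exact Finset.single_le_sum (f := fun j => v j ^ 2) (fun j _ => sq_nonneg _) (Finset.mem_univ i)

lemma ball_box (P : Ctx) {n : ℕ} (hn : 3 ≤ n) {C r : ℝ} (hr : 0 < r)
    (hC : ∀ i a, |un n P.th i a| ≤ C * ee P n i) {θ : Fin 3 → ℝ}
    (hθ : vecNorm ((un n P.th)⁻¹.mulVec (θ - P.th)) ≤ r) :
    Bx (fun i => C * (3 * r + 1) * ee P n i) P.th θ := by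
  intro i
  set v := (un n P.th)⁻¹.mulVec (θ - P.th) with hv
  have h1 : θ - P.th = (un n P.th).mulVec v := by
    rw [hv, Matrix.mulVec_mulVec, Matrix.mul_nonsing_inv _ (un_det P hn), Matrix.one_mulVec]
  have h2 : θ i - P.th i = ∑ a, un n P.th i a * v a := by
    have := congrFun h1 i
    simpa [Matrix.mulVec, dotProduct] using this
  have h0 : 0 ≤ C * ee P n i := (abs_nonneg _).trans (hC i 0)
  rw [h2]
  calc _ ≤ ∑ a : Fin 3, |un n P.th i a * v a| := Finset.abs_sum_le_sum_abs _ _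
    _ ≤ ∑ a : Fin 3, C * ee P n i * r := by
        refine Finset.sum_le_sum fun a _ => ?_
        rw [abs_mul]
        have h3 := hC i a
        have h4 := (abs_le_vecNorm v a).trans hθ
        gcongr
    _ = 3 * (C * ee P n i * r) := by simp
    _ ≤ _ := by nlinarith

lemma box_V (P : Ctx) (c : ℝ) : ∀ᶠ n : ℕ in atTop,
    ∀ θ, Bx (fun i => c * ee P n i) P.th θ → P.V θ := by
  have hs := P.hs; have hd := P.hd; have hτ := P.hτ
  have h1 : Tendsto (fun n : ℕ => c * ee P n 0) atTop (𝓝 0) := by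
    have := (tendsto_rpow_neg_nat (e := -(1 / 2)) (by norm_num)).const_mul c
    simpa [ee] using this
  have hneg : -P.a0 / 4 + P.τ < 0 := by
    have := P.hτ3; have := P.K_pos; nlinarith [mul_pos P.K_pos hτ]
  have h2 : Tendsto (fun n : ℕ => c * ee P n 1) atTop (𝓝 0) := by
    have := (tendsto_rpow_neg_nat hneg).const_mul c
    simpa [ee] using this
  filter_upwards [h1.eventually (gt_mem_nhds (by linarith : 0 < P.s0 / 2)),
    h2.eventually (gt_mem_nhds (by linarith : 0 < P.d0 / 2)),
    h2.eventually (gt_mem_nhds hτ)] with n g1 g2 g3 θ hb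
  have b0 := abs_le.1 (hb 0)
  have b1 := abs_le.1 (hb 1)
  have b2 := abs_le.1 (hb 2)
  have e2 : ee P n 2 = ee P n 1 := by simp [ee]
  have t0 : P.th 0 = P.s0 := rfl
  have t1 : P.th 1 = P.d0 := rfl
  have t2 : P.th 2 = P.a0 := rfl
  simp only [e2, t0, t1, t2] at b0 b1 b2
  refine ⟨?_, ?_, ?_, ?_, ?_, ?_⟩ <;> linarith [b0.1, b0.2, b1.1, b1.2, b2.1, b2.2]

lemma main_ctx (P : Ctx) : ∀ r > (0 : ℝ), ∀ ε > (0 : ℝ),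
      Tendsto
        (fun n : ℕ => Pn n P.th
          {x | ε < ⨆ θ ∈ {θ' : Fin 3 → ℝ |
                vecNorm ((un n P.th)⁻¹.mulVec (θ' - P.th)) ≤ r},
              frobNorm ((un n P.th)ᵀ *
                (hessMat n θ x - hessMat n P.th x) * un n P.th)})
        atTop (𝓝 0) := by
  intro r hr ε hε
  obtain ⟨D⟩ := exists_QD P
  obtain ⟨C, hC1, hC⟩ := un_bound P
  set c := C * (3 * r + 1) with hc
  have hCc : C ≤ c := by rw [hc]; nlinarith
  obtain ⟨A, hA, HA⟩ := box_bound D (hC1.le.trans hCc)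
  have hsm := prob_small P (ε := ε / (27 * A)) (by positivity)
  refine tendsto_of_tendsto_of_tendsto_of_le_of_le' tendsto_const_nhds hsm
    (Eventually.of_forall fun n => zero_le) ?_
  filter_upwards [box_V P c, eventually_ge_atTop D.N, eventually_ge_atTop 3] with n hV hn hn3
  have hn' : 1 ≤ n := by omega
  refine measure_mono fun x hx => ?_
  by_contra hcon
  have hcon' := not_or.1 hcon
  rw [not_exists, not_le] at hcon'
  obtain ⟨hx1', hx2⟩ := hcon'
  have hx1 : ∀ k, |Real.sqrt n * x k| ≤ (n : ℝ) ^ P.K := fun k => not_lt.1 (hx1' k)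
  have hT : 0 ≤ ∑ k, Tn P n (Real.sqrt n * x k) := Finset.sum_nonneg fun k _ => Tn_nonneg P hn' _
  have hb0 : Bx (fun i => c * ee P n i) P.th P.th := fun i => by
    have := ee_pos P hn' i
    simp only [sub_self, abs_zero]
    have : 0 ≤ c := by linarith
    positivity
  have hsup : (⨆ θ ∈ {θ' : Fin 3 → ℝ | vecNorm ((un n P.th)⁻¹.mulVec (θ' - P.th)) ≤ r},
      frobNorm ((un n P.th)ᵀ * (hessMat n θ x - hessMat n P.th x) * un n P.th)) ≤
      27 * (A * ∑ k, Tn P n (Real.sqrt n * x k)) := by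
    refine Real.iSup_le (fun θ => Real.iSup_le (fun hθ => ?_) (by positivity)) (by positivity)
    have hb : Bx (fun i => c * ee P n i) P.th θ := ball_box P hn3 hr (hC n hn3) hθ
    refine sandwich _ _ (fun i => c * ee P n i) (fun i a => (hC n hn3 i a).trans ?_) (fun i j => ?_)
    · have := ee_pos P hn' i
      gcongr
    · rw [Matrix.sub_apply, hess_eq D hn hx1 (hV _ hb), hess_eq D hn hx1 (hV _ hb0),
        ← Finset.sum_sub_distrib, Finset.mul_sum]
      have e1 := ee_pos P hn' i
      have e2 := ee_pos P hn' j
      have hc0 : 0 < c := by linarith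
      calc _ ≤ (c * ee P n i) * (c * ee P n j) * ∑ k, |D.A i j n (Real.sqrt n * x k) θ -
            D.A i j n (Real.sqrt n * x k) P.th| := by
              gcongr
              exact Finset.abs_sum_le_sum_abs _ _
        _ = ∑ k, (c * ee P n i) * (c * ee P n j) * |D.A i j n (Real.sqrt n * x k) θ -
            D.A i j n (Real.sqrt n * x k) P.th| := Finset.mul_sum _ _ _
        _ ≤ _ := Finset.sum_le_sum fun k _ => HA n hn hV _ (hx1 k) i j θ hb
  have h3 : 27 * (A * ∑ k, Tn P n (Real.sqrt n * x k)) < ε := by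
    rw [lt_div_iff₀ (by positivity)] at hx2
    linarith
  exact absurd (lt_of_lt_of_le hx hsup) (not_lt.2 h3.le)

lemma exists_ctx (σ₀ δ₀ α₀ : ℝ) (hσ : 0 < σ₀) (hδ : 0 < δ₀) (hα : α₀ ∈ Set.Ioo (0 : ℝ) 2) :
    ∃ P : Ctx, P.th = ![σ₀, δ₀, α₀] := by
  obtain ⟨h0, h2⟩ := hα
  set K := 12 / α₀ with hK
  have hK0 : 0 < K := by positivity
  set g := min α₀ (1 - α₀ / 2) with hg
  have hg0 : 0 < g := lt_min h0 (by linarith)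
  have hg1 : g ≤ α₀ := min_le_left _ _
  have hg2 : g ≤ 1 - α₀ / 2 := min_le_right _ _
  set τ := g / (4 * (9 * K + 21)) with hτ
  have hτ0 : 0 < τ := by positivity
  have hτe : (9 * K + 21) * τ = g / 4 := by rw [hτ]; field_simp
  have hp := mul_pos hK0 hτ0
  refine ⟨{ s0 := σ₀, d0 := δ₀, a0 := α₀, τ := τ, K := K, hs := hσ, hd := hδ, ha := h0, ha2 := h2,
            hτ := hτ0, hτ1 := by nlinarith, hK := hK, hτ2 := by nlinarith, hτ3 := by nlinarith }, rfl⟩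


/-- uniform law of large numbers for the Hessian over the shrinking
neighborhoods `V_n^{(r)}`. -/
theorem statement2 (σ₀ δ₀ α₀ : ℝ) (hσ : 0 < σ₀) (hδ : 0 < δ₀) (hα : α₀ ∈ Set.Ioo (0 : ℝ) 2) :
    ∀ r > (0 : ℝ), ∀ ε > (0 : ℝ),
      Tendsto
        (fun n : ℕ => Pn n ![σ₀, δ₀, α₀]
          {x | ε < ⨆ θ ∈ {θ' : Fin 3 → ℝ |
                vecNorm ((un n ![σ₀, δ₀, α₀])⁻¹.mulVec (θ' - ![σ₀, δ₀, α₀])) ≤ r},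
              frobNorm ((un n ![σ₀, δ₀, α₀])ᵀ *
                (hessMat n θ x - hessMat n ![σ₀, δ₀, α₀] x) * un n ![σ₀, δ₀, α₀])})
        atTop (𝓝 0) := by
  obtain ⟨P, hP⟩ := exists_ctx σ₀ δ₀ α₀ hσ hδ hα
  rw [← hP]
  exact main_ctx P


end LevyLAN
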